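/- Let n ≥ 3 be an integer and p = (n+2)/(n−2). In the merged traveling-wave configuration with λ > 1 and λ' > 1, assume additionally there is M > 0 with v_λ(x) ≤ M e^x and v_{λ'}(x) ≤ M e^x for all x ≤ 0, and set v(x,τ) = min(u₁(x,τ), u₂(x,τ)) and d = (γ_λ γ_{λ'} + (p − 1))/p. Then there exist T ∈ (−∞, +∞], τ₀ < T, D > 0, and a function u : ℝ × (−∞, T) → ℝ such that: u is continuous, twice continuously differentiable in x and once continuously differentiable in τ; ∂_τ(u^p)(x,τ) = u_{xx}(x,τ) + u(x,τ)^p − u(x,τ) for all (x,τ) ∈ ℝ × (−∞, T); 0 < u(x,τ) ≤ v(x,τ) for all (x,τ) ∈ ℝ × (−∞, T); for each τ < T the function x ↦ (v^p − u^p)(x,τ) is Lebesgue integrable; and ∫_ℝ |v(x,τ)^p − u(x,τ)^p| dx ≤ D e^{dτ} for all τ ≤ τ₀. -/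

import Mathlib

open Real Filter Topology MeasureTheory

/-- A traveling-wave profile with speed `lam` for the cylindrical Yamabe-flow
equation `(u^p)_τ = u_{xx} + u^p - u`: it is `C²`, takes values in `(0,1]`,
is strictly increasing, solves `v'' + λ p v^{p-1} v' + v^p - v = 0`,
tends to `0` at `-∞` and to `1` at `+∞`. -/
def IsTWProfile (p lam : ℝ) (v : ℝ → ℝ) : Prop :=
  ContDiff ℝ 2 v ∧ (∀ x, 0 < v x) ∧ (∀ x, v x ≤ 1) ∧ (∀ x, 0 < deriv v x) ∧
  (∀ x, deriv (deriv v) x + lam * p * v x ^ (p - 1) * deriv v x + v x ^ p - v x = 0) ∧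
  Filter.Tendsto v Filter.atBot (nhds 0) ∧ Filter.Tendsto v Filter.atTop (nhds 1)

/-- The profile `v` has exponential asymptotics at `+∞` with rate `gam` and
constant `C`: `v(x) = 1 - C e^{-γ x} + o(e^{-γ x})` where `γ` is a root of the
characteristic equation `γ² - λ p γ + (p-1) = 0`. -/
def HasExpAsym (p lam gam C : ℝ) (v : ℝ → ℝ) : Prop :=
  0 < gam ∧ 0 < C ∧ gam ^ 2 - lam * p * gam + (p - 1) = 0 ∧
  Filter.Tendsto (fun x => Real.exp (gam * x) * (1 - v x)) Filter.atTop (nhds C)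

namespace AMS

/-- One-sided exponential average. -/
noncomputable def gP (r : ℝ) (h : ℝ → ℝ) (x : ℝ) : ℝ :=
  Real.exp (-(r * x)) * ∫ t in Set.Iic x, Real.exp (r * t) * h t

theorem gP_int {r : ℝ} (hr : 0 < r) {h : ℝ → ℝ} (hc : Continuous h) {N : ℝ}
    (hN : ∀ x, |h x| ≤ N) (x : ℝ) :
    IntegrableOn (fun t => Real.exp (r * t) * h t) (Set.Iic x) := by
  have h1 := integrableOn_exp_mul_Iic hr x
  refine Integrable.mono' (h1.mul_const N) ?_ ?_
  · exact Continuous.aestronglyMeasurable (by fun_prop)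
  · refine Eventually.of_forall fun t => ?_
    rw [Real.norm_eq_abs, abs_mul, abs_of_pos (Real.exp_pos _)]
    exact mul_le_mul_of_nonneg_left (hN t) (Real.exp_pos _).le

theorem gP_hasDerivAt {r : ℝ} (hr : 0 < r) {h : ℝ → ℝ} (hc : Continuous h) {N : ℝ}
    (hN : ∀ x, |h x| ≤ N) (x : ℝ) :
    HasDerivAt (gP r h) (h x - r * gP r h x) x := by
  have hI := gP_int hr hc hN
  have hcont : Continuous (fun t => Real.exp (r * t) * h t) := by fun_prop
  have e1 : (fun y => ∫ t in Set.Iic y, Real.exp (r * t) * h t) =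
      fun y => (∫ t in Set.Iic (0:ℝ), Real.exp (r * t) * h t) +
        ∫ t in (0:ℝ)..y, Real.exp (r * t) * h t := by
    funext y
    rw [← intervalIntegral.integral_Iic_sub_Iic (hI 0) (hI y)]; ring
  have d1 : HasDerivAt (fun y => ∫ t in Set.Iic y, Real.exp (r * t) * h t)
      (Real.exp (r * x) * h x) x := by
    rw [e1]
    refine HasDerivAt.const_add _ ?_
    exact intervalIntegral.integral_hasDerivAt_right (hcont.intervalIntegrable _ _)
      (hcont.stronglyMeasurableAtFilter _ _) hcont.continuousAt
  have d2 : HasDerivAt (fun y : ℝ => Real.exp (-(r * y))) (Real.exp (-(r*x)) * (-(r * 1))) x :=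
    (((hasDerivAt_id x).const_mul r).neg).exp
  have d3 := d2.mul d1
  have : Real.exp (-(r * x)) * (-(r * 1)) * (∫ t in Set.Iic x, Real.exp (r * t) * h t) +
      Real.exp (-(r * x)) * (Real.exp (r * x) * h x) = h x - r * gP r h x := by
    unfold gP
    rw [← mul_assoc (Real.exp (-(r * x))), ← Real.exp_add]
    simp; ring
  rw [this] at d3
  exact d3

theorem gP_mono {r : ℝ} (hr : 0 < r) {h k : ℝ → ℝ} (hc : Continuous h) (kc : Continuous k) {N : ℝ}
    (hN : ∀ x, |h x| ≤ N) (kN : ∀ x, |k x| ≤ N) (hk : ∀ x, h x ≤ k x) (x : ℝ) :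
    gP r h x ≤ gP r k x := by
  unfold gP
  refine mul_le_mul_of_nonneg_left ?_ (Real.exp_pos _).le
  refine setIntegral_mono (gP_int hr hc hN x) (gP_int hr kc kN x) fun t => ?_
  exact mul_le_mul_of_nonneg_left (hk t) (Real.exp_pos _).le

theorem gP_const {r : ℝ} (hr : 0 < r) (c x : ℝ) : gP r (fun _ => c) x = c / r := by
  unfold gP
  rw [integral_mul_const, integral_exp_mul_Iic hr, neg_eq_neg_one_mul, ← neg_eq_neg_one_mul, Real.exp_neg]
  field_simp

theorem gP_sub {r : ℝ} (hr : 0 < r) {h k : ℝ → ℝ} (hc : Continuous h) (kc : Continuous k) {N : ℝ}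
    (hN : ∀ x, |h x| ≤ N) (kN : ∀ x, |k x| ≤ N) (x : ℝ) :
    gP r (fun t => h t - k t) x = gP r h x - gP r k x := by
  unfold gP
  rw [← mul_sub, ← integral_sub (gP_int hr hc hN x) (gP_int hr kc kN x)]
  simp only [mul_sub]

theorem gP_pos {r : ℝ} (hr : 0 < r) {h : ℝ → ℝ} (hc : Continuous h) {N : ℝ}
    (hN : ∀ x, |h x| ≤ N) (hp : ∀ x, 0 < h x) (x : ℝ) : 0 < gP r h x := by
  unfold gP
  refine mul_pos (Real.exp_pos _) ?_
  rw [setIntegral_pos_iff_support_of_nonneg_ae]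
  · have : (Function.support fun t => Real.exp (r * t) * h t) = Set.univ := by
      ext t; simp [(hp t).ne']
    rw [this, Set.univ_inter, Real.volume_Iic]; simp
  · exact Eventually.of_forall fun t => (mul_pos (Real.exp_pos _) (hp t)).le
  · exact gP_int hr hc hN x

/-- Green operator of `r^2 - d^2/dx^2`. -/
noncomputable def gr (r : ℝ) (h : ℝ → ℝ) (x : ℝ) : ℝ :=
  (gP r h x + gP r (fun t => h (-t)) (-x)) / (2 * r)

noncomputable def gr' (r : ℝ) (h : ℝ → ℝ) (x : ℝ) : ℝ :=
  (gP r (fun t => h (-t)) (-x) - gP r h x) / 2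

theorem gQ_hasDerivAt {r : ℝ} {h : ℝ → ℝ} {N : ℝ} (hr : 0 < r) (hc : Continuous h) (hN : ∀ x, |h x| ≤ N)
    (x : ℝ) : HasDerivAt (fun y => gP r (fun t => h (-t)) (-y))
    (r * gP r (fun t => h (-t)) (-x) - h x) x := by
  have := (gP_hasDerivAt (h := fun t => h (-t)) hr (by fun_prop) (fun x => hN (-x)) (-x)).scomp x
    (hasDerivAt_neg x)
  refine HasDerivAt.congr_deriv (f := fun y => gP r (fun t => h (-t)) (-y)) this ?_
  simp

theorem gr_hasDerivAt {r : ℝ} {h : ℝ → ℝ} {N : ℝ} (hr : 0 < r) (hc : Continuous h) (hN : ∀ x, |h x| ≤ N)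
    (x : ℝ) : HasDerivAt (gr r h) (gr' r h x) x := by
  have h1 := gP_hasDerivAt hr hc hN x
  have h2 := gQ_hasDerivAt hr hc hN x
  have h3 := (h1.add h2).div_const (2 * r)
  refine HasDerivAt.congr_deriv (f := gr r h) h3 ?_
  unfold gr'; field_simp; ring

theorem gr'_hasDerivAt {r : ℝ} {h : ℝ → ℝ} {N : ℝ} (hr : 0 < r) (hc : Continuous h) (hN : ∀ x, |h x| ≤ N)
    (x : ℝ) : HasDerivAt (gr' r h) (r ^ 2 * gr r h x - h x) x := by
  have h1 := gP_hasDerivAt hr hc hN x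
  have h2 := gQ_hasDerivAt hr hc hN x
  have h3 := (h2.sub h1).div_const 2
  refine HasDerivAt.congr_deriv (f := gr' r h) h3 ?_
  unfold gr; field_simp; ring

theorem gr_mono {r : ℝ} {h : ℝ → ℝ} {k : ℝ → ℝ} {N : ℝ} (hr : 0 < r) (hc : Continuous h) (kc : Continuous k) (hN : ∀ x, |h x| ≤ N) (kN : ∀ x, |k x| ≤ N)
    (hk : ∀ x, h x ≤ k x) (x : ℝ) : gr r h x ≤ gr r k x := by
  unfold gr
  have h1 := gP_mono hr hc kc hN kN hk x
  have h2 := gP_mono (h := fun t => h (-t)) (k := fun t => k (-t)) hr (by fun_prop) (by fun_prop)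
    (fun x => hN (-x)) (fun x => kN (-x)) (fun x => hk (-x)) (-x)
  gcongr

theorem gr_pos {r : ℝ} {h : ℝ → ℝ} {N : ℝ} (hr : 0 < r) (hc : Continuous h) (hN : ∀ x, |h x| ≤ N)
    (hp : ∀ x, 0 < h x) (x : ℝ) : 0 < gr r h x := by
  unfold gr
  have h1 := gP_pos hr hc hN hp x
  have h2 := gP_pos (h := fun t => h (-t)) hr (by fun_prop) (fun x => hN (-x)) (fun x => hp (-x)) (-x)
  positivity

theorem gr_const {r : ℝ} (hr : 0 < r)
    (c x : ℝ) : gr r (fun _ => c) x = c / r ^ 2 := by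
  unfold gr
  rw [gP_const hr, gP_const hr]; field_simp; ring

theorem gr_sub {r : ℝ} {h : ℝ → ℝ} {k : ℝ → ℝ} {N : ℝ} (hr : 0 < r) (hc : Continuous h) (kc : Continuous k) (hN : ∀ x, |h x| ≤ N) (kN : ∀ x, |k x| ≤ N)
    (x : ℝ) : gr r (fun t => h t - k t) x = gr r h x - gr r k x := by
  unfold gr
  rw [gP_sub hr hc kc hN kN, gP_sub (h := fun t => h (-t)) (k := fun t => k (-t)) hr
    (by fun_prop) (by fun_prop) (fun x => hN (-x)) (fun x => kN (-x))]
  ring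

theorem gr_abs {r : ℝ} {h : ℝ → ℝ} {N : ℝ} (hr : 0 < r) (hc : Continuous h) (hN : ∀ x, |h x| ≤ N)
    (x : ℝ) : |gr r h x| ≤ N / r ^ 2 := by
  have hN0 : 0 ≤ N := (abs_nonneg _).trans (hN 0)
  rw [abs_le]
  constructor
  · have := gr_mono (h := fun _ => -N) hr continuous_const hc (N := N) (by simp [abs_of_nonneg hN0]) hN
      (fun x => (abs_le.1 (hN x)).1) x
    rw [gr_const hr] at this; linarith [neg_div (r^2) N]
  · have := gr_mono (k := fun _ => N) hr hc continuous_const (N := N) hN (by simp [abs_of_nonneg hN0])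
      (fun x => (abs_le.1 (hN x)).2) x
    rwa [gr_const hr] at this

end AMS

namespace AMS

theorem rpow_sub_le {p a b : ℝ} (hp : 1 < p) (ha : 0 ≤ a) (hab : a ≤ b) (hb : b ≤ 1) :
    b ^ p - a ^ p ≤ p * (b - a) := by
  rcases eq_or_lt_of_le (ha.trans hab) with h0 | h0
  · have : a = b := by linarith
    subst this; simp
  have h1 : 1 + p * (a / b - 1) ≤ (1 + (a / b - 1)) ^ p :=
    one_add_mul_self_le_rpow_one_add (by have : 0 ≤ a / b := by positivity
                                         linarith) hp.le
  have h2 : (1 + (a / b - 1)) = a / b := by ring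
  rw [h2, Real.div_rpow ha h0.le] at h1
  have hbp : 0 < b ^ p := Real.rpow_pos_of_pos h0 p
  have h3 : b ^ p * (1 + p * (a / b - 1)) ≤ a ^ p := by
    calc b ^ p * (1 + p * (a / b - 1)) ≤ b ^ p * (a ^ p / b ^ p) := by gcongr
      _ = a ^ p := by field_simp
  have h4 : b ^ p = b ^ (p - 1) * b := by
    rw [← Real.rpow_add_one h0.ne']; ring_nf
  have h5 : b ^ (p - 1) ≤ 1 := Real.rpow_le_one h0.le hb (by linarith)
  have h6 : b ^ p * (1 + p * (a / b - 1)) = b ^ p - p * b ^ (p - 1) * (b - a) := by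
    rw [h4]; field_simp
    ring
  have h7 : p * b ^ (p - 1) * (b - a) ≤ p * 1 * (b - a) := by
    have : 0 ≤ b - a := by linarith
    gcongr
  linarith

/-- clamp to `[0,1]` -/
noncomputable def cl (t : ℝ) : ℝ := max 0 (min t 1)

theorem cl_mem (t : ℝ) : 0 ≤ cl t ∧ cl t ≤ 1 :=
  ⟨le_max_left _ _, max_le zero_le_one (min_le_right _ _)⟩

theorem cl_cont : Continuous cl := by unfold cl; fun_prop

theorem cl_mono : Monotone cl := fun a b h => by unfold cl; gcongr

theorem cl_lip {a b : ℝ} (h : a ≤ b) : cl b - cl a ≤ b - a := by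
  unfold cl
  rcases le_total a 0 with h1 | h1 <;> rcases le_total b 0 with h2 | h2 <;>
  rcases le_total a 1 with h3 | h3 <;> rcases le_total b 1 with h4 | h4 <;>
  simp [*] <;> linarith

theorem cl_of_mem {t : ℝ} (h0 : 0 ≤ t) (h1 : t ≤ 1) : cl t = t := by
  unfold cl; simp [*]

noncomputable def Psi (p δ t : ℝ) : ℝ :=
  (1 + p / δ) * cl t - ((1 - δ) * cl t ^ p + δ * cl t) / δ

theorem Psi_cont {p δ : ℝ} (hp : 1 < p) : Continuous (Psi p δ) := by
  unfold Psi
  have h := cl_cont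
  have h2 : Continuous fun t => cl t ^ p := h.rpow_const fun x => Or.inr (by linarith)
  fun_prop

theorem Psi_bd {p δ : ℝ} (hp : 1 < p) (hδ : 0 < δ) (hδ1 : δ < 1) {a b : ℝ} (hab : a ≤ b) :
    0 ≤ Psi p δ b - Psi p δ a ∧ Psi p δ b - Psi p δ a ≤ p / δ * (b - a) := by
  have h1 := rpow_sub_le hp (cl_mem a).1 (cl_mono hab) (cl_mem b).2
  have h2 : cl a ^ p ≤ cl b ^ p := Real.rpow_le_rpow (cl_mem a).1 (cl_mono hab) (by linarith)
  have h3 := cl_lip hab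
  have h4 := cl_mono hab
  have e : Psi p δ b - Psi p δ a = (p * (cl b - cl a) - (1 - δ) * (cl b ^ p - cl a ^ p)) / δ := by
    unfold Psi; field_simp; ring
  rw [e]
  constructor
  · apply div_nonneg _ hδ.le
    nlinarith
  · rw [div_mul_eq_mul_div]
    gcongr
    nlinarith

theorem Psi_zero {p δ : ℝ} (hp : 1 < p) : Psi p δ 0 = 0 := by
  have : cl 0 = 0 := cl_of_mem le_rfl zero_le_one
  unfold Psi; rw [this, Real.zero_rpow (by linarith)]; simp

theorem Psi_one {p δ : ℝ} (hδ : 0 < δ) : Psi p δ 1 = 1 + p / δ - 1 / δ := by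
  have : cl 1 = 1 := cl_of_mem zero_le_one le_rfl
  unfold Psi; rw [this, Real.one_rpow]; field_simp; ring

theorem Psi_le_one {p δ : ℝ} (hp : 1 < p) (hδ : 0 < δ) (hδ1 : δ < 1) (t : ℝ) :
    0 ≤ Psi p δ t ∧ Psi p δ t ≤ Psi p δ 1 := by
  have e : ∀ t, Psi p δ t = Psi p δ (cl t) := fun t => by
    unfold Psi; rw [cl_of_mem (cl_mem t).1 (cl_mem t).2]
  rw [e t]
  have h1 := (Psi_bd hp hδ hδ1 (cl_mem t).1).1
  have h2 := (Psi_bd hp hδ hδ1 (cl_mem t).2).1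
  rw [Psi_zero hp] at h1
  constructor <;> linarith

theorem step_exists {p δ : ℝ} (hp : 1 < p) (hδ : 0 < δ) (hδ1 : δ < 1) {g : ℝ → ℝ}
    (hg : Continuous g) (g0 : ∀ x, 0 < g x) (g1 : ∀ x, g x ≤ 1) :
    ∃ u u1 : ℝ → ℝ, (∀ x, 0 < u x) ∧ (∀ x, u x ≤ 1) ∧ (∀ x, HasDerivAt u (u1 x) x) ∧
      ∀ x, HasDerivAt u1 (((1 - δ) * u x ^ p + δ * u x - g x ^ p) / δ) x := by
  have hκ : 0 < 1 + p / δ := by positivity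
  set κ := 1 + p / δ with hκd
  set r := Real.sqrt κ with hr
  have hr0 : 0 < r := Real.sqrt_pos.2 hκ
  have hr2 : r ^ 2 = κ := Real.sq_sqrt hκ.le
  have hgp : Continuous fun x => g x ^ p := hg.rpow_const fun x => Or.inl (g0 x).ne'
  let H : (ℝ → ℝ) → ℝ → ℝ := fun u x => Psi p δ (u x) + g x ^ p / δ
  have Hc : ∀ u : ℝ → ℝ, Continuous u → Continuous (H u) := fun u hu =>
    ((Psi_cont hp).comp hu).add (hgp.div_const δ)
  have gp1 : ∀ x, 0 < g x ^ p ∧ g x ^ p ≤ 1 := fun x =>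
    ⟨Real.rpow_pos_of_pos (g0 x) p, Real.rpow_le_one (g0 x).le (g1 x) (by linarith)⟩
  have Hpos : ∀ u x, 0 < H u x := fun u x => by
    have := (Psi_le_one hp hδ hδ1 (u x)).1
    have := div_pos (gp1 x).1 hδ
    show 0 < Psi p δ (u x) + g x ^ p / δ
    linarith
  have Hle : ∀ u x, H u x ≤ κ := fun u x => by
    have h1 := (Psi_le_one hp hδ hδ1 (u x)).2
    rw [Psi_one hδ] at h1
    have : g x ^ p / δ ≤ 1 / δ := by gcongr; exact (gp1 x).2
    show Psi p δ (u x) + g x ^ p / δ ≤ κ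
    linarith
  have Hab : ∀ u x, |H u x| ≤ κ := fun u x => by
    rw [abs_of_pos (Hpos u x)]; exact Hle u x
  let T : BoundedContinuousFunction ℝ ℝ → BoundedContinuousFunction ℝ ℝ := fun u =>
    BoundedContinuousFunction.ofNormedAddCommGroup (gr r (H u))
      (continuous_iff_continuousAt.2 fun x =>
        (gr_hasDerivAt hr0 (Hc u u.continuous) (Hab u) x).continuousAt) (κ / r ^ 2)
      (fun x => gr_abs hr0 (Hc u u.continuous) (Hab u) x)
  have hK0 : 0 ≤ (p / δ) / κ := by positivity
  have hT : ContractingWith ⟨(p / δ) / κ, hK0⟩ T := by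
    constructor
    · have h : (p / δ) / κ < 1 := by
        rw [div_lt_one hκ]; linarith
      exact h
    · refine LipschitzWith.of_dist_le_mul fun u v => ?_
      rw [BoundedContinuousFunction.dist_le (by positivity)]
      intro x
      show dist (gr r (H u) x) (gr r (H v) x) ≤ (p / δ) / κ * dist u v
      rw [Real.dist_eq, ← gr_sub hr0 (Hc u u.continuous) (Hc v v.continuous) (Hab u) (Hab v)]
      have := gr_abs (h := fun t => H u t - H v t) (N := p / δ * dist u v) hr0
        ((Hc u u.continuous).sub (Hc v v.continuous)) (fun t => ?_) x
      · rw [hr2] at this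
        calc _ ≤ _ := this
          _ = _ := by ring
      · show |(Psi p δ (u t) + g t ^ p / δ) - (Psi p δ (v t) + g t ^ p / δ)| ≤ _
        have hd : |u t - v t| ≤ dist u v := by
          rw [← Real.dist_eq]; exact BoundedContinuousFunction.dist_coe_le_dist t
        have hpd : 0 ≤ p / δ := by positivity
        have key : |(Psi p δ (u t) + g t ^ p / δ) - (Psi p δ (v t) + g t ^ p / δ)|
            ≤ p / δ * |u t - v t| := by
          rcases le_total (u t) (v t) with h | h
          · obtain ⟨h1, h2⟩ := Psi_bd hp hδ hδ1 h
            rw [abs_of_nonpos (by linarith), abs_of_nonpos (by linarith)]; linarith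
          · obtain ⟨h1, h2⟩ := Psi_bd hp hδ hδ1 h
            rw [abs_of_nonneg (by linarith), abs_of_nonneg (by linarith)]; linarith
        exact key.trans (by gcongr)
  obtain ⟨u, hu⟩ : ∃ u, T u = u := ⟨_, hT.fixedPoint_isFixedPt⟩
  have hux : ∀ x, u x = gr r (H u) x := fun x => by
    have := DFunLike.congr_fun hu x
    exact this.symm
  have u0 : ∀ x, 0 < u x := fun x => by
    rw [hux]; exact gr_pos hr0 (Hc u u.continuous) (Hab u) (Hpos u) x
  have u1 : ∀ x, u x ≤ 1 := fun x => by
    rw [hux]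
    have := (le_abs_self _).trans (gr_abs hr0 (Hc u u.continuous) (Hab u) x)
    rwa [hr2, div_self hκ.ne'] at this
  have huf : (u : ℝ → ℝ) = gr r (H u) := funext hux
  refine ⟨u, gr' r (H u), u0, u1, fun x => ?_, fun x => ?_⟩
  · have := gr_hasDerivAt hr0 (Hc u u.continuous) (Hab u) x
    rwa [← huf] at this
  · refine (gr'_hasDerivAt hr0 (Hc u u.continuous) (Hab u) x).congr_deriv ?_
    rw [← hux, hr2]
    show κ * u x - (Psi p δ (u x) + g x ^ p / δ) = _
    unfold Psi
    rw [cl_of_mem (u0 x).le (u1 x), ← hκd]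
    field_simp
    ring

end AMS

namespace AMS

theorem max_second {F F1 : ℝ → ℝ} {F2 x0 : ℝ} (hF : ∀ x, HasDerivAt F (F1 x) x)
    (hF1 : HasDerivAt F1 F2 x0) (hmax : ∀ y, F y ≤ F x0) : F1 x0 = 0 ∧ F2 ≤ 0 := by
  have h0 : F1 x0 = 0 := by
    have : IsLocalMax F x0 := Eventually.of_forall hmax
    exact this.hasDerivAt_eq_zero (hF x0)
  refine ⟨h0, ?_⟩
  by_contra hlt
  push Not at hlt
  have h1 : ∀ᶠ y in 𝓝[>] x0, 0 < F1 y := by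
    have h2 := (hasDerivAt_iff_tendsto_slope.1 hF1).eventually (lt_mem_nhds hlt)
    have h3 : 𝓝[>] x0 ≤ 𝓝[≠] x0 := nhdsWithin_mono _ fun y hy => ne_of_gt hy
    filter_upwards [h3 h2, self_mem_nhdsWithin] with y hy hy2
    have hy2' : 0 < y - x0 := sub_pos.2 hy2
    rw [slope_def_field, h0, sub_zero] at hy
    exact (div_pos_iff_of_pos_right hy2').1 hy
  obtain ⟨b, hb, hbs⟩ := mem_nhdsGT_iff_exists_Ioo_subset.1 h1
  have hb' : x0 < b := hb
  obtain ⟨c, hc, hcd⟩ := exists_hasDerivAt_eq_slope F F1 (show x0 < (x0 + b) / 2 by linarith)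
    (fun x _ => (hF x).continuousAt.continuousWithinAt) (fun x _ => hF x)
  have hpos : 0 < F1 c := hbs ⟨hc.1, by linarith [hc.2]⟩
  rw [hcd] at hpos
  have := (div_pos_iff_of_pos_right (show 0 < (x0 + b) / 2 - x0 by linarith)).1 hpos
  linarith [hmax ((x0 + b) / 2)]

/-- A function that is eventually bounded by `K` and exceeds `K` somewhere attains its maximum. -/
theorem exists_max {F : ℝ → ℝ} (hF : Continuous F) {K x1 : ℝ} (h1 : K < F x1)
    (hK : ∀ᶠ x in cocompact ℝ, F x ≤ K) : ∃ x0, (∀ y, F y ≤ F x0) ∧ F x1 ≤ F x0 := by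
  obtain ⟨x0, h0⟩ := hF.exists_forall_ge' x1 (hK.mono fun x hx => hx.trans h1.le)
  exact ⟨x0, h0, h0 x1⟩

theorem abs_le_cosh (x : ℝ) : |x| / 2 ≤ Real.cosh x := by
  rw [← Real.cosh_abs, Real.cosh_eq]
  have := Real.add_one_le_exp |x|
  have := Real.exp_pos (-|x|)
  linarith

theorem tendsto_abs_coc : Tendsto (fun x : ℝ => |x|) (cocompact ℝ) atTop := by
  exact tendsto_norm_cocompact_atTop (E := ℝ)

theorem nonpos_of_sub {z z1 z2 : ℝ → ℝ} (h1 : ∀ x, HasDerivAt z (z1 x) x)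
    (h2 : ∀ x, HasDerivAt z1 (z2 x) x) (h : ∀ x, 0 < z x → z x ≤ z2 x) {N : ℝ}
    (hN : ∀ x, z x ≤ N) (x : ℝ) : z x ≤ 0 := by
  by_contra hx
  push Not at hx
  have hc := Real.cosh_pos x
  set ε := z x / (2 * Real.cosh x) with hε
  have hε0 : 0 < ε := by positivity
  have hF : ∀ y, HasDerivAt (fun y => z y - ε * Real.cosh y) (z1 y - ε * Real.sinh y) y := fun y =>
    (h1 y).sub ((Real.hasDerivAt_cosh y).const_mul ε)
  have hF1 : ∀ y, HasDerivAt (fun y => z1 y - ε * Real.sinh y) (z2 y - ε * Real.cosh y) y := fun y =>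
    (h2 y).sub ((Real.hasDerivAt_sinh y).const_mul ε)
  have hpos : 0 < z x - ε * Real.cosh x := by
    have : ε * Real.cosh x = z x / 2 := by rw [hε]; field_simp
    linarith
  obtain ⟨x0, hm, hx0⟩ := exists_max (F := fun y => z y - ε * Real.cosh y) (K := 0) (x1 := x)
    (continuous_iff_continuousAt.2 fun y => (hF y).continuousAt) hpos (by
      filter_upwards [tendsto_abs_coc.eventually_ge_atTop (2 * N / ε)] with y hy
      have h3 := abs_le_cosh y
      have h4 : N ≤ ε * Real.cosh y := by
        have : ε * (2 * N / ε / 2) ≤ ε * Real.cosh y := by gcongr; linarith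
        have e : ε * (2 * N / ε / 2) = N := by field_simp
        linarith
      linarith [hN y])
  obtain ⟨-, h5⟩ := max_second hF (hF1 x0) hm
  have h6 := Real.cosh_pos x0
  have h7 : 0 < z x0 := by nlinarith [mul_pos hε0 h6]
  have := h x0 h7
  linarith

theorem rpow_strict {p : ℝ} (hp : 1 < p) {a b : ℝ} (ha : 0 ≤ a) (hab : a < b) : a ^ p < b ^ p :=
  Real.rpow_lt_rpow ha hab (by linarith)

/-- Comparison principle for one implicit step. -/
theorem step_compare {p δ : ℝ} (hp : 1 < p) (hδ : 0 < δ) (hδ1 : δ < 1) {u u1 u2 w w1 w2 : ℝ → ℝ}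
    (hu : ∀ x, HasDerivAt u (u1 x) x) (hu1 : ∀ x, HasDerivAt u1 (u2 x) x)
    (hw : ∀ x, HasDerivAt w (w1 x) x) (hw1 : ∀ x, HasDerivAt w1 (w2 x) x)
    {N : ℝ} (hN : ∀ x, u x ≤ N) (w0 : ∀ x, 0 < w x)
    (h : ∀ x, (1 - δ) * u x ^ p + δ * u x - δ * u2 x ≤ (1 - δ) * w x ^ p + δ * w x - δ * w2 x)
    (x : ℝ) : u x ≤ w x := by
  have := nonpos_of_sub (z := fun x => u x - w x) (fun x => (hu x).sub (hw x))
    (fun x => (hu1 x).sub (hw1 x)) (fun x hx => ?_) (N := N) (fun x => by linarith [hN x, w0 x]) x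
  · linarith
  · have h1 := h x
    have h2 := rpow_strict hp (w0 x).le (show w x < u x by linarith)
    have h3 : (1 - δ) * w x ^ p ≤ (1 - δ) * u x ^ p :=
      mul_le_mul_of_nonneg_left h2.le (by linarith)
    have h4 : δ * (u x - w x) ≤ δ * (u2 x - w2 x) := by linarith
    exact le_of_mul_le_mul_left h4 hδ

/-- A gradient bound for positive functions on the line. -/
theorem deriv_le_self {g g1 g2 : ℝ → ℝ} (h1 : ∀ x, HasDerivAt g (g1 x) x)
    (h2 : ∀ x, HasDerivAt g1 (g2 x) x) (g0 : ∀ x, 0 < g x) (h : ∀ x, g2 x ≤ g x) (x : ℝ) :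
    g1 x ≤ g x := by
  by_contra hx
  push Not at hx
  have hexp : ∀ y, HasDerivAt (fun y : ℝ => Real.exp y) (Real.exp y) y := fun y => Real.hasDerivAt_exp y
  have hφ : ∀ y, HasDerivAt (fun y => Real.exp y * (g y - g1 y))
      (Real.exp y * (g y - g1 y) + Real.exp y * (g1 y - g2 y)) y := fun y =>
    (hexp y).mul ((h1 y).sub (h2 y))
  have mono : Monotone fun y => Real.exp y * (g y - g1 y) := by
    refine monotone_of_hasDerivAt_nonneg hφ fun y => ?_
    have := mul_nonneg (Real.exp_pos y).le (sub_nonneg.2 (h y))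
    show 0 ≤ Real.exp y * (g y - g1 y) + Real.exp y * (g1 y - g2 y)
    linarith
  set c := Real.exp x * (g1 x - g x) with hc
  have hc0 : 0 < c := mul_pos (Real.exp_pos _) (by linarith)
  have hψ : ∀ y, HasDerivAt (fun y => Real.exp (-y) * g y + c / 2 * Real.exp (-(2 * y)))
      ((Real.exp (-y) * (-1)) * g y + Real.exp (-y) * g1 y
        + c / 2 * (Real.exp (-(2 * y)) * (-(2 * 1)))) y := fun y => by
    have a1 : HasDerivAt (fun y : ℝ => Real.exp (-y)) (Real.exp (-y) * (-1)) y :=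
      ((hasDerivAt_id y).neg).exp
    have a2 : HasDerivAt (fun y : ℝ => Real.exp (-(2 * y))) (Real.exp (-(2*y)) * (-(2 * 1))) y :=
      (((hasDerivAt_id y).const_mul 2).neg).exp
    exact (a1.mul (h1 y)).add (a2.const_mul _)
  have mono2 : MonotoneOn (fun y => Real.exp (-y) * g y + c / 2 * Real.exp (-(2 * y))) (Set.Iic x) := by
    refine monotoneOn_of_deriv_nonneg (convex_Iic x)
      (fun y _ => (hψ y).continuousAt.continuousWithinAt)
      (fun y _ => (hψ y).differentiableAt.differentiableWithinAt) fun y hy => ?_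
    rw [interior_Iic] at hy
    rw [(hψ y).deriv]
    have h3 := mono (show y ≤ x from (Set.mem_Iio.1 hy).le)
    simp only at h3
    have h4 : c ≤ Real.exp y * (g1 y - g y) := by linarith
    have e1 : Real.exp (-(2 * y)) * Real.exp y = Real.exp (-y) := by
      rw [← Real.exp_add]; ring_nf
    have h5 : Real.exp (-(2 * y)) * c ≤ Real.exp (-(2 * y)) * (Real.exp y * (g1 y - g y)) := by gcongr
    have h6 : Real.exp (-(2 * y)) * (Real.exp y * (g1 y - g y)) = Real.exp (-y) * (g1 y - g y) := by
      rw [← mul_assoc, e1]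
    rw [h6] at h5
    linarith
  have hbd : ∀ y ≤ x, c / 2 * Real.exp (-(2 * y)) ≤
      Real.exp (-x) * g x + c / 2 * Real.exp (-(2 * x)) := fun y hy => by
    have h3 := mono2 hy (Set.mem_Iic.2 le_rfl) hy
    simp only at h3
    have := mul_pos (Real.exp_pos (-y)) (g0 y)
    linarith
  set R := Real.exp (-x) * g x + c / 2 * Real.exp (-(2 * x)) with hR
  have hR0 : 0 < R := add_pos (mul_pos (Real.exp_pos _) (g0 x)) (by positivity)
  have h3 := hbd (min x (-(R / c))) (min_le_left _ _)
  have h4 : 2 * (R / c) + 1 ≤ Real.exp (-(2 * min x (-(R / c)))) := by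
    have := Real.add_one_le_exp (-(2 * min x (-(R / c))))
    have := min_le_right x (-(R / c))
    linarith
  have h5 : c / 2 * (2 * (R / c) + 1) ≤ R := (mul_le_mul_of_nonneg_left h4 (by positivity)).trans h3
  have h6 : c / 2 * (2 * (R / c) + 1) = R + c / 2 := by field_simp
  linarith

theorem abs_deriv_le_self {g g1 g2 : ℝ → ℝ} (h1 : ∀ x, HasDerivAt g (g1 x) x)
    (h2 : ∀ x, HasDerivAt g1 (g2 x) x) (g0 : ∀ x, 0 < g x) (h : ∀ x, g2 x ≤ g x) (x : ℝ) :
    |g1 x| ≤ g x := by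
  rw [abs_le]
  refine ⟨?_, deriv_le_self h1 h2 g0 h x⟩
  have := deriv_le_self (g := fun y => g (-y)) (g1 := fun y => - g1 (-y)) (g2 := fun y => g2 (-y))
    (fun y => by
      have := (h1 (-y)).scomp y (hasDerivAt_neg y)
      exact HasDerivAt.congr_deriv (f := fun y => g (-y)) this (by simp))
    (fun y => by
      have := ((h2 (-y)).scomp y (hasDerivAt_neg y)).neg
      exact HasDerivAt.congr_deriv (f := fun y => - g1 (-y)) this (by simp))
    (fun y => g0 _) (fun y => h _) (-x)
  simp only [neg_neg] at this
  linarith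

/-- Harnack inequality from a logarithmic gradient bound. -/
theorem harnack {g g1 : ℝ → ℝ} (h1 : ∀ x, HasDerivAt g (g1 x) x) (h : ∀ x, |g1 x| ≤ g x) (x y : ℝ) :
    g x * Real.exp (-|x - y|) ≤ g y := by
  have a1 : ∀ y : ℝ, HasDerivAt (fun y : ℝ => Real.exp (-y)) (Real.exp (-y) * (-1)) y := fun y =>
      ((hasDerivAt_id y).neg).exp
  have anti : Antitone fun y => Real.exp (-y) * g y := by
    refine antitone_of_hasDerivAt_nonpos (fun y => (a1 y).mul (h1 y)) fun y => ?_
    have := (abs_le.1 (h y)).2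
    have := mul_nonneg (Real.exp_pos (-y)).le (sub_nonneg.2 this)
    show Real.exp (-y) * (-1) * g y + Real.exp (-y) * g1 y ≤ 0
    linarith
  have mono : Monotone fun y => Real.exp y * g y := by
    refine monotone_of_hasDerivAt_nonneg (fun y => (Real.hasDerivAt_exp y).mul (h1 y)) fun y => ?_
    have := (abs_le.1 (h y)).1
    have := mul_nonneg (Real.exp_pos y).le (show 0 ≤ g y + g1 y by linarith)
    show 0 ≤ Real.exp y * g y + Real.exp y * g1 y
    linarith
  rcases le_total x y with hxy | hxy
  · rw [abs_of_nonpos (by linarith)]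
    have h3 := mono hxy
    simp only at h3
    have : Real.exp (-y) * (Real.exp x * g x) ≤ Real.exp (-y) * (Real.exp y * g y) := by gcongr
    rw [← mul_assoc, ← mul_assoc, ← Real.exp_add, ← Real.exp_add] at this
    simp only [neg_add_cancel, Real.exp_zero, one_mul] at this
    calc _ = _ := by rw [mul_comm]; ring_nf
      _ ≤ _ := this
  · rw [abs_of_nonneg (by linarith)]
    have h3 := anti hxy
    simp only at h3
    have : Real.exp y * (Real.exp (-x) * g x) ≤ Real.exp y * (Real.exp (-y) * g y) := by gcongr
    rw [← mul_assoc, ← mul_assoc, ← Real.exp_add, ← Real.exp_add] at this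
    simp only [add_neg_cancel, Real.exp_zero, one_mul] at this
    calc _ = _ := by rw [mul_comm]; ring_nf
      _ ≤ _ := this

end AMS

namespace AMS

/-- Logarithmic derivative data of a positive function. -/
structure Data (g s G J : ℝ → ℝ) : Prop where
  pos : ∀ x, 0 < g x
  d1 : ∀ x, HasDerivAt g (g x * s x) x
  d2 : ∀ x, HasDerivAt s (G x + 1 - s x ^ 2) x
  d3 : ∀ x, HasDerivAt G (J x) x

theorem Data.dd {g s G J : ℝ → ℝ} (h : Data g s G J) (x : ℝ) :
    HasDerivAt (fun x => g x * s x) (g x * (G x + 1)) x :=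
  ((h.d1 x).mul (h.d2 x)).congr_deriv (by ring)

theorem amul {a b A B : ℝ} (ha : |a| ≤ A) (hb : |b| ≤ B) : |a * b| ≤ A * B := by
  rw [abs_mul]; exact mul_le_mul ha hb (abs_nonneg _) ((abs_nonneg _).trans ha)

theorem aadd {a b A B : ℝ} (ha : |a| ≤ A) (hb : |b| ≤ B) : |a + b| ≤ A + B :=
  (abs_add_le a b).trans (add_le_add ha hb)

theorem asub {a b A B : ℝ} (ha : |a| ≤ A) (hb : |b| ≤ B) : |a - b| ≤ A + B :=
  (abs_sub a b).trans (add_le_add ha hb)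

noncomputable def cG (p : ℝ) : ℝ := 15 * p ^ 2 + 11 * p

theorem G_alg2 {p a : ℝ} (hp : 1 < p) (ha : 0 ≤ a) (h : (p + 1) * a ^ 2 ≤
    (2 * p ^ 2 + 4 * p) * (1 * (1 + a)) + (2 * p * 1 * (1 + a) + p * 1 * (1 + a)) *
      (1 * (p + 2) + 1 * (2 * p)) + 4 * p * a) : - -a ≤ 2 * cG p + 1 := by
  have hfin : (p + 1) * a ^ 2 ≤ cG p * (1 + a) := by
    have e : cG p * (1 + a) - ((2 * p ^ 2 + 4 * p) * (1 * (1 + a)) + (2 * p * 1 * (1 + a) + p * 1 * (1 + a)) * (1 * (p + 2) + 1 * (2 * p)) + 4 * p * a) = (4 * p ^ 2 + p) * (1 + a) - 4 * p * a := by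
        unfold cG; ring
    have e1 : 4 * p * a ≤ 4 * p ^ 2 * a := by
      have : p ≤ p ^ 2 := by nlinarith
      have := mul_le_mul_of_nonneg_right this ha
      linarith
    have e2 : 0 ≤ p * a := by positivity
    have e3 : 0 ≤ p ^ 2 := by positivity
    linarith
  have hc : 1 ≤ cG p := by unfold cG; nlinarith
  by_contra hcon
  push Not at hcon
  have h3 : 2 * cG p + 1 < a := by linarith
  have h4 : (2 * cG p + 1) * a ≤ a ^ 2 := by rw [pow_two]; gcongr
  have h5 : a ^ 2 ≤ (p + 1) * a ^ 2 := le_mul_of_one_le_left (sq_nonneg a) (by linarith)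
  have h6 : cG p * (1 + a) ≤ cG p * (a + a) := by gcongr; linarith
  linarith

theorem G_alg {p s sb G J X Z : ℝ} (hp : 1 < p) (hs : |s| ≤ 1) (hsb : |sb| ≤ 1) (hG : G ≤ 0)
    (hJ : J = 2 * p * s * (G + 1 - s ^ 2)) (hX : X = J - (p - 1) * s * G)
    (hZ : Z ≤ p * (X * (s + sb)))
    (hF : -((p - 1) * ((G + 1 - s ^ 2) * G + s * J) + (p * sb - s) * X + (Z - X * (s + sb)))
      + 2 * p * (G + 1 - s ^ 2) ^ 2 + 2 * p * s * (J - 2 * s * (G + 1 - s ^ 2)) ≤ 0) :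
    - G ≤ 2 * cG p + 1 := by
  obtain ⟨a, rfl⟩ : ∃ a, G = -a := ⟨-G, by ring⟩
  have ha : 0 ≤ a := by linarith
  have hs2 : s ^ 2 ≤ 1 := by rw [← sq_abs]; nlinarith [abs_nonneg s]
  have hs0 : 0 ≤ s ^ 2 := sq_nonneg s
  set σ := -a + 1 - s ^ 2 with hσ
  have hσb : |σ| ≤ 1 + a := abs_le.2 ⟨by linarith, by linarith⟩
  have hp' : |p| ≤ p := by rw [abs_of_pos (by linarith)]
  have hp1 : |p - 1| ≤ p := by rw [abs_of_pos (by linarith)]; linarith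
  have h2 : |(2:ℝ)| ≤ 2 := by norm_num
  have haa : |a| ≤ 1 + a := by rw [abs_of_nonneg ha]; linarith
  have hJb : |J| ≤ 2 * p * 1 * (1 + a) := by
    rw [hJ]; exact amul (amul (amul h2 hp') hs) hσb
  have hXb : |X| ≤ 2 * p * 1 * (1 + a) + p * 1 * (1 + a) := by
    rw [hX]; exact asub hJb (amul (amul hp1 hs) (by rw [abs_neg]; exact haa))
  have hbr : |s * (2 - p) + sb * (1 - 2 * p)| ≤ 1 * (p + 2) + 1 * (2 * p) :=
    aadd (amul hs (abs_le.2 ⟨by linarith, by linarith⟩))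
      (amul hsb (abs_le.2 ⟨by linarith, by linarith⟩))
  have hXbr := (abs_le.1 (amul hXb hbr)).1
  have e1 : |s * J| ≤ 1 * (2 * p * 1 * (1 + a)) := amul hs hJb
  have e1' : s * J = 2 * p * (s ^ 2 * σ) := by rw [hJ]; ring
  have e2 : |s ^ 2 * σ| ≤ 1 * (1 + a) := amul (by rw [abs_of_nonneg hs0]; exact hs2) hσb
  have e3 := (abs_le.1 e2).1
  have e4 := (abs_le.1 e2).2
  have e5 : 2 * p * σ ^ 2 + (p - 1) * σ * a ≥ (p + 1) * a ^ 2 - 4 * p * a := by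
    have h : 2 * p * σ ^ 2 + (p - 1) * σ * a - ((p + 1) * a ^ 2 - 4 * p * a)
       = 2 * p * (1 - s ^ 2) ^ 2 + 4 * p * a * s ^ 2 + (p - 1) * a * (1 - s ^ 2) := by
      rw [hσ]; ring
    have : 0 ≤ 2 * p * (1 - s ^ 2) ^ 2 + 4 * p * a * s ^ 2 + (p - 1) * a * (1 - s ^ 2) := by
      have h1 : 0 ≤ p - 1 := by linarith
      have h3 : 0 ≤ 1 - s ^ 2 := by linarith
      have h4 : 0 ≤ p := by linarith
      positivity
    linarith
  have key : (p + 1) * a ^ 2 - 4 * p * a + (2 * p * (2 * p) - 4 * p - (p - 1) * (2 * p)) * (s ^ 2 * σ)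
      + X * (s * (2 - p) + sb * (1 - 2 * p)) ≤ 0 := by
    have : 2 * p * s * (J - 2 * s * σ) = 2 * p * (2 * p * (s ^ 2 * σ)) - 4 * p * (s ^ 2 * σ) := by
      rw [hJ]; ring
    rw [e1', this] at hF
    have e8 : (p - 1) * (σ * -a + 2 * p * (s ^ 2 * σ)) = -((p - 1) * σ * a)
      + (p - 1) * (2 * p) * (s ^ 2 * σ) := by ring
    have e9 : (p * sb - s) * X + (Z - X * (s + sb)) ≤ -(X * (s * (2 - p) + sb * (1 - 2 * p))) := by
      have : p * (X * (s + sb)) + (p * sb - s) * X - X * (s + sb)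
        = -(X * (s * (2 - p) + sb * (1 - 2 * p))) := by ring
      linarith
    have e10 : (2 * p * (2 * p) - 4 * p - (p - 1) * (2 * p)) * (s ^ 2 * σ) = 2 * p * (2 * p * (s ^ 2 * σ))
      - 4 * p * (s ^ 2 * σ) - (p - 1) * (2 * p) * (s ^ 2 * σ) := by ring
    rw [e8] at hF
    rw [e10]
    linarith
  have e6 : |2 * p * (2 * p) - 4 * p - (p - 1) * (2 * p)| ≤ 2 * p ^ 2 + 4 * p := by
    refine abs_le.2 ⟨by nlinarith, by nlinarith⟩
  have e7 := (abs_le.1 (amul e6 e2)).1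
  exact G_alg2 hp ha (by linarith only [key, e7, hXbr])

noncomputable def N0 (p : ℝ) : ℝ := 2 * cG p + 2 + p

noncomputable def K1 (p N : ℝ) : ℝ :=
  (p * 1 + (2 * p + 2)) + (p * (2 * N) * N + (2 * p + 2) * (p * 1 * N)) + (2 * p + p * 1 + (p + 2))
  + (2 * p * (p * 1 + (2 * p + 2)) + p * (N + 2 * (2 * N)) + (p * (2 * N) + 2 * (2 * N))
      + (p + 2) * (p * 1))
  + (2 * p * (p * (2 * N) * N + (2 * p + 2) * (p * 1 * N)) + 2 * (p * 1 * N) * (2 * N)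
      + (p * (2 * N) + 2 * (2 * N)) * (p * 1 * N) + (p + 2) * (p * (2 * N) * N))
noncomputable def B1 (p N : ℝ) : ℝ := K1 p N ^ 2 / 4 + K1 p N + 1
noncomputable def K2 (p N : ℝ) : ℝ := K1 p N + B1 p N * N * K1 p N
noncomputable def Q1 (p N : ℝ) : ℝ := (2 * K2 p N + 1) ^ 2 + B1 p N * N ^ 2

theorem J_alg2 {N K B L J G α β κ c4 c5 : ℝ} (hN : 1 ≤ N) (hK : 1 ≤ K) (hB2 : B = K ^ 2 / 4 + K + 1)
    (hα' : |α| ≤ K) (hβ' : |β| ≤ K) (hκ' : |κ| ≤ K) (hc4' : |c4| ≤ K) (hc5' : |c5| ≤ K) (hG : |G| ≤ N)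
    (main : L * L + α * L * J + (B + β) * J ^ 2 + κ * J - B * G * c4 * J - B * G * c5 ≤ 0) :
    J ^ 2 + B * G ^ 2 ≤ (2 * (K + B * N * K) + 1) ^ 2 + B * N ^ 2 := by
  have hB : 1 ≤ B := by rw [hB2]; nlinarith
  have hN0 : 0 < N := by linarith
  have hL2 : -(K ^ 2 / 4 * J ^ 2) ≤ L * L + α * L * J := by
    have h1 : α ^ 2 ≤ K ^ 2 := sq_le_sq' (by linarith [(abs_le.1 hα').1]) (abs_le.1 hα').2
    have h2 := mul_le_mul_of_nonneg_right h1 (sq_nonneg J)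
    have h3 : 0 ≤ L * L + α * L * J + α ^ 2 * J ^ 2 / 4 := by
      have := sq_nonneg (L + α * J / 2)
      linarith
    linarith
  have hβ2 : -(K * J ^ 2) ≤ β * J ^ 2 := by nlinarith [sq_nonneg J, (abs_le.1 hβ').1]
  have hκ2 := (abs_le.1 (amul hκ' (le_refl |J|))).1
  have hBa : |B| ≤ B := by rw [abs_of_pos (by linarith)]
  have h4 := (abs_le.1 (amul (amul (amul hBa hG) hc4') (le_refl |J|))).2
  have h5 := (abs_le.1 (amul (amul hBa hG) hc5')).2
  have hJ2 : J ^ 2 ≤ (K + B * N * K) * (|J| + 1) := by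
    have e : J ^ 2 = (B - K ^ 2 / 4 - K) * J ^ 2 := by rw [hB2]; ring
    have e2 : (B + β) * J ^ 2 = B * J ^ 2 + β * J ^ 2 := by ring
    rw [e2] at main
    linarith only [main, e, hL2, hβ2, hκ2, h4, h5, hK]
  have hD : 1 ≤ K + B * N * K := by
    have : 0 < B * N * K := by positivity
    linarith
  obtain ⟨D, hDd⟩ : ∃ D, D = K + B * N * K := ⟨_, rfl⟩
  rw [← hDd] at hJ2 hD ⊢
  have hJ3 : |J| ≤ 2 * D + 1 := by
    by_contra hcon
    push Not at hcon
    rw [← sq_abs] at hJ2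
    nlinarith [abs_nonneg J]
  have hJ4 : J ^ 2 ≤ (2 * D + 1) ^ 2 := by
    rw [← sq_abs]; exact pow_le_pow_left₀ (abs_nonneg _) hJ3 2
  have hG2 : G ^ 2 ≤ N ^ 2 := by
    rw [← sq_abs]; exact pow_le_pow_left₀ (abs_nonneg _) hG 2
  have := mul_le_mul_of_nonneg_left hG2 (show 0 ≤ B by linarith)
  linarith

theorem J_alg {p N s sb G Gb σ σb J Jb L X Z θ : ℝ} (hp : 1 < p) (hN : 1 ≤ N)
    (hs : |s| ≤ 1) (hsb : |sb| ≤ 1) (hG : |G| ≤ N)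
    (hσ : |σ| ≤ 2 * N) (hσb : |σb| ≤ 2 * N) (hθ : 0 ≤ θ)
    (hX : X = J - (p - 1) * s * G) (hZ : Z = θ * (G - Gb))
    (hL : L = (p - 1) * (σ * G + s * J) + (p * sb - s) * X + (Z - X * (s + sb)))
    (hF : Jb ^ 2 + B1 p N * Gb ^ 2 ≤ J ^ 2 + B1 p N * G ^ 2)
    (hF2 : L * L + J * (((p * sb - s) * Z + θ * (J - Jb)) + (p - 1) * ((J - 2 * s * σ) * G + 2 * σ * J + s * L)
      + ((p - 1) * σb - 2 * σ) * X + ((p - 1) * sb - 2 * s) * (L - (p - 1) * (σ * G + s * J)))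
      + B1 p N * (J * J + G * L) ≤ 0) :
    J ^ 2 + B1 p N * G ^ 2 ≤ Q1 p N := by
  have hp0 : 0 < p := by linarith
  have hp' : |p| ≤ p := by rw [abs_of_pos (by linarith)]
  have hp1 : |p - 1| ≤ p := by rw [abs_of_pos (by linarith)]; linarith
  have h2 : |(2:ℝ)| ≤ 2 := by norm_num
  have hN0 : 0 < N := by linarith
  have q1 : 0 < (p * 1 + (2 * p + 2)) := by positivity
  have q2 : 0 < (p * (2 * N) * N + (2 * p + 2) * (p * 1 * N)) := by positivity
  have q3 : 0 < (2 * p + p * 1 + (p + 2)) := by positivity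
  have q4 : 0 < (2 * p * (p * 1 + (2 * p + 2)) + p * (N + 2 * (2 * N)) + (p * (2 * N) + 2 * (2 * N))
      + (p + 2) * (p * 1)) := by positivity
  have q5 : 0 < (2 * p * (p * (2 * N) * N + (2 * p + 2) * (p * 1 * N)) + 2 * (p * 1 * N) * (2 * N)
      + (p * (2 * N) + 2 * (2 * N)) * (p * 1 * N) + (p + 2) * (p * (2 * N) * N)) := by positivity
  have hK : 1 ≤ K1 p N := by
    unfold K1
    have : (1:ℝ) ≤ (p * 1 + (2 * p + 2)) := by linarith
    linarith
  have hB : 1 ≤ B1 p N := by unfold B1; nlinarith [sq_nonneg (K1 p N)]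
  obtain ⟨B, hBdef⟩ : ∃ B, B = B1 p N := ⟨_, rfl⟩
  rw [← hBdef] at hB hF hF2 ⊢
  have hθJ : -(B * G * Z) ≤ J * (θ * (J - Jb)) := by
    have h1 : -(B * G * (G - Gb)) ≤ J * (J - Jb) := by
      nlinarith [sq_nonneg (J - Jb), mul_nonneg (by linarith : 0 ≤ B) (sq_nonneg (G - Gb))]
    have h3 := mul_le_mul_of_nonneg_left h1 hθ
    rw [hZ]; linarith
  obtain ⟨r, hr⟩ : ∃ ww, ww = (p * sb - s) := ⟨_, rfl⟩
  have hrb : |r| ≤ 2 * p := hr ▸ (asub (amul hp' hsb) hs).trans (by linarith)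
  obtain ⟨q, hq⟩ : ∃ ww, ww = (1 - p) * sb + 2 * s := ⟨_, rfl⟩
  have hqb : |q| ≤ 2 * p + 2 := by
    rw [hq]
    refine (aadd (amul (A := p) ?_ hsb) (amul h2 hs)).trans (by linarith)
    rw [abs_sub_comm]; exact hp1
  obtain ⟨t, ht⟩ : ∃ ww, ww = (p - 1) * sb - 2 * s := ⟨_, rfl⟩
  have htb : |t| ≤ p + 2 := ht ▸ (asub (amul hp1 hsb) (amul h2 hs)).trans (by linarith)
  obtain ⟨c4, hc4⟩ : ∃ ww, ww = -((p - 1) * s) + q := ⟨_, rfl⟩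
  obtain ⟨c5, hc5⟩ : ∃ ww, ww = -((p - 1) * σ * G) - q * ((p - 1) * s * G) := ⟨_, rfl⟩
  have hZ' : Z = L + c4 * J + c5 := by
    rw [hc4, hc5, hq]
    have : Z = L - (p - 1) * (σ * G + s * J) - r * X + X * (s + sb) := by rw [hL, hr]; ring
    rw [this, hX, hr]; ring
  have hps := amul hp1 hs
  have hpsG := amul hps hG
  have hpσG := amul (amul hp1 hσ) hG
  have hc4b : |c4| ≤ p * 1 + (2 * p + 2) := hc4 ▸ aadd (by rw [abs_neg]; exact hps) hqb
  have hc5b : |c5| ≤ p * (2 * N) * N + (2 * p + 2) * (p * 1 * N) :=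
    hc5 ▸ asub (by rw [abs_neg]; exact hpσG) (amul hqb hpsG)
  obtain ⟨α, hα⟩ : ∃ ww, ww = r + (p - 1) * s + t := ⟨_, rfl⟩
  have hαb : |α| ≤ 2 * p + p * 1 + (p + 2) := hα ▸ aadd (aadd hrb hps) htb
  obtain ⟨w, hw⟩ : ∃ ww, ww = (p - 1) * σb - 2 * σ := ⟨_, rfl⟩
  have hwb : |w| ≤ p * (2 * N) + 2 * (2 * N) := hw ▸ asub (amul hp1 hσb) (amul h2 hσ)
  obtain ⟨β, hβ⟩ : ∃ ww, ww = r * c4 + (p - 1) * (G + 2 * σ) + w - t * ((p - 1) * s) := ⟨_, rfl⟩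
  have hβb : |β| ≤ 2 * p * (p * 1 + (2 * p + 2)) + p * (N + 2 * (2 * N)) + (p * (2 * N) + 2 * (2 * N))
      + (p + 2) * (p * 1) :=
    hβ ▸ asub (aadd (aadd (amul hrb hc4b) (amul hp1 (aadd hG (amul h2 hσ)))) hwb) (amul htb hps)
  obtain ⟨κ, hκ⟩ : ∃ ww, ww = r * c5 - 2 * ((p - 1) * s * G) * σ - w * ((p - 1) * s * G) - t * ((p - 1) * σ * G) := ⟨_, rfl⟩
  have hκb : |κ| ≤ 2 * p * (p * (2 * N) * N + (2 * p + 2) * (p * 1 * N)) + 2 * (p * 1 * N) * (2 * N)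
      + (p * (2 * N) + 2 * (2 * N)) * (p * 1 * N) + (p + 2) * (p * (2 * N) * N) :=
    hκ ▸ asub (asub (asub (amul hrb hc5b) (amul (amul h2 hpsG) hσ)) (amul hwb hpsG)) (amul htb hpσG)
  have hα' : |α| ≤ K1 p N := by unfold K1; linarith
  have hc4' : |c4| ≤ K1 p N := by unfold K1; linarith
  have hc5' : |c5| ≤ K1 p N := by unfold K1; linarith
  have hβ' : |β| ≤ K1 p N := by unfold K1; linarith
  have hκ' : |κ| ≤ K1 p N := by unfold K1; linarith
  have hB2 : B = K1 p N ^ 2 / 4 + K1 p N + 1 := by rw [hBdef, B1]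
  have hQ : Q1 p N = (2 * (K1 p N + B * N * K1 p N) + 1) ^ 2 + B * N ^ 2 := by
    rw [Q1, K2, ← hBdef]
  rw [hQ]
  clear hQ
  have main : L * L + α * L * J + (B + β) * J ^ 2 + κ * J - B * G * c4 * J - B * G * c5 ≤ 0 := by
    have e : L * L + J * ((r * Z + θ * (J - Jb)) + (p - 1) * ((J - 2 * s * σ) * G + 2 * σ * J + s * L)
      + w * X + t * (L - (p - 1) * (σ * G + s * J)))
      + B * (J * J + G * L) = (L * L + α * L * J + (B + β) * J ^ 2 + κ * J - B * G * c4 * J - B * G * c5)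
       + (J * (θ * (J - Jb)) + B * G * Z) := by
      rw [hα, hβ, hκ, hX, hZ']; ring
    rw [← hr, ← hw, ← ht, e] at hF2
    linarith only [hF2, hθJ]
  exact J_alg2 hN hK hB2 hα' hβ' hκ' hc4' hc5' hG main

end AMS

namespace AMS

theorem rpow_hd {p : ℝ} {g s : ℝ → ℝ} {x : ℝ} (h0 : 0 < g x) (h : HasDerivAt g (g x * s x) x) :
    HasDerivAt (fun y => g y ^ p) (p * g x ^ p * s x) x := by
  refine (h.rpow_const (p := p) (Or.inl h0.ne')).congr_deriv ?_
  have : g x ^ p = g x ^ (p - 1) * g x := by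
    rw [← Real.rpow_add_one h0.ne']; ring_nf
  rw [this]; ring

/-- Abstract step data: relations between two consecutive steps. -/
structure Rel (p : ℝ) (sb Gb Jb θ s G J : ℝ → ℝ) : Prop where
  θp : ∀ x, 0 < θ x
  dsb : ∀ x, HasDerivAt sb (Gb x + 1 - sb x ^ 2) x
  dGb : ∀ x, HasDerivAt Gb (Jb x) x
  ds : ∀ x, HasDerivAt s (G x + 1 - s x ^ 2) x
  dG : ∀ x, HasDerivAt G (J x) x
  dθ : ∀ x, HasDerivAt θ (θ x * (p * sb x - s x)) x
  hJ : J = fun x => (p - 1) * (s x * G x) + θ x * (s x - sb x)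

theorem Rel.dJ {p : ℝ} {sb Gb Jb θ s G J : ℝ → ℝ} (h : Rel p sb Gb Jb θ s G J) (x : ℝ) :
    HasDerivAt J ((p - 1) * ((G x + 1 - s x ^ 2) * G x + s x * J x)
      + (p * sb x - s x) * (θ x * (s x - sb x)) + (θ x * (G x - Gb x) - (θ x * (s x - sb x)) * (s x + sb x))) x := by
  have e := (((h.ds x).mul (h.dG x)).const_mul (p - 1)).add ((h.dθ x).mul ((h.ds x).sub (h.dsb x)))
  refine (e.congr_of_eventuallyEq (Eventually.of_forall fun y => congrFun h.hJ y)).congr_deriv ?_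
  simp only [Pi.sub_apply]
  ring

theorem Rel.dL {p : ℝ} {sb Gb Jb θ s G J : ℝ → ℝ} (h : Rel p sb Gb Jb θ s G J) {L X : ℝ → ℝ}
    (hL : L = fun x => ((p - 1) * ((G x + 1 - s x ^ 2) * G x + s x * J x)
      + (p * sb x - s x) * (θ x * (s x - sb x)) + (θ x * (G x - Gb x) - (θ x * (s x - sb x)) * (s x + sb x))))
    (hX : ∀ x, X x = J x - (p - 1) * s x * G x) (x : ℝ) :
    HasDerivAt L (((p * sb x - s x) * (θ x * (G x - Gb x)) + θ x * (J x - Jb x))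
      + (p - 1) * ((J x - 2 * s x * (G x + 1 - s x ^ 2)) * G x + 2 * (G x + 1 - s x ^ 2) * J x + s x * L x)
      + ((p - 1) * (Gb x + 1 - sb x ^ 2) - 2 * (G x + 1 - s x ^ 2)) * X x
      + ((p - 1) * sb x - 2 * s x) * (L x - (p - 1) * ((G x + 1 - s x ^ 2) * G x + s x * J x))) x := by
  have hJx : J x = (p - 1) * (s x * G x) + θ x * (s x - sb x) := by rw [h.hJ]
  have dσ : HasDerivAt (fun x => G x + 1 - s x ^ 2) (J x - 2 * s x * (G x + 1 - s x ^ 2)) x :=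
    (((h.dG x).add_const 1).sub ((h.ds x).pow 2)).congr_deriv (by push_cast; ring)
  have dX : HasDerivAt (fun x => θ x * (s x - sb x))
      (L x - (p - 1) * ((G x + 1 - s x ^ 2) * G x + s x * J x)) x := by
    refine ((h.dθ x).mul ((h.ds x).sub (h.dsb x))).congr_deriv ?_
    rw [hL]; simp only [Pi.sub_apply]; ring
  have dJ : HasDerivAt J (L x) x := by rw [hL]; exact h.dJ x
  have dZ : HasDerivAt (fun x => θ x * (G x - Gb x))
      ((p * sb x - s x) * (θ x * (G x - Gb x)) + θ x * (J x - Jb x)) x :=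
    ((h.dθ x).mul ((h.dG x).sub (h.dGb x))).congr_deriv (by simp only [Pi.sub_apply]; ring)
  have e := ((((dσ.mul (h.dG x)).add ((h.ds x).mul dJ)).const_mul (p - 1)).add
    ((((h.dsb x).const_mul p).sub (h.ds x)).mul dX)).add (dZ.sub (dX.mul ((h.ds x).add (h.dsb x))))
  refine (e.congr_of_eventuallyEq (Eventually.of_forall fun y => congrFun hL y)).congr_deriv ?_
  have hXx : X x = θ x * (s x - sb x) := by rw [hX, hJx]; ring
  rw [hXx]
  simp only [Pi.sub_apply, Pi.add_apply]
  ring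

theorem Rel.G_bound {p N : ℝ} (hp : 1 < p) (hN : N0 p ≤ N) {sb Gb Jb θ s G J : ℝ → ℝ}
    (h : Rel p sb Gb Jb θ s G J) (hs : ∀ x, |s x| ≤ 1) (hsb : ∀ x, |sb x| ≤ 1) (hG : ∀ x, G x ≤ 0)
    (hNb : ∀ x, -Gb x + p * sb x ^ 2 ≤ N) (hGinf : Tendsto G (cocompact ℝ) (𝓝 0)) (x : ℝ) :
    -G x + p * s x ^ 2 ≤ N := by
  have hs2 : ∀ x, s x ^ 2 ≤ 1 := fun x => by rw [← sq_abs]; exact pow_le_one₀ (abs_nonneg _) (hs x)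
  have hc : 1 ≤ cG p := by unfold cG; nlinarith
  by_contra hx
  push Not at hx
  have dF : ∀ x, HasDerivAt (fun x => -G x + p * s x ^ 2) (-J x + p * (2 * s x * (G x + 1 - s x ^ 2))) x :=
    fun x => ((h.dG x).neg.add (((h.ds x).pow 2).const_mul p)).congr_deriv (by push_cast; ring)
  have dσ : ∀ x, HasDerivAt (fun x => G x + 1 - s x ^ 2) (J x - 2 * s x * (G x + 1 - s x ^ 2)) x :=
    fun x => (((h.dG x).add_const 1).sub ((h.ds x).pow 2)).congr_deriv (by push_cast; ring)
  have dF1 := fun x => (h.dJ x).neg.add (((((h.ds x).const_mul 2)).mul (dσ x)).const_mul p)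
  obtain ⟨x0, hm, hx0⟩ := exists_max (F := fun x => -G x + p * s x ^ 2) (K := N) (x1 := x)
    (continuous_iff_continuousAt.2 fun y => (dF y).continuousAt) hx (by
      filter_upwards [hGinf.eventually (lt_mem_nhds (show (-1:ℝ) < 0 by norm_num))] with y hy
      have := hs2 y
      unfold N0 at hN
      nlinarith)
  obtain ⟨h1, h2⟩ := max_second dF (dF1 x0) hm
  have hx1 : N < -G x0 + p * s x0 ^ 2 := lt_of_lt_of_le hx hx0
  have hJx : J x0 = (p - 1) * (s x0 * G x0) + θ x0 * (s x0 - sb x0) := by rw [h.hJ]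
  have := G_alg (J := J x0) (X := θ x0 * (s x0 - sb x0)) (Z := θ x0 * (G x0 - Gb x0)) hp (hs x0) (hsb x0) (hG x0)
    (by linarith) (by rw [hJx]; ring) (by
      have h3 : G x0 - Gb x0 ≤ p * ((s x0 - sb x0) * (s x0 + sb x0)) := by
        have := hNb x0
        nlinarith
      have := mul_le_mul_of_nonneg_left h3 (h.θp x0).le
      linarith) (by linarith)
  have h4 := hs2 x0
  unfold N0 at hN
  nlinarith

theorem Rel.J_bound {p N Q : ℝ} (hp : 1 < p) (hN : 1 ≤ N) (hQ : Q1 p N ≤ Q) {sb Gb Jb θ s G J : ℝ → ℝ}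
    (h : Rel p sb Gb Jb θ s G J) (hs : ∀ x, |s x| ≤ 1) (hsb : ∀ x, |sb x| ≤ 1) (hG : ∀ x, |G x| ≤ N)
    (hGb : ∀ x, |Gb x| ≤ N)
    (hQb : ∀ x, Jb x ^ 2 + B1 p N * Gb x ^ 2 ≤ Q) (hGinf : Tendsto G (cocompact ℝ) (𝓝 0))
    (hJinf : Tendsto J (cocompact ℝ) (𝓝 0)) (x : ℝ) :
    J x ^ 2 + B1 p N * G x ^ 2 ≤ Q := by
  have hs2 : ∀ {s : ℝ → ℝ}, (∀ x, |s x| ≤ 1) → ∀ x, |s x ^ 2| ≤ 1 := fun hs x => by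
    rw [abs_of_nonneg (sq_nonneg _), ← sq_abs]; exact pow_le_one₀ (abs_nonneg _) (hs x)
  by_contra hx
  push Not at hx
  have hp0 : 0 < p := by linarith
  have hK : 0 < K1 p N := by unfold K1; positivity
  have hB : 0 < B1 p N := by unfold B1; positivity
  have hQ0 : 0 < Q := by
    have : 0 < Q1 p N := by unfold Q1 K2; positivity
    linarith
  obtain ⟨L, hL⟩ : ∃ L : ℝ → ℝ, L = fun x => ((p - 1) * ((G x + 1 - s x ^ 2) * G x + s x * J x)
      + (p * sb x - s x) * (θ x * (s x - sb x)) + (θ x * (G x - Gb x) - (θ x * (s x - sb x)) * (s x + sb x))) := ⟨_, rfl⟩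
  have dJ : ∀ x, HasDerivAt J (L x) x := fun x => by rw [hL]; exact h.dJ x
  have dL := h.dL (X := fun x => J x - (p - 1) * s x * G x) hL (fun x => rfl)
  have dF : ∀ x, HasDerivAt (fun x => J x ^ 2 + B1 p N * G x ^ 2) (2 * (J x * L x + B1 p N * (G x * J x))) x :=
    fun x => (((dJ x).pow 2).add (((h.dG x).pow 2).const_mul _)).congr_deriv (by push_cast; ring)
  have dF1 := fun x => (((dJ x).mul (dL x)).add (((h.dG x).mul (dJ x)).const_mul (B1 p N))).const_mul 2
  have hinf : Tendsto (fun x => J x ^ 2 + B1 p N * G x ^ 2) (cocompact ℝ) (𝓝 0) := by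
    have := (hJinf.pow 2).add ((hGinf.pow 2).const_mul (B1 p N))
    simpa using this
  obtain ⟨x0, hm, hx0⟩ := exists_max (F := fun x => J x ^ 2 + B1 p N * G x ^ 2) (K := Q) (x1 := x)
    (continuous_iff_continuousAt.2 fun y => (dF y).continuousAt) hx (by
      filter_upwards [hinf.eventually (gt_mem_nhds hQ0)] with y hy
      exact hy.le)
  obtain ⟨h1, h2⟩ := max_second dF (dF1 x0) hm
  have hx1 : Q < J x0 ^ 2 + B1 p N * G x0 ^ 2 := lt_of_lt_of_le hx hx0
  have hJx : J x0 = (p - 1) * (s x0 * G x0) + θ x0 * (s x0 - sb x0) := by rw [h.hJ]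
  have h1a : |(1:ℝ)| ≤ 1 := by norm_num
  have hσ' : ∀ {G s : ℝ}, |G| ≤ N → |s| ≤ 1 → |G + 1 - s ^ 2| ≤ 2 * N := fun {G s} hG hs => by
    have h3 : s ^ 2 ≤ 1 := by rw [← sq_abs]; exact pow_le_one₀ (abs_nonneg _) hs
    have h4 := sq_nonneg s
    have := abs_le.1 hG
    exact abs_le.2 ⟨by linarith, by linarith⟩
  have hXe : θ x0 * (s x0 - sb x0) = J x0 - (p - 1) * s x0 * G x0 := by rw [hJx]; ring
  have := J_alg (Gb := Gb x0) (Jb := Jb x0) (L := L x0) (J := J x0) hp hN (hs x0) (hsb x0) (hG x0)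
    (hσ' (hG x0) (hs x0)) (hσ' (hGb x0) (hsb x0)) (h.θp x0).le rfl rfl
    (by rw [hL, ← hXe]) (by linarith [hQb x0]) (by linarith)
  linarith

end AMS

namespace AMS

structure Good (p N Q : ℝ) (g s G J : ℝ → ℝ) : Prop extends Data g s G J where
  le1 : ∀ x, g x ≤ 1
  G0 : ∀ x, G x ≤ 0
  s1 : ∀ x, |s x| ≤ 1
  hN : ∀ x, -G x + p * s x ^ 2 ≤ N
  hQ : ∀ x, J x ^ 2 + B1 p N * G x ^ 2 ≤ Q
  dec : ∃ C, ∀ x, g x ≤ C * Real.exp (-|x|)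

theorem Data.cont {g s G J : ℝ → ℝ} (h : Data g s G J) : Continuous g :=
  continuous_iff_continuousAt.2 fun y => (h.d1 y).continuousAt

theorem s_bound {g s G J : ℝ → ℝ} (h : Data g s G J) (hG : ∀ x, G x ≤ 0) (x : ℝ) : |s x| ≤ 1 := by
  have h1 := abs_deriv_le_self h.d1 h.dd h.pos (fun x => by nlinarith [hG x, h.pos x]) x
  rw [abs_mul, abs_of_pos (h.pos x)] at h1
  exact le_of_mul_le_mul_left (by linarith) (h.pos x)

theorem good_step {p δ N Q : ℝ} (hp : 1 < p) (hδ : 0 < δ) (hδ1 : δ < 1) (hN : N0 p ≤ N)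
    (hQ : Q1 p N ≤ Q) {g sb Gb Jb : ℝ → ℝ} (hg : Good p N Q g sb Gb Jb) :
    ∃ u s G J, Good p N Q u s G J ∧
      ∀ x, (1 - δ) * u x ^ p + δ * u x - g x ^ p = δ * (u x * (G x + 1)) := by
  have hp0 : 0 < p := by linarith
  obtain ⟨u, u1, u0, ule, hu, hu1⟩ := step_exists hp hδ hδ1 hg.cont hg.pos hg.le1
  have hδ' : 0 < 1 - δ := by linarith
  obtain ⟨c, hc⟩ : ∃ c : ℝ, c = ((1 - δ)⁻¹) ^ (p⁻¹) := ⟨_, rfl⟩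
  have hc0 : 0 < c := by rw [hc]; positivity
  have hcp : c ^ p = (1 - δ)⁻¹ := by
    rw [hc, Real.rpow_inv_rpow (by positivity) hp0.ne']
  have hucg : ∀ x, u x ≤ c * g x := by
    refine step_compare hp hδ hδ1 (w := fun x => c * g x) hu hu1 (fun x => (hg.d1 x).const_mul c)
      (fun x => (hg.dd x).const_mul c) (N := 1) ule (fun x => mul_pos hc0 (hg.pos x)) fun x => ?_
    rw [Real.mul_rpow hc0.le (hg.pos x).le, hcp]
    have e1 : (1 - δ) * ((1 - δ)⁻¹ * g x ^ p) = g x ^ p := by field_simp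
    have e2 : δ * (((1 - δ) * u x ^ p + δ * u x - g x ^ p) / δ) = (1 - δ) * u x ^ p + δ * u x - g x ^ p := by
      field_simp
    rw [e1, e2]
    have := mul_nonneg (mul_pos (mul_pos hδ hc0) (hg.pos x)).le (neg_nonneg.2 (hg.G0 x))
    nlinarith
  have hup : ∀ x, (1 - δ) * u x ^ p ≤ g x ^ p := fun x => by
    have h1 := Real.rpow_le_rpow (u0 x).le (hucg x) hp0.le
    rw [Real.mul_rpow hc0.le (hg.pos x).le, hcp] at h1
    have h2 := mul_le_mul_of_nonneg_left h1 hδ'.le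
    rwa [← mul_assoc, mul_inv_cancel₀ hδ'.ne', one_mul] at h2
  obtain ⟨s, hs⟩ : ∃ s : ℝ → ℝ, s = fun x => u1 x / u x := ⟨_, rfl⟩
  obtain ⟨G, hG⟩ : ∃ G : ℝ → ℝ, G = fun x => ((1 - δ) * u x ^ p - g x ^ p) / (δ * u x) := ⟨_, rfl⟩
  obtain ⟨θ, hθ⟩ : ∃ θ : ℝ → ℝ, θ = fun x => p * g x ^ p / (δ * u x) := ⟨_, rfl⟩
  obtain ⟨J, hJ⟩ : ∃ J : ℝ → ℝ, J = fun x => (p - 1) * (s x * G x) + θ x * (s x - sb x) := ⟨_, rfl⟩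
  have us : ∀ x, u1 x = u x * s x := fun x => by rw [hs]; have := (u0 x).ne'; field_simp
  have d1 : ∀ x, HasDerivAt u (u x * s x) x := fun x => us x ▸ hu x
  have u2G : ∀ x, ((1 - δ) * u x ^ p + δ * u x - g x ^ p) / δ = u x * (G x + 1) := fun x => by
    rw [hG]; have := (u0 x).ne'; field_simp; ring
  have gp0 : ∀ x, 0 < g x ^ p := fun x => Real.rpow_pos_of_pos (hg.pos x) p
  have dgp : ∀ x, HasDerivAt (fun y => g y ^ p) (p * g x ^ p * sb x) x := fun x => rpow_hd (hg.pos x) (hg.d1 x)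
  have dup : ∀ x, HasDerivAt (fun y => u y ^ p) (p * u x ^ p * s x) x := fun x => rpow_hd (u0 x) (d1 x)
  have d2 : ∀ x, HasDerivAt s (G x + 1 - s x ^ 2) x := fun x => by
    have h1 := (hu1 x).div (hu x) (u0 x).ne'
    rw [u2G x] at h1
    rw [hs]
    refine HasDerivAt.congr_deriv (f := fun x => u1 x / u x) h1 ?_
    have := (u0 x).ne'
    field_simp
  have d3 : ∀ x, HasDerivAt G (J x) x := fun x => by
    have h1 := (((dup x).const_mul (1 - δ)).sub (dgp x)).div ((d1 x).const_mul δ) (mul_pos hδ (u0 x)).ne'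
    refine (h1.congr_of_eventuallyEq (Eventually.of_forall fun y => congrFun hG y)).congr_deriv ?_
    rw [hJ, hθ, hG]
    have := (u0 x).ne'
    simp only [Pi.sub_apply]
    field_simp
    ring
  have D : Data u s G J := ⟨u0, d1, d2, d3⟩
  have θp : ∀ x, 0 < θ x := fun x => by
    rw [hθ]; exact div_pos (mul_pos hp0 (gp0 x)) (mul_pos hδ (u0 x))
  have R : Rel p sb Gb Jb θ s G J := by
    refine ⟨θp, hg.d2, hg.d3, d2, d3, fun x => ?_, hJ⟩
    have h1 := ((dgp x).const_mul p).div ((d1 x).const_mul δ) (mul_pos hδ (u0 x)).ne'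
    refine (h1.congr_of_eventuallyEq (Eventually.of_forall fun y => congrFun hθ y)).congr_deriv ?_
    rw [hθ]
    have := (u0 x).ne'
    field_simp
  have G0 : ∀ x, G x ≤ 0 := fun x => by
    rw [hG]; exact div_nonpos_of_nonpos_of_nonneg (by linarith [hup x]) (mul_pos hδ (u0 x)).le
  have s1 := s_bound D G0
  have har : ∀ x, u 0 * Real.exp (-|x|) ≤ u x := fun x => by
    have := harnack d1 (fun x => by
      rw [abs_mul, abs_of_pos (u0 x)]; nlinarith [s1 x, u0 x]) 0 x
    simpa using this
  obtain ⟨C, hC⟩ := hg.dec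
  have hC0 : 0 ≤ C := by
    have := (hg.pos 0).le.trans (hC 0)
    simpa using this
  have θinf : Tendsto θ (cocompact ℝ) (𝓝 0) := by
    have lim : Tendsto (fun x : ℝ => p * C ^ p / (δ * u 0) * Real.exp (-((p - 1) * |x|))) (cocompact ℝ) (𝓝 0) := by
      have h1 : Tendsto (fun x : ℝ => Real.exp (-((p - 1) * |x|))) (cocompact ℝ) (𝓝 0) :=
        (Real.tendsto_exp_neg_atTop_nhds_zero).comp
          (tendsto_abs_coc.const_mul_atTop (show 0 < p - 1 by linarith))
      simpa using h1.const_mul (p * C ^ p / (δ * u 0))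
    refine squeeze_zero (fun x => (θp x).le) (fun x => ?_) lim
    rw [hθ]
    have hh := har x
    have h2 : g x ^ p ≤ C ^ p * Real.exp (-(p * |x|)) := by
      have := Real.rpow_le_rpow (hg.pos x).le (hC x) hp0.le
      rw [Real.mul_rpow hC0 (Real.exp_pos _).le, ← Real.exp_mul] at this
      convert this using 3
      ring
    have hu00 := u0 0
    calc p * g x ^ p / (δ * u x) ≤ p * (C ^ p * Real.exp (-(p * |x|))) / (δ * (u 0 * Real.exp (-|x|))) := by
          gcongr
      _ = _ := by
          rw [show -(p * |x|) = -((p - 1) * |x|) + -|x| by ring, Real.exp_add]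
          have := (Real.exp_pos (-|x|)).ne'
          field_simp
  have Gb' : ∀ x, |G x| ≤ θ x := fun x => by
    rw [abs_of_nonpos (G0 x)]
    have e : θ x = p * (g x ^ p / (δ * u x)) := by rw [hθ]; ring
    have e2 : G x = (1 - δ) * u x ^ p / (δ * u x) - g x ^ p / (δ * u x) := by rw [hG]; ring
    have h1 : 0 ≤ (1 - δ) * u x ^ p / (δ * u x) :=
      div_nonneg (mul_nonneg hδ'.le (Real.rpow_nonneg (u0 x).le p)) (mul_pos hδ (u0 x)).le
    have h2 : 0 ≤ g x ^ p / (δ * u x) := div_nonneg (gp0 x).le (mul_pos hδ (u0 x)).le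
    nlinarith
  have Ginf : Tendsto G (cocompact ℝ) (𝓝 0) := squeeze_zero_norm Gb' θinf
  have Jinf : Tendsto J (cocompact ℝ) (𝓝 0) := by
    have lim : Tendsto (fun x => (p - 1) * (1 * θ x) + θ x * (1 + 1)) (cocompact ℝ) (𝓝 0) := by
      simpa using ((θinf.const_mul 1).const_mul (p - 1)).add (θinf.mul_const (1 + 1))
    refine squeeze_zero_norm (fun x => ?_) lim
    rw [Real.norm_eq_abs, hJ]
    exact aadd (amul (by rw [abs_of_pos (by linarith)]) (amul (s1 x) (Gb' x)))
      (amul (by rw [abs_of_pos (θp x)]) (asub (s1 x) (hg.s1 x)))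
  have hcG : 1 ≤ cG p := by unfold cG; nlinarith
  have hN1 : 1 ≤ N := by unfold N0 at hN; linarith
  have HN := R.G_bound hp hN s1 hg.s1 G0 hg.hN Ginf
  have absG : ∀ {G s : ℝ → ℝ}, (∀ x, G x ≤ 0) → (∀ x, -G x + p * s x ^ 2 ≤ N) → ∀ x, |G x| ≤ N :=
    fun {G s} h1 h2 x => by
      rw [abs_of_nonpos (h1 x)]; nlinarith [h2 x, sq_nonneg (s x)]
  have HQ := R.J_bound hp hN1 hQ s1 hg.s1 (absG G0 HN) (absG hg.G0 hg.hN) hg.hQ Ginf Jinf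
  refine ⟨u, s, G, J, ⟨D, ule, G0, s1, HN, HQ, c * C, fun x => ?_⟩, fun x => ?_⟩
  · have := mul_le_mul_of_nonneg_left (hC x) hc0.le
    linarith [hucg x]
  · rw [← u2G x]; field_simp

end AMS

namespace AMS

/-- Collected facts on a profile. -/
structure Wave (p lam gam K c z0 : ℝ) (φ s G J : ℝ → ℝ) : Prop extends Data φ s G J where
  p1 : 1 < p
  lam1 : 1 < lam
  gam0 : 0 < gam
  gameq : gam ^ 2 - lam * p * gam + (p - 1) = 0
  K1 : 1 ≤ K
  c0 : 0 < c
  lt1 : ∀ z, φ z < 1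
  mono : StrictMono φ
  s0 : ∀ z, 0 < s z
  s1 : ∀ z, s z ≤ 1
  G0 : ∀ z, G z ≤ 0
  GK : ∀ z, |G z| ≤ K
  JK : ∀ z, |J z| ≤ K
  eq : ∀ z, φ z * (G z + 1) + lam * (p * φ z ^ p * s z) + φ z ^ p - φ z = 0
  grad : ∀ z, φ z * s z ≤ K * (1 - φ z)
  conc : ∀ z, z0 ≤ z → G z + 1 ≤ 0
  up : ∀ z, 1 - φ z ≤ K * Real.exp (-(gam * z))
  low : ∀ z, 0 ≤ z → c * Real.exp (-(gam * z)) ≤ 1 - φ z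
  dec : ∀ z, φ z ≤ K * Real.exp z
  top : Tendsto φ atTop (𝓝 1)
  bot : Tendsto φ atBot (𝓝 0)

/-- A bounded function cannot have derivative bounded below on a half line. -/
theorem no_growth {f f1 : ℝ → ℝ} (hf : ∀ x, HasDerivAt f (f1 x) x) (hb : ∀ x, f x ≤ 1) {x0 ε : ℝ}
    (hε : 0 < ε) (h : ∀ x, x0 ≤ x → ε ≤ f1 x) : False := by
  have h1 : ∀ y, x0 < y → ε * (y - x0) ≤ f y - f x0 := fun y hy => by
    obtain ⟨c, hc, hcd⟩ := exists_hasDerivAt_eq_slope f f1 hy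
      (fun x _ => (hf x).continuousAt.continuousWithinAt) (fun x _ => hf x)
    have := h c hc.1.le
    rw [hcd, le_div_iff₀ (by linarith)] at this
    exact this
  have h0 : 0 ≤ 1 - f x0 := by linarith [hb x0]
  have h2 := h1 (x0 + ((1 - f x0) / ε + 1)) (by have := div_nonneg h0 hε.le; linarith)
  have h3 : ε * (x0 + ((1 - f x0) / ε + 1) - x0) = 1 - f x0 + ε := by field_simp; ring
  rw [h3] at h2
  linarith [hb (x0 + ((1 - f x0) / ε + 1))]

theorem wave_exists {p lam gam C M : ℝ} (hp : 1 < p) (hlam : 1 < lam) {v : ℝ → ℝ}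
    (h : IsTWProfile p lam v) (ha : HasExpAsym p lam gam C v)
    (hb : ∀ x ≤ (0:ℝ), v x ≤ M * Real.exp x) :
    ∃ s G J K c z0, Wave p lam gam K c z0 v s G J := by
  obtain ⟨hC2, v0, vle, v1, veq, vbot, vtop⟩ := h
  obtain ⟨g0, C0, geq, hlim⟩ := ha
  have hp0 : 0 < p := by linarith
  have hl0 : 0 < lam := by linarith
  have e1 : ∀ x, HasDerivAt v (deriv v x) x := fun x =>
    ((hC2.differentiable (by norm_num)) x).hasDerivAt
  have e2 : ∀ x, HasDerivAt (deriv v) (deriv (deriv v) x) x := fun x => by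
    have h1 : ContDiff ℝ 1 (deriv v) := by
      have : ContDiff ℝ (1 + 1) v := by
        simpa [one_add_one_eq_two] using hC2
      exact (contDiff_succ_iff_deriv.1 this).2.2
    exact ((h1.differentiable (by norm_num)) x).hasDerivAt
  have vm : StrictMono v := strictMono_of_deriv_pos v1
  have lt1 : ∀ z, v z < 1 := fun z => (vm (show z < z + 1 by linarith)).trans_le (vle _)
  obtain ⟨s, hs⟩ : ∃ s : ℝ → ℝ, s = fun x => deriv v x / v x := ⟨_, rfl⟩
  obtain ⟨G, hG⟩ : ∃ G : ℝ → ℝ, G = fun x => -(v x ^ (p - 1) * (1 + lam * p * s x)) := ⟨_, rfl⟩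
  have s0 : ∀ z, 0 < s z := fun z => by rw [hs]; exact div_pos (v1 z) (v0 z)
  have vs : ∀ x, deriv v x = v x * s x := fun x => by rw [hs]; have := (v0 x).ne'; field_simp
  have vp : ∀ x, v x ^ p = v x ^ (p - 1) * v x := fun x => by
    rw [← Real.rpow_add_one (v0 x).ne']; ring_nf
  have v2 : ∀ x, deriv (deriv v) x = v x * (G x + 1) := fun x => by
    have := veq x
    rw [vs, vp] at this
    rw [hG]; simp only
    linarith
  have d1 : ∀ x, HasDerivAt v (v x * s x) x := fun x => vs x ▸ e1 x
  have d2 : ∀ x, HasDerivAt s (G x + 1 - s x ^ 2) x := fun x => by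
    have h1 := (e2 x).div (e1 x) (v0 x).ne'
    rw [v2 x] at h1
    refine (h1.congr_of_eventuallyEq (Eventually.of_forall fun y => congrFun hs y)).congr_deriv ?_
    have := (v0 x).ne'
    rw [vs]
    field_simp
  obtain ⟨J, hJ⟩ : ∃ J : ℝ → ℝ, J = fun x => (p - 1) * s x * G x -
      lam * p * (v x ^ (p - 1) * (G x + 1 - s x ^ 2)) := ⟨_, rfl⟩
  have d3 : ∀ x, HasDerivAt G (J x) x := fun x => by
    have h1 : HasDerivAt (fun y => v y ^ (p - 1)) ((p - 1) * v x ^ (p - 1) * s x) x := rpow_hd (v0 x) (d1 x)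
    have h2 := (h1.mul (((d2 x).const_mul (lam * p)).const_add 1)).neg
    refine (h2.congr_of_eventuallyEq (Eventually.of_forall fun y => congrFun hG y)).congr_deriv ?_
    rw [hJ]; simp only
    rw [show G x = -(v x ^ (p - 1) * (1 + lam * p * s x)) from congrFun hG x]
    ring
  have D : Data v s G J := ⟨v0, d1, d2, d3⟩
  have vq0 : ∀ x, 0 < v x ^ (p - 1) := fun x => Real.rpow_pos_of_pos (v0 x) _
  have vq1 : ∀ x, v x ^ (p - 1) ≤ 1 := fun x => Real.rpow_le_one (v0 x).le (vle x) (by linarith)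
  have lps : ∀ x, 0 < lam * p * s x := fun x => mul_pos (mul_pos hl0 hp0) (s0 x)
  have G0 : ∀ x, G x ≤ 0 := fun x => by
    rw [hG]; simp only
    have := mul_pos (vq0 x) (show 0 < 1 + lam * p * s x by linarith [lps x])
    linarith
  have s1 : ∀ x, s x ≤ 1 := fun x => (abs_le.1 (s_bound D G0 x)).2
  have sa : ∀ x, |s x| ≤ 1 := fun x => s_bound D G0 x
  have hlp : |lam * p| ≤ lam * p := by rw [abs_of_pos (by positivity)]
  have GK : ∀ x, |G x| ≤ 1 * (1 + lam * p * 1) := fun x => by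
    rw [hG, abs_neg]
    exact amul (by rw [abs_of_pos (vq0 x)]; exact vq1 x) (aadd (by norm_num) (amul hlp (sa x)))
  have JK : ∀ x, |J x| ≤ p * 1 * (1 * (1 + lam * p * 1)) + lam * p * (1 * ((1 * (1 + lam * p * 1)) + 1 + 1)) := fun x => by
    rw [hJ]
    refine asub (amul (amul ?_ (sa x)) (GK x)) (amul hlp (amul ?_ (asub (aadd (GK x) ?_) ?_)))
    · rw [abs_of_pos (by linarith)]; linarith
    · rw [abs_of_pos (vq0 x)]; exact vq1 x
    · norm_num
    · rw [abs_of_nonneg (sq_nonneg _), ← sq_abs]; exact pow_le_one₀ (abs_nonneg _) (sa x)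
  have eq : ∀ z, v z * (G z + 1) + lam * (p * v z ^ p * s z) + v z ^ p - v z = 0 := fun z => by
    have := veq z
    rw [v2, vs] at this
    rw [vp] at this ⊢
    linarith
  have dP : ∀ x, HasDerivAt (fun x => v x * s x + lam * v x ^ p) (v x - v x ^ p) x := fun x => by
    have h1 : HasDerivAt (fun y => v y ^ p) (p * v x ^ p * s x) x := rpow_hd (v0 x) (d1 x)
    refine ((D.dd x).add (h1.const_mul lam)).congr_deriv ?_
    linarith [eq x]
  have vple : ∀ x, v x ^ p ≤ v x := fun x => by
    rw [vp]; nlinarith [vq1 x, v0 x]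
  have mP : Monotone (fun x => v x * s x + lam * v x ^ p) :=
    monotone_of_hasDerivAt_nonneg dP fun x => sub_nonneg.2 (vple x)
  have grad : ∀ z, v z * s z ≤ lam * p * (1 - v z) := fun z => by
    have h1 : v z * s z + lam * v z ^ p ≤ lam := by
      by_contra hcon
      push Not at hcon
      refine no_growth d1 vle (x0 := z) (ε := v z * s z + lam * v z ^ p - lam) (by linarith) fun x hx => ?_
      have h2 := mP hx
      simp only at h2
      have h3 : v x ^ p ≤ 1 := (vple x).trans (vle x)
      nlinarith
    have h2 := rpow_sub_le hp (v0 z).le (vle z) le_rfl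
    rw [Real.one_rpow] at h2
    nlinarith
  have hq1 : Tendsto (fun x => v x ^ (p - 1)) atTop (𝓝 1) := by
    have := vtop.rpow_const (p := p - 1) (Or.inl one_ne_zero)
    simpa using this
  obtain ⟨z1, hz1⟩ := eventually_atTop.1 (hq1.eventually (lt_mem_nhds (show 2 - p < 1 by linarith)))
  obtain ⟨z0, hz01, hz0⟩ : ∃ z0, z1 ≤ z0 ∧ G z0 + 1 ≤ 0 := by
    by_contra hcon
    push Not at hcon
    refine no_growth d1 vle (x0 := z1) (ε := v z1 * s z1) (mul_pos (v0 _) (s0 _)) fun x hx => ?_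
    have hm : MonotoneOn (fun x => v x * s x) (Set.Ici z1) := by
      refine monotoneOn_of_deriv_nonneg (convex_Ici z1)
        (fun y _ => (D.dd y).continuousAt.continuousWithinAt)
        (fun y _ => (D.dd y).differentiableAt.differentiableWithinAt) fun y hy => ?_
      rw [interior_Ici] at hy
      rw [(D.dd y).deriv]
      exact mul_nonneg (v0 y).le (hcon y (le_of_lt hy)).le
    exact hm Set.self_mem_Ici hx hx
  have conc : ∀ z, z0 ≤ z → G z + 1 ≤ 0 := fun z hz => by
    have := image_le_of_deriv_right_lt_deriv_boundary' (f := fun x => G x + 1) (f' := J) (a := z0) (b := z)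
      (fun x _ => ((d3 x).add_const 1).continuousAt.continuousWithinAt)
      (fun x _ => ((d3 x).add_const 1).hasDerivWithinAt) (B := fun _ => 0) (B' := fun _ => 0) hz0
      continuousOn_const (fun x _ => (hasDerivAt_const x (0:ℝ)).hasDerivWithinAt)
      (fun x hx hx0 => by
        have h1 := hz1 x (hz01.trans hx.1)
        have h2 : G x = -1 := by linarith
        have h3 : v x ^ (p - 1) * (lam * p * s x) = 1 - v x ^ (p - 1) := by
          have := congrFun hG x
          linarith
        have h4 : J x = s x * (2 - p - v x ^ (p - 1)) := by
          rw [hJ]; simp only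
          rw [h2]
          have : lam * p * (v x ^ (p - 1) * (-1 + 1 - s x ^ 2)) = -(s x * (v x ^ (p - 1) * (lam * p * s x))) := by ring
          rw [this, h3]; ring
        rw [h4]
        exact mul_neg_of_pos_of_neg (s0 x) (by linarith)) (Set.right_mem_Icc.2 hz)
    exact this
  obtain ⟨z2, hz2⟩ := eventually_atTop.1 (hlim.eventually (gt_mem_nhds (show C < 2 * C by linarith)))
  obtain ⟨z3, hz3⟩ := eventually_atTop.1 (hlim.eventually (lt_mem_nhds (show C / 2 < C by linarith)))
  have up : ∀ z, 1 - v z ≤ (2 * C + Real.exp (gam * z2)) * Real.exp (-(gam * z)) := fun z => by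
    have h1 : Real.exp (gam * z) * (1 - v z) ≤ 2 * C + Real.exp (gam * z2) := by
      rcases le_total z2 z with hz | hz
      · have := hz2 z hz
        have := Real.exp_pos (gam * z2)
        linarith
      · have h2 : Real.exp (gam * z) ≤ Real.exp (gam * z2) := Real.exp_le_exp.2 (by gcongr)
        have h3 := v0 z
        have h4 := vle z
        nlinarith [Real.exp_pos (gam * z)]
    rw [Real.exp_neg, ← div_eq_mul_inv, le_div_iff₀ (Real.exp_pos _)]
    linarith
  have low : ∀ z, 0 ≤ z → min (C / 2) (1 - v z3) * Real.exp (-(gam * z)) ≤ 1 - v z := fun z hz => by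
    rcases le_total z3 z with h3 | h3
    · have h4 := hz3 z h3
      rw [Real.exp_neg, ← div_eq_mul_inv, div_le_iff₀ (Real.exp_pos _)]
      have := min_le_left (C / 2) (1 - v z3)
      linarith
    · have h4 : v z ≤ v z3 := vm.monotone h3
      have h5 : Real.exp (-(gam * z)) ≤ 1 := Real.exp_le_one_iff.2 (by have := mul_nonneg g0.le hz; linarith)
      have h6 := min_le_right (C / 2) (1 - v z3)
      have h7 : 0 < 1 - v z3 := by linarith [lt1 z3]
      have h8 := Real.exp_pos (-(gam * z))
      have h9 : min (C / 2) (1 - v z3) * Real.exp (-(gam * z)) ≤ (1 - v z3) * 1 :=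
        mul_le_mul h6 h5 h8.le h7.le
      linarith
  have c0 : 0 < min (C / 2) (1 - v z3) := lt_min (by linarith) (by linarith [lt1 z3])
  have dec : ∀ z, v z ≤ (|M| + 1) * Real.exp z := fun z => by
    rcases le_total z 0 with hz | hz
    · refine (hb z hz).trans ?_
      have := le_abs_self M
      gcongr
      linarith
    · have h1 := Real.one_le_exp hz
      have := abs_nonneg M
      nlinarith [vle z]
  obtain ⟨K, hK⟩ : ∃ K, K = (1 * (1 + lam * p * 1)) + (p * 1 * (1 * (1 + lam * p * 1)) + lam * p * (1 * ((1 * (1 + lam * p * 1)) + 1 + 1)))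
     + lam * p + (2 * C + Real.exp (gam * z2)) + (|M| + 1) := ⟨_, rfl⟩
  have k1 : 0 < (1 * (1 + lam * p * 1)) := by positivity
  have k2 : 0 < p * 1 * (1 * (1 + lam * p * 1)) + lam * p * (1 * ((1 * (1 + lam * p * 1)) + 1 + 1)) := by positivity
  have k3 : 0 < lam * p := by positivity
  have k4 : 0 < 2 * C + Real.exp (gam * z2) := by positivity
  have k5 := abs_nonneg M
  refine ⟨s, G, J, K, min (C / 2) (1 - v z3), z0, ⟨D, hp, hlam, g0, geq, ?_, c0, lt1, vm, s0, s1, G0, ?_, ?_, eq, ?_, conc, ?_, low, ?_, vtop, vbot⟩⟩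
  · linarith
  · exact fun z => (GK z).trans (by linarith)
  · exact fun z => (JK z).trans (by linarith)
  · exact fun z => (grad z).trans (mul_le_mul_of_nonneg_right (by linarith) (by linarith [vle z]))
  · exact fun z => (up z).trans (mul_le_mul_of_nonneg_right (by linarith) (Real.exp_pos _).le)
  · exact fun z => (dec z).trans (mul_le_mul_of_nonneg_right (by linarith) (Real.exp_pos _).le)

end AMS

namespace AMS

theorem taylor_up {f f1 f2 : ℝ → ℝ} (h1 : ∀ x, HasDerivAt f (f1 x) x) (h2 : ∀ x, HasDerivAt f1 (f2 x) x)
    {z t M : ℝ} (ht : 0 ≤ t) (hM : ∀ r, 0 ≤ r → r ≤ t → f2 (z + r) ≤ M) :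
    f (z + t) ≤ f z + t * f1 z + M * t ^ 2 / 2 := by
  have d1 : ∀ r, HasDerivAt (fun r => f1 z + M * r - f1 (z + r)) (M - f2 (z + r)) r := fun r => by
    have e := (((hasDerivAt_id r).const_mul M).const_add (f1 z)).sub ((h2 (z + r)).comp_const_add z r)
    exact e.congr_deriv (by simp)
  have d0 : ∀ r, HasDerivAt (fun r => f z + r * f1 z + M * r ^ 2 / 2 - f (z + r)) (f1 z + M * r - f1 (z + r)) r := fun r => by
    have e := ((((hasDerivAt_id r).mul_const (f1 z)).const_add (f z)).add
      ((((hasDerivAt_id r).pow 2).const_mul M).div_const 2)).sub ((h1 (z + r)).comp_const_add z r)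
    exact e.congr_deriv (by simp; ring)
  have m1 : MonotoneOn (fun r => f1 z + M * r - f1 (z + r)) (Set.Icc 0 t) := by
    refine monotoneOn_of_deriv_nonneg (convex_Icc 0 t)
        (fun y _ => (d1 y).continuousAt.continuousWithinAt)
        (fun y _ => (d1 y).differentiableAt.differentiableWithinAt) fun y hy => ?_
    rw [interior_Icc] at hy
    rw [(d1 y).deriv]
    linarith [hM y hy.1.le hy.2.le]
  have m0 : MonotoneOn (fun r => f z + r * f1 z + M * r ^ 2 / 2 - f (z + r)) (Set.Icc 0 t) := by
    refine monotoneOn_of_deriv_nonneg (convex_Icc 0 t)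
        (fun y _ => (d0 y).continuousAt.continuousWithinAt)
        (fun y _ => (d0 y).differentiableAt.differentiableWithinAt) fun y hy => ?_
    rw [interior_Icc] at hy
    rw [(d0 y).deriv]
    have := m1 (Set.left_mem_Icc.2 ht) ⟨hy.1.le, hy.2.le⟩ hy.1.le
    simpa using this
  have := m0 (Set.left_mem_Icc.2 ht) (Set.right_mem_Icc.2 ht) ht
  simp at this
  linarith

theorem taylor_dn {f f1 f2 : ℝ → ℝ} (h1 : ∀ x, HasDerivAt f (f1 x) x) (h2 : ∀ x, HasDerivAt f1 (f2 x) x)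
    {z t M : ℝ} (ht : 0 ≤ t) (hM : ∀ r, 0 ≤ r → r ≤ t → f2 (z - r) ≤ M) :
    f (z - t) ≤ f z - t * f1 z + M * t ^ 2 / 2 := by
  have := taylor_up (f := fun y => f (-y)) (f1 := fun y => - f1 (-y)) (f2 := fun y => f2 (-y)) (z := -z)
    (fun y => by
      have := (h1 (-y)).scomp y (hasDerivAt_neg y)
      exact HasDerivAt.congr_deriv (f := fun y => f (-y)) this (by simp))
    (fun y => by
      have := ((h2 (-y)).scomp y (hasDerivAt_neg y)).neg
      exact HasDerivAt.congr_deriv (f := fun y => - f1 (-y)) this (by simp)) ht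
    (M := M) (fun r h0 h1 => by have := hM r h0 h1; simpa [sub_eq_add_neg, add_comm] using this)
  simp only [neg_neg, neg_add_rev] at this
  have e : -t + z = z - t := by ring
  rw [e] at this
  linarith

noncomputable def C2 (p : ℝ) : ℝ := p ^ 2 * Real.exp p

section
variable {p lam gam K c z0 : ℝ} {φ s G J : ℝ → ℝ}

theorem Wave.dpow (w : Wave p lam gam K c z0 φ s G J) (z : ℝ) :
    HasDerivAt (fun y => φ y ^ p) (p * φ z ^ p * s z) z := rpow_hd (w.pos z) (w.d1 z)

theorem Wave.dpow2 (w : Wave p lam gam K c z0 φ s G J) (z : ℝ) :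
    HasDerivAt (fun y => p * φ y ^ p * s y) (p * φ z ^ p * ((p - 1) * s z ^ 2 + G z + 1)) z :=
  (((w.dpow z).const_mul p).mul (w.d2 z)).congr_deriv (by ring)

theorem Wave.pow_pos (w : Wave p lam gam K c z0 φ s G J) (z : ℝ) : 0 < φ z ^ p :=
  Real.rpow_pos_of_pos (w.pos z) p

theorem Wave.pow_le_one (w : Wave p lam gam K c z0 φ s G J) (z : ℝ) : φ z ^ p ≤ 1 :=
  Real.rpow_le_one (w.pos z).le (w.lt1 z).le (by linarith [w.p1])

theorem Wave.pow_bd (w : Wave p lam gam K c z0 φ s G J) (z r : ℝ) (hr : |r| ≤ 1) :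
    p * φ (z + r) ^ p * ((p - 1) * s (z + r) ^ 2 + G (z + r) + 1) ≤ C2 p * φ z ^ p := by
  have hp := w.p1
  have h1 := harnack w.d1 (fun x => by
      rw [abs_mul, abs_of_pos (w.pos x), abs_of_pos (w.s0 x)]; nlinarith [w.s1 x, w.pos x]) (z + r) z
  have h2 : φ (z + r) ≤ φ z * Real.exp 1 := by
    have : Real.exp (-1) ≤ Real.exp (-|z + r - z|) := Real.exp_le_exp.2 (by simpa using hr)
    have h3 : φ (z + r) * Real.exp (-1) ≤ φ z := (mul_le_mul_of_nonneg_left this (w.pos _).le).trans h1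
    rw [Real.exp_neg, ← div_eq_mul_inv, div_le_iff₀ (Real.exp_pos _)] at h3
    exact h3
  have h3 : φ (z + r) ^ p ≤ φ z ^ p * Real.exp p := by
    have := Real.rpow_le_rpow (w.pos _).le h2 (by linarith : 0 ≤ p)
    rwa [Real.mul_rpow (w.pos z).le (Real.exp_pos _).le, ← Real.exp_mul, one_mul] at this
  have h4 : (p - 1) * s (z + r) ^ 2 + G (z + r) + 1 ≤ p := by
    have : s (z + r) ^ 2 ≤ 1 := pow_le_one₀ (w.s0 _).le (w.s1 _)
    nlinarith [w.G0 (z + r)]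
  unfold C2
  calc _ ≤ p * φ (z + r) ^ p * p := by
        have := w.pow_pos (z + r)
        gcongr
    _ ≤ p * (φ z ^ p * Real.exp p) * p := by gcongr
    _ = _ := by ring

theorem Wave.shift_up (w : Wave p lam gam K c z0 φ s G J) (z t : ℝ) (h0 : 0 ≤ t) (h1 : t ≤ 1) :
    φ (z + t) ^ p ≤ φ z ^ p + t * (p * φ z ^ p * s z) + C2 p * t ^ 2 * φ z ^ p := by
  have := taylor_up w.dpow w.dpow2 (z := z) h0 (fun r hr hrt => w.pow_bd z r (by
    rw [abs_of_nonneg hr]; linarith))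
  have h2 : 0 ≤ C2 p * φ z ^ p * t ^ 2 := by
    have := w.pow_pos z
    unfold C2; positivity
  linarith

theorem Wave.shift_dn (w : Wave p lam gam K c z0 φ s G J) (z t : ℝ) (h0 : 0 ≤ t) (h1 : t ≤ 1) :
    φ (z - t) ^ p ≤ φ z ^ p - t * (p * φ z ^ p * s z) + C2 p * t ^ 2 * φ z ^ p := by
  have := taylor_dn w.dpow w.dpow2 (z := z) h0 (fun r hr hrt => by
    have := w.pow_bd z (-r) (by rw [abs_neg, abs_of_nonneg hr]; linarith)
    rwa [← sub_eq_add_neg] at this)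
  have h2 : 0 ≤ C2 p * φ z ^ p * t ^ 2 := by
    have := w.pow_pos z
    unfold C2; positivity
  linarith

noncomputable def Lw (p lam : ℝ) : ℝ := 2 + lam * p + 2 * (C2 p * lam ^ 2)

theorem Wave.compare_step (w : Wave p lam gam K c z0 φ s G J) {δ e' L : ℝ} (hδ : 0 < δ) (hδ1 : δ < 1)
    (he : δ ≤ e') (hL : Lw p lam ≤ L) (hLδ : L * δ ≤ 1) {u su Gu Ju g : ℝ → ℝ} (D : Data u su Gu Ju)
    (ule : ∀ x, u x ≤ 1)
    (hu : ∀ x, (1 - δ) * u x ^ p + δ * u x - g x ^ p = δ * (u x * (Gu x + 1)))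
    (a : ℝ) (hg : ∀ x, g x ^ p ≤ (1 + e') * φ (x + a + lam * δ) ^ p) (x : ℝ) :
    u x ^ p ≤ (1 + e' * (1 + L * δ)) * φ (x + a) ^ p := by
  have hp := w.p1
  have hl := w.lam1
  have hp0 : 0 < p := by linarith
  have hC : 0 < C2 p := by unfold C2; positivity
  have hLl : lam ≤ L := by
    refine le_trans ?_ hL
    unfold Lw
    have : 0 < C2 p * lam ^ 2 := by positivity
    nlinarith
  have hL0 : 0 < L := by linarith
  have ht : lam * δ ≤ 1 := by nlinarith
  have he0 : 0 < e' := by linarith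
  obtain ⟨E, hE⟩ : ∃ E, E = 1 + e' * (1 + L * δ) := ⟨_, rfl⟩
  have hE1 : 1 < E := by rw [hE]; have : 0 < e' * (1 + L * δ) := by positivity
                         linarith
  obtain ⟨q, hq⟩ : ∃ q : ℝ, q = E ^ (p⁻¹) := ⟨_, rfl⟩
  have hq1 : 1 ≤ q := by rw [hq]; exact Real.one_le_rpow hE1.le (by positivity)
  have hqp : q ^ p = E := by rw [hq, Real.rpow_inv_rpow (by linarith) hp0.ne']
  have hcmp : u x ≤ q * φ (x + a) := by
    refine step_compare hp hδ hδ1 (w := fun x => q * φ (x + a)) D.d1 D.dd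
      (fun x => ((w.d1 (x + a)).comp_add_const x a).const_mul q)
      (fun x => ((w.dd (x + a)).comp_add_const x a).const_mul q)
      (N := 1) ule (fun x => mul_pos (by linarith) (w.pos _)) (fun x => ?_) x
    have h1 := hu x
    have h2 := hg x
    have h3 := w.shift_up (x + a) (lam * δ) (by positivity) ht
    have h4 := w.eq (x + a)
    rw [Real.mul_rpow (by linarith) (w.pos _).le, hqp]
    have hψ := w.pow_pos (x + a)
    have hs0 := w.s0 (x + a)
    have hs1 := w.s1 (x + a)
    obtain ⟨ψ, hψd⟩ : ∃ ψ, ψ = φ (x + a) ^ p := ⟨_, rfl⟩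
    obtain ⟨S, hSd⟩ : ∃ S, S = p * ψ * s (x + a) := ⟨_, rfl⟩
    rw [← hψd] at h3 h4 hψ ⊢
    rw [← hSd] at h3 h4
    have hS0 : 0 < S := by rw [hSd]; positivity
    have hS1 : S ≤ p * ψ := by rw [hSd]; exact mul_le_of_le_one_right (by positivity) hs1
    have key : δ * (q * φ (x + a)) - δ * (q * (φ (x + a) * (G (x + a) + 1))) = δ * q * (lam * S + ψ) := by
      have : φ (x + a) - φ (x + a) * (G (x + a) + 1) = lam * S + ψ := by linarith
      rw [← this]; ring
    have k2 : δ * (lam * S + ψ) ≤ δ * q * (lam * S + ψ) := by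
      have : 0 ≤ δ * (lam * S + ψ) := by positivity
      nlinarith
    have k3 : (1 + e') * φ (x + a + lam * δ) ^ p ≤ (1 + e') * (ψ + lam * δ * S + C2 p * (lam * δ) ^ 2 * ψ) := by
      gcongr
    have k4 : (1 + e') * (ψ + lam * δ * S + C2 p * (lam * δ) ^ 2 * ψ) ≤ (1 - δ) * (E * ψ) + δ * (lam * S + ψ) := by
      have m1 : e' * (lam * δ) * S ≤ e' * (lam * δ) * (p * ψ) := by gcongr
      have m2 : C2 p * (lam * δ) ^ 2 * ψ ≤ C2 p * lam ^ 2 * (δ * e') * ψ := by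
        have : (lam * δ) ^ 2 ≤ lam ^ 2 * (δ * e') := by
          rw [mul_pow, pow_two δ]; gcongr
        have := mul_le_mul_of_nonneg_right (mul_le_mul_of_nonneg_left this hC.le) hψ.le
        linarith
      have m3 : e' * (C2 p * (lam * δ) ^ 2 * ψ) ≤ C2 p * lam ^ 2 * (δ * e') * ψ := by
        have : δ ^ 2 ≤ δ := by nlinarith
        have := mul_le_mul_of_nonneg_left this (show 0 ≤ e' * C2 p * lam ^ 2 * ψ by positivity)
        linarith
      have m4 : e' * (L * δ) * δ * ψ ≤ e' * δ * ψ := by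
        have := mul_le_mul_of_nonneg_left hLδ (show 0 ≤ e' * δ * ψ by positivity)
        linarith
      have m5 : Lw p lam * (e' * δ * ψ) ≤ L * (e' * δ * ψ) := by gcongr
      unfold Lw at m5
      rw [hE]
      linarith only [m1, m2, m3, m4, m5]
    linarith only [h1, h2, key, k2, k3, k4]
  have := Real.rpow_le_rpow (D.pos x).le hcmp hp0.le
  rw [Real.mul_rpow (by linarith) (w.pos _).le, hqp, hE] at this
  exact this

end

theorem Data.refl {g s G J : ℝ → ℝ} (h : Data g s G J) :
    Data (fun x => g (-x)) (fun x => -s (-x)) (fun x => G (-x)) (fun x => -J (-x)) := by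
  refine ⟨fun x => h.pos _, fun x => ?_, fun x => ?_, fun x => ?_⟩
  · exact ((h.d1 (-x)).scomp x (hasDerivAt_neg x)).congr_deriv (by simp)
  · exact (((h.d2 (-x)).scomp x (hasDerivAt_neg x)).neg).congr_deriv (by simp)
  · exact ((h.d3 (-x)).scomp x (hasDerivAt_neg x)).congr_deriv (by simp)

theorem Data.shift {g s G J : ℝ → ℝ} (h : Data g s G J) (a : ℝ) :
    Data (fun x => g (x + a)) (fun x => s (x + a)) (fun x => G (x + a)) (fun x => J (x + a)) :=
  ⟨fun x => h.pos _, fun x => (h.d1 (x + a)).comp_add_const x a,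
    fun x => (h.d2 (x + a)).comp_add_const x a, fun x => (h.d3 (x + a)).comp_add_const x a⟩

/-- One Rothe sequence. -/
structure Rothe (p δ N Q : ℝ) (U S G J : ℕ → ℝ → ℝ) : Prop where
  good : ∀ k, Good p N Q (U k) (S k) (G k) (J k)
  step : ∀ k x, (1 - δ) * U (k + 1) x ^ p + δ * U (k + 1) x - U k x ^ p
    = δ * (U (k + 1) x * (G (k + 1) x + 1))

theorem rothe_exists {p δ N Q : ℝ} (hp : 1 < p) (hδ : 0 < δ) (hδ1 : δ < 1) (hN : N0 p ≤ N)
    (hQ : Q1 p N ≤ Q) {g s G J : ℝ → ℝ} (hg : Good p N Q g s G J) :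
    ∃ U S G J, Rothe p δ N Q U S G J ∧ U 0 = g := by
  let X := {q : (ℝ → ℝ) × (ℝ → ℝ) × (ℝ → ℝ) × (ℝ → ℝ) // Good p N Q q.1 q.2.1 q.2.2.1 q.2.2.2}
  have hstep : ∀ q : X, ∃ q' : X, ∀ x, (1 - δ) * q'.1.1 x ^ p + δ * q'.1.1 x - q.1.1 x ^ p
    = δ * (q'.1.1 x * (q'.1.2.2.1 x + 1)) := fun q => by
    obtain ⟨u, s, G, J, h, h'⟩ := good_step hp hδ hδ1 hN hQ q.2
    exact ⟨⟨(u, s, G, J), h⟩, h'⟩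
  choose f hf using hstep
  let q : ℕ → X := fun k => Nat.rec ⟨(g, s, G, J), hg⟩ (fun _ q => f q) k
  exact ⟨fun k => (q k).1.1, fun k => (q k).1.2.1, fun k => (q k).1.2.2.1, fun k => (q k).1.2.2.2,
    ⟨fun k => (q k).2, fun k x => hf (q k) x⟩, rfl⟩

/-- Comparison of the whole sequence with the two waves. -/
theorem Wave.compare {p lam gam K c z0 : ℝ} {φ s G J : ℝ → ℝ} (w : Wave p lam gam K c z0 φ s G J)
    {δ N Q L : ℝ} (hδ : 0 < δ) (hδ1 : δ < 1)
    (hL : Lw p lam ≤ L) (hLδ : L * δ ≤ 1) {U S GU JU : ℕ → ℝ → ℝ} (R : Rothe p δ N Q U S GU JU)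
    (a : ℝ) (h0 : ∀ x, U 0 x ≤ φ (x + a)) (k : ℕ) (x : ℝ) :
    U k x ^ p ≤ (1 + δ * (1 + L * δ) ^ k) * φ (x + (a - lam * (k * δ))) ^ p := by
  have hp := w.p1
  have hC : 0 < C2 p := by unfold C2; positivity
  have hL0 : 0 < L := by
    refine lt_of_lt_of_le ?_ hL
    unfold Lw
    have := w.lam1
    positivity
  induction k generalizing x with
  | zero =>
    have h1 := Real.rpow_le_rpow ((R.good 0).pos x).le (h0 x) (by linarith : 0 ≤ p)
    have h2 := w.pow_pos (x + a)
    simp only [pow_zero, mul_one, Nat.cast_zero, zero_mul, mul_zero, sub_zero]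
    nlinarith
  | succ k ih =>
    have h1 : δ ≤ δ * (1 + L * δ) ^ k := le_mul_of_one_le_right hδ.le
      (one_le_pow₀ (by have := mul_pos hL0 hδ; linarith))
    have := w.compare_step hδ hδ1 h1 hL hLδ (R.good (k + 1)).toData (R.good (k + 1)).le1 (R.step k)
      (a - lam * ((k + 1 : ℕ) * δ)) (fun x => by
        have := ih x
        convert this using 3
        push_cast; ring) x
    rw [pow_succ, ← mul_assoc]
    exact this

theorem Rothe.refl {p δ N Q : ℝ} {U S G J : ℕ → ℝ → ℝ} (R : Rothe p δ N Q U S G J) :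
    Rothe p δ N Q (fun k x => U k (-x)) (fun k x => -S k (-x)) (fun k x => G k (-x)) (fun k x => -J k (-x)) := by
  refine ⟨fun k => ?_, fun k x => R.step k (-x)⟩
  have h := R.good k
  obtain ⟨C, hC⟩ := h.dec
  exact ⟨h.toData.refl, fun x => h.le1 _, fun x => h.G0 _, fun x => by rw [abs_neg]; exact h.s1 _,
    fun x => by rw [neg_sq]; exact h.hN _, fun x => by rw [neg_sq]; exact h.hQ _,
    C, fun x => by have := hC (-x); rwa [abs_neg] at this⟩

end AMS

namespace AMS

section
variable {p lam gam K c z0 : ℝ} {φ s G J : ℝ → ℝ}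

theorem Wave.weaken (w : Wave p lam gam K c z0 φ s G J) {K' c' z0' : ℝ} (hK : K ≤ K') (hc0 : 0 < c')
    (hc : c' ≤ c) (hz : z0 ≤ z0') : Wave p lam gam K' c' z0' φ s G J where
  toData := w.toData
  p1 := w.p1
  lam1 := w.lam1
  gam0 := w.gam0
  gameq := w.gameq
  K1 := w.K1.trans hK
  c0 := hc0
  lt1 := w.lt1
  mono := w.mono
  s0 := w.s0
  s1 := w.s1
  G0 := w.G0
  GK := fun z => (w.GK z).trans hK
  JK := fun z => (w.JK z).trans hK
  eq := w.eq
  grad := fun z => (w.grad z).trans (mul_le_mul_of_nonneg_right hK (by linarith [w.lt1 z]))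
  conc := fun z h => w.conc z (hz.trans h)
  up := fun z => (w.up z).trans (mul_le_mul_of_nonneg_right hK (Real.exp_pos _).le)
  low := fun z h => (mul_le_mul_of_nonneg_right hc (Real.exp_pos _).le).trans (w.low z h)
  dec := fun z => (w.dec z).trans (mul_le_mul_of_nonneg_right hK (Real.exp_pos _).le)
  top := w.top
  bot := w.bot

theorem Data.contG {g s G J : ℝ → ℝ} (h : Data g s G J) : Continuous G :=
  continuous_iff_continuousAt.2 fun y => (h.d3 y).continuousAt

theorem Data.conts {g s G J : ℝ → ℝ} (h : Data g s G J) : Continuous s :=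
  continuous_iff_continuousAt.2 fun y => (h.d2 y).continuousAt

theorem Wave.integrable_of_le (w : Wave p lam gam K c z0 φ s G J) {F : ℝ → ℝ} (hF : Continuous F) {L A : ℝ}
    (hL : 0 ≤ L) (hb : ∀ x, |F x| ≤ L * φ (x + A)) (X : ℝ) : IntegrableOn F (Set.Iic X) := by
  have h1 : IntegrableOn (fun x => L * (K * Real.exp A) * Real.exp (1 * x)) (Set.Iic X) :=
    (integrableOn_exp_mul_Iic one_pos X).const_mul _
  refine Integrable.mono' h1 hF.aestronglyMeasurable (Eventually.of_forall fun x => ?_)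
  rw [Real.norm_eq_abs]
  refine (hb x).trans ?_
  have h2 := mul_le_mul_of_nonneg_left (w.dec (x + A)) hL
  rw [Real.exp_add] at h2
  rw [one_mul]
  linarith

theorem Wave.half_step (w : Wave p lam gam K c z0 φ s G J) (A X : ℝ) {δ : ℝ} (hδ : 0 ≤ δ) (hl : lam * δ ≤ 1) :
    ∫ x in Set.Iic X, φ (x + (A - lam * δ)) ^ p ≤ (1 + C2 p * (lam * δ) ^ 2) * (∫ x in Set.Iic X, φ (x + A) ^ p)
      + δ * (∫ x in Set.Iic X, (φ (x + A) ^ p - φ (x + A))) + δ * (φ (X + A) * s (X + A)) := by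
  have hp := w.p1
  have hl1 := w.lam1
  have hc := w.cont
  have hpw : Continuous (fun x => φ x ^ p) := hc.rpow_const fun x => Or.inl (w.pos x).ne'
  have hle : ∀ x, φ x ^ p ≤ φ x := fun x => by
    have := Real.rpow_le_rpow_of_exponent_ge (w.pos x) (w.lt1 x).le hp.le
    rwa [Real.rpow_one] at this
  have hI0 : ∀ A, IntegrableOn (fun x => φ (x + A)) (Set.Iic X) := fun A =>
    w.integrable_of_le (L := 1) (A := A) (by fun_prop) zero_le_one (fun x => by
      rw [abs_of_pos (w.pos _), one_mul]) X
  have hI1 : ∀ A, IntegrableOn (fun x => φ (x + A) ^ p) (Set.Iic X) := fun A =>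
    w.integrable_of_le (L := 1) (A := A) (hpw.comp (continuous_add_const A)) zero_le_one (fun x => by
      show |φ (x + A) ^ p| ≤ _
      rw [abs_of_pos (w.pow_pos _), one_mul]; exact hle _) X
  have hcG := w.contG
  have hI2 : IntegrableOn (fun x => φ (x + A) * (G (x + A) + 1)) (Set.Iic X) :=
    w.integrable_of_le (L := K + 1) (A := A) (by fun_prop) (by linarith [w.K1]) (fun x => by
      rw [abs_mul, abs_of_pos (w.pos _), mul_comm]
      refine mul_le_mul_of_nonneg_right ?_ (w.pos _).le
      exact aadd (w.GK _) (by simp)) X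
  have e2 : ∫ x in Set.Iic X, φ (x + A) * (G (x + A) + 1) = φ (X + A) * s (X + A) := by
    have := integral_Iic_of_hasDerivAt_of_tendsto' (a := X) (f := fun x => φ (x + A) * s (x + A)) (m := 0)
      (f' := fun x => φ (x + A) * (G (x + A) + 1))
      (fun x _ => (w.dd (x + A)).comp_add_const x A) hI2 ?_
    · rw [this, sub_zero]
    · have h1 : Tendsto (fun x => φ (x + A)) atBot (𝓝 0) :=
        w.bot.comp (tendsto_atBot_add_const_right _ A tendsto_id)
      refine squeeze_zero (fun x => (mul_pos (w.pos _) (w.s0 _)).le) (fun x => ?_) h1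
      exact mul_le_of_le_one_right (w.pos _).le (w.s1 _)
  have hpt : ∀ x, φ (x + (A - lam * δ)) ^ p ≤ (1 + C2 p * (lam * δ) ^ 2) * φ (x + A) ^ p +
      δ * (φ (x + A) ^ p - φ (x + A)) + δ * (φ (x + A) * (G (x + A) + 1)) := fun x => by
    have h1 := w.shift_dn (x + A) (lam * δ) (by positivity) hl
    have h2 := w.eq (x + A)
    have e : x + A - lam * δ = x + (A - lam * δ) := by ring
    rw [e] at h1
    have h3 : lam * δ * (p * φ (x + A) ^ p * s (x + A)) = - δ * (φ (x + A) * (G (x + A) + 1)) - δ * φ (x + A) ^ p + δ * φ (x + A) := by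
      linear_combination δ * h2
    linarith only [h1, h3]
  have i1 := (hI1 A).const_mul (1 + C2 p * (lam * δ) ^ 2)
  have i2 := ((hI1 A).sub (hI0 A)).const_mul δ
  have i3 := hI2.const_mul δ
  have := setIntegral_mono (hI1 (A - lam * δ)) ((i1.add i2).add i3) hpt
  refine this.trans (le_of_eq ?_)
  have e1 := integral_add (i1.add i2) i3
  have e3 := integral_add i1 i2
  simp only [Pi.add_apply, Pi.sub_apply] at e1 e3 ⊢
  rw [e1, e3, integral_const_mul, integral_const_mul, integral_const_mul, e2]

end

/-- the glued profile -/
noncomputable def vm (φ φ' : ℝ → ℝ) (A B x : ℝ) : ℝ := min (φ (x + A)) (φ' (-x + B))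

section
variable {p lam lam' gam gam' K c z0 : ℝ} {φ s G J φ' s' G' J' : ℝ → ℝ}

noncomputable def th (gam gam' : ℝ) : ℝ := gam * gam' / (gam + gam')

theorem cross (w : Wave p lam gam K c z0 φ s G J) (w' : Wave p lam' gam' K c z0 φ' s' G' J') (A B : ℝ) :
    ∃ X, φ (X + A) = φ' (-X + B) := by
  have hc := w.cont
  have hc' := w'.cont
  have h1 : Tendsto (fun x => φ (x + A) - φ' (-x + B)) atBot (𝓝 (0 - 1)) :=
    (w.bot.comp (tendsto_atBot_add_const_right _ A tendsto_id)).sub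
      (w'.top.comp (tendsto_atTop_add_const_right _ B tendsto_neg_atBot_atTop))
  have h2 : Tendsto (fun x => φ (x + A) - φ' (-x + B)) atTop (𝓝 (1 - 0)) :=
    (w.top.comp (tendsto_atTop_add_const_right _ A tendsto_id)).sub
      (w'.bot.comp (tendsto_atBot_add_const_right _ B tendsto_neg_atTop_atBot))
  obtain ⟨a, ha⟩ := (h1.eventually (gt_mem_nhds (by norm_num : (0:ℝ) - 1 < 0))).exists
  obtain ⟨b, hb⟩ := (h2.eventually (lt_mem_nhds (by norm_num : (0:ℝ) < 1 - 0))).exists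
  obtain ⟨X, hX⟩ := mem_range_of_exists_le_of_exists_ge
    (show Continuous (fun x => φ (x + A) - φ' (-x + B)) by fun_prop) ⟨a, ha.le⟩ ⟨b, hb.le⟩
  exact ⟨X, by simp only at hX; linarith⟩

theorem cross_small (w : Wave p lam gam K c z0 φ s G J) (w' : Wave p lam' gam' K c z0 φ' s' G' J') {A B X : ℝ}
    (hX : φ (X + A) = φ' (-X + B)) : 1 - φ (X + A) ≤ K * Real.exp (-(th gam gam' * (A + B))) := by
  have hg := w.gam0
  have hg' := w'.gam0
  rcases le_total ((gam' * B - gam * A) / (gam + gam')) X with h | h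
  · have h1 := w.mono.monotone (add_le_add_left h A)
    refine (by linarith : _ ≤ 1 - φ ((gam' * B - gam * A) / (gam + gam') + A)).trans
      ((w.up _).trans_eq ?_)
    congr 2
    unfold th
    field_simp
    ring
  · rw [hX]
    have h1 := w'.mono.monotone (add_le_add_left (neg_le_neg h) B)
    refine (by linarith : _ ≤ 1 - φ' (-((gam' * B - gam * A) / (gam + gam')) + B)).trans
      ((w'.up _).trans_eq ?_)
    congr 2
    unfold th
    field_simp
    ring

theorem cross_nonneg (w : Wave p lam gam K c z0 φ s G J) (w' : Wave p lam' gam' K c z0 φ' s' G' J') :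
    ∃ S0, ∀ A B X, S0 ≤ A + B → φ (X + A) = φ' (-X + B) → 0 ≤ X + A ∧ 0 ≤ -X + B := by
  have hth : 0 < th gam gam' := by
    have := w.gam0; have := w'.gam0; unfold th; positivity
  have hK := w.K1
  have ht : Tendsto (fun y => K * Real.exp (-(th gam gam' * y))) atTop (𝓝 (K * 0)) :=
    (Real.tendsto_exp_neg_atTop_nhds_zero.comp (tendsto_id.const_mul_atTop hth)).const_mul K
  rw [mul_zero] at ht
  have e1 := ht.eventually (gt_mem_nhds (show (0:ℝ) < 1 - φ 0 by linarith [w.lt1 0]))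
  have e2 := ht.eventually (gt_mem_nhds (show (0:ℝ) < 1 - φ' 0 by linarith [w'.lt1 0]))
  obtain ⟨S0, hS⟩ := (e1.and e2).exists_forall_of_atTop
  refine ⟨S0, fun A B X hAB hX => ?_⟩
  have h1 := cross_small w w' hX
  have h2 := hS _ hAB
  constructor
  · have : φ 0 < φ (X + A) := by linarith
    exact (w.mono.lt_iff_lt.1 this).le
  · have : φ' 0 < φ' (-X + B) := by rw [← hX]; linarith
    exact (w'.mono.lt_iff_lt.1 this).le

theorem vm_left (w : Wave p lam gam K c z0 φ s G J) (w' : Wave p lam' gam' K c z0 φ' s' G' J') {A B X x : ℝ}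
    (hX : φ (X + A) = φ' (-X + B)) (h : x ≤ X) : vm φ φ' A B x = φ (x + A) := by
  unfold vm
  refine min_eq_left ?_
  have h1 := w.mono.monotone (add_le_add_left h A)
  have h2 := w'.mono.monotone (add_le_add_left (neg_le_neg h) B)
  linarith

theorem vm_right (w : Wave p lam gam K c z0 φ s G J) (w' : Wave p lam' gam' K c z0 φ' s' G' J') {A B X x : ℝ}
    (hX : φ (X + A) = φ' (-X + B)) (h : X ≤ x) : vm φ φ' A B x = φ' (-x + B) := by
  unfold vm
  refine min_eq_right ?_
  have h1 := w.mono.monotone (add_le_add_left h A)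
  have h2 := w'.mono.monotone (add_le_add_left (neg_le_neg h) B)
  linarith

theorem integrableOn_neg {F : ℝ → ℝ} {X : ℝ} (h : IntegrableOn F (Set.Iic (-X))) :
    IntegrableOn (fun x => F (-x)) (Set.Ioi X) := by
  have := (integrableOn_Ici_iff_integrableOn_Ioi (μ := volume) (f := fun x => F (-x)) (b := X)).1
  apply this
  have h3 := (Measure.measurePreserving_neg (volume : Measure ℝ)).integrableOn_comp_preimage
    (Homeomorph.neg ℝ).measurableEmbedding (f := F) (s := Set.Iic (-X))
  have h4 := h3.2 h
  have e : (Neg.neg ⁻¹' Set.Iic (-X) : Set ℝ) = Set.Ici X := by ext; simp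
  rw [e] at h4
  exact h4

theorem vm_integral (w : Wave p lam gam K c z0 φ s G J) (w' : Wave p lam' gam' K c z0 φ' s' G' J') {A B X : ℝ}
    (hX : φ (X + A) = φ' (-X + B)) {F : ℝ → ℝ} (hF : Continuous F) (hb : ∀ t, 0 < t → t < 1 → |F t| ≤ t) :
    Integrable (fun x => F (vm φ φ' A B x)) ∧
    ∫ x, F (vm φ φ' A B x) = (∫ x in Set.Iic X, F (φ (x + A))) + ∫ x in Set.Iic (-X), F (φ' (x + B)) := by
  have hc := w.cont
  have hc' := w'.cont
  have i1 : IntegrableOn (fun x => F (φ (x + A))) (Set.Iic X) :=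
    w.integrable_of_le (L := 1) (A := A) (by fun_prop) zero_le_one
      (fun x => by rw [one_mul]; exact hb _ (w.pos _) (w.lt1 _)) X
  have i2 : IntegrableOn (fun x => F (φ' (x + B))) (Set.Iic (-X)) :=
    w'.integrable_of_le (L := 1) (A := B) (by fun_prop) zero_le_one
      (fun x => by rw [one_mul]; exact hb _ (w'.pos _) (w'.lt1 _)) (-X)
  have i3 := integrableOn_neg i2
  have j1 : IntegrableOn (fun x => F (vm φ φ' A B x)) (Set.Iic X) :=
    i1.congr_fun (fun x hx => by simp only [vm_left w w' hX hx]) measurableSet_Iic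
  have j2 : IntegrableOn (fun x => F (vm φ φ' A B x)) (Set.Ioi X) :=
    i3.congr_fun (fun x hx => by simp only [vm_right w w' hX (le_of_lt hx)]) measurableSet_Ioi
  have j : Integrable (fun x => F (vm φ φ' A B x)) := by
    rw [← integrableOn_univ, ← Set.Iic_union_Ioi (a := X)]
    exact j1.union j2
  refine ⟨j, ?_⟩
  rw [← intervalIntegral.integral_Iic_add_Ioi j1 j2]
  congr 1
  · exact setIntegral_congr_fun measurableSet_Iic fun x hx => by simp only [vm_left w w' hX hx]
  · rw [← integral_comp_neg_Ioi X (fun x => F (φ' (x + B)))]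
    exact setIntegral_congr_fun measurableSet_Ioi fun x hx => by simp only [vm_right w w' hX (le_of_lt hx)]

end
end AMS

namespace AMS

theorem abs_rpow_sub_le {p : ℝ} (hp : 1 < p) {t : ℝ} (h0 : 0 < t) (h1 : t < 1) : |t ^ p - t| ≤ t := by
  have h2 := Real.rpow_le_rpow_of_exponent_ge h0 h1.le hp.le
  rw [Real.rpow_one] at h2
  have h3 := Real.rpow_pos_of_pos h0 p
  rw [abs_le]; constructor <;> linarith

theorem abs_rpow_le {p : ℝ} (hp : 1 < p) {t : ℝ} (h0 : 0 < t) (h1 : t < 1) : |t ^ p| ≤ t := by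
  have h2 := Real.rpow_le_rpow_of_exponent_ge h0 h1.le hp.le
  rw [Real.rpow_one] at h2
  have h3 := Real.rpow_pos_of_pos h0 p
  rwa [abs_of_pos h3]

section
variable {p lam lam' gam gam' K c z0 : ℝ} {φ s G J φ' s' G' J' : ℝ → ℝ}

theorem vm_cont (w : Wave p lam gam K c z0 φ s G J) (w' : Wave p lam' gam' K c z0 φ' s' G' J') (A B : ℝ) :
    Continuous (vm φ φ' A B) := by
  have hc := w.cont
  have hc' := w'.cont
  unfold vm
  fun_prop

theorem vm_pos (w : Wave p lam gam K c z0 φ s G J) (w' : Wave p lam' gam' K c z0 φ' s' G' J') (A B x : ℝ) :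
    0 < vm φ φ' A B x := lt_min (w.pos _) (w'.pos _)

theorem vm_lt (w : Wave p lam gam K c z0 φ s G J) (A B x : ℝ) :
    vm φ φ' A B x < 1 := (min_le_left _ _).trans_lt (w.lt1 _)

theorem vm_anti (w : Wave p lam gam K c z0 φ s G J) (w' : Wave p lam' gam' K c z0 φ' s' G' J') {A B A2 B2 : ℝ}
    (hA : A2 ≤ A) (hB : B2 ≤ B) (x : ℝ) : vm φ φ' A2 B2 x ≤ vm φ φ' A B x :=
  min_le_min (w.mono.monotone (by linarith)) (w'.mono.monotone (by linarith))

theorem vm_int (w : Wave p lam gam K c z0 φ s G J) (w' : Wave p lam' gam' K c z0 φ' s' G' J') (A B : ℝ) :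
    Integrable (vm φ φ' A B) := by
  obtain ⟨X, hX⟩ := cross w w' A B
  exact (vm_integral w w' hX continuous_id (fun t h0 _ => by simp [abs_of_pos h0])).1

theorem rpow_cont {p : ℝ} (hp : 1 < p) : Continuous (fun t : ℝ => t ^ p) :=
  continuous_id.rpow_const fun _ => Or.inr (by linarith)

theorem vmp_int (w : Wave p lam gam K c z0 φ s G J) (w' : Wave p lam' gam' K c z0 φ' s' G' J') (A B : ℝ) :
    Integrable (fun x => vm φ φ' A B x ^ p) := by
  obtain ⟨X, hX⟩ := cross w w' A B
  exact (vm_integral w w' hX (rpow_cont w.p1) (fun t h0 h1 => abs_rpow_le w.p1 h0 h1)).1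

theorem V_step (w : Wave p lam gam K c z0 φ s G J) (w' : Wave p lam' gam' K c z0 φ' s' G' J') (A B : ℝ) {δ : ℝ}
    (hδ : 0 ≤ δ) (hl : lam * δ ≤ 1) (hl' : lam' * δ ≤ 1) :
    ∫ x, vm φ φ' (A - lam * δ) (B - lam' * δ) x ^ p ≤ (1 + C2 p * (lam ^ 2 + lam' ^ 2) * δ ^ 2) * (∫ x, vm φ φ' A B x ^ p)
      + δ * (∫ x, (vm φ φ' A B x ^ p - vm φ φ' A B x)) + δ * (2 * K ^ 2 * Real.exp (-(th gam gam' * (A + B)))) := by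
  have hp := w.p1
  have hK := w.K1
  obtain ⟨X, hX⟩ := cross w w' A B
  have e1 := (vm_integral w w' hX (rpow_cont hp) (fun t h0 h1 => abs_rpow_le hp h0 h1)).2
  have e2 := (vm_integral w w' hX ((rpow_cont hp).sub continuous_id) (fun t h0 h1 => abs_rpow_sub_le hp h0 h1)).2
  simp only [id, Pi.sub_apply] at e1 e2
  have a1 := w.half_step A X hδ hl
  have a2 := w'.half_step B (-X) hδ hl'
  have n1 : 0 ≤ ∫ x in Set.Iic X, φ (x + A) ^ p := integral_nonneg fun x => (w.pow_pos _).le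
  have n2 : 0 ≤ ∫ x in Set.Iic (-X), φ' (x + B) ^ p := integral_nonneg fun x => (w'.pow_pos _).le
  have g1 := w.grad (X + A)
  have g2 := w'.grad (-X + B)
  rw [← hX] at g2
  have hs := mul_le_mul_of_nonneg_left (cross_small w w' hX) (by linarith : 0 ≤ K)
  have up : ∫ x, vm φ φ' (A - lam * δ) (B - lam' * δ) x ^ p ≤ (∫ x in Set.Iic X, φ (x + (A - lam * δ)) ^ p)
      + ∫ x in Set.Iic (-X), φ' (x + (B - lam' * δ)) ^ p := by
    have hI := vmp_int w w' (A - lam * δ) (B - lam' * δ)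
    have i1 : IntegrableOn (fun x => φ (x + (A - lam * δ)) ^ p) (Set.Iic X) :=
      w.integrable_of_le (L := 1) (A := A - lam * δ) ((rpow_cont hp).comp (w.cont.comp (continuous_add_const _))) zero_le_one
      (fun x => by rw [one_mul]; exact abs_rpow_le hp (w.pos _) (w.lt1 _)) X
    have i2 : IntegrableOn (fun x => φ' (x + (B - lam' * δ)) ^ p) (Set.Iic (-X)) :=
      w'.integrable_of_le (L := 1) (A := B - lam' * δ) ((rpow_cont hp).comp (w'.cont.comp (continuous_add_const _))) zero_le_one
      (fun x => by rw [one_mul]; exact abs_rpow_le hp (w'.pos _) (w'.lt1 _)) (-X)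
    rw [← intervalIntegral.integral_Iic_add_Ioi (b := X) hI.integrableOn hI.integrableOn,
      ← integral_comp_neg_Ioi X (fun x => φ' (x + (B - lam' * δ)) ^ p)]
    refine add_le_add (setIntegral_mono hI.integrableOn i1 fun x => ?_)
      (setIntegral_mono hI.integrableOn (integrableOn_neg i2) fun x => ?_)
    · exact Real.rpow_le_rpow (vm_pos w w' _ _ _).le (min_le_left _ _) (by linarith)
    · exact Real.rpow_le_rpow (vm_pos w w' _ _ _).le (min_le_right _ _) (by linarith)
  have hC : 0 ≤ C2 p := by unfold C2; positivity
  rw [e1, e2]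
  have m1 : C2 p * (lam * δ) ^ 2 * (∫ x in Set.Iic X, φ (x + A) ^ p) ≤ C2 p * (lam ^ 2 + lam' ^ 2) * δ ^ 2 * (∫ x in Set.Iic X, φ (x + A) ^ p) := by
    refine mul_le_mul_of_nonneg_right ?_ n1
    rw [mul_pow, ← mul_assoc]
    refine mul_le_mul_of_nonneg_right (mul_le_mul_of_nonneg_left ?_ hC) (sq_nonneg _)
    linarith [sq_nonneg lam']
  have m2 : C2 p * (lam' * δ) ^ 2 * (∫ x in Set.Iic (-X), φ' (x + B) ^ p) ≤ C2 p * (lam ^ 2 + lam' ^ 2) * δ ^ 2 * (∫ x in Set.Iic (-X), φ' (x + B) ^ p) := by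
    refine mul_le_mul_of_nonneg_right ?_ n2
    rw [mul_pow, ← mul_assoc]
    refine mul_le_mul_of_nonneg_right (mul_le_mul_of_nonneg_left ?_ hC) (sq_nonneg _)
    linarith [sq_nonneg lam]
  have m3 : φ (X + A) * s (X + A) + φ' (-X + B) * s' (-X + B) ≤ 2 * K ^ 2 * Real.exp (-(th gam gam' * (A + B))) := by
    rw [← hX]
    linarith
  have m4 := mul_le_mul_of_nonneg_left m3 hδ
  linarith only [up, a1, a2, m1, m2, m4]

theorem Data.mul {g s G J g' s' G' J' : ℝ → ℝ} (h : Data g s G J) (h' : Data g' s' G' J') :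
    Data (fun x => g x * g' x) (fun x => s x + s' x) (fun x => G x + G' x + 1 + 2 * (s x * s' x))
      (fun x => J x + J' x + 2 * ((G x + 1 - s x ^ 2) * s' x + s x * (G' x + 1 - s' x ^ 2))) := by
  refine ⟨fun x => mul_pos (h.pos x) (h'.pos x), fun x => ?_, fun x => ?_, fun x => ?_⟩
  · exact ((h.d1 x).mul (h'.d1 x)).congr_deriv (by ring)
  · exact ((h.d2 x).add (h'.d2 x)).congr_deriv (by ring)
  · exact ((((h.d3 x).add (h'.d3 x)).add_const 1).add (((h.d2 x).mul (h'.d2 x)).const_mul 2)).congr_deriv (by ring)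

noncomputable def Nf (p K : ℝ) : ℝ := N0 p + (2 * K + 3 + p)
noncomputable def Qf (p K : ℝ) : ℝ := Q1 p (Nf p K) + ((6 * K + 8) ^ 2 + B1 p (Nf p K) * (2 * K + 3) ^ 2)

theorem B1_nonneg (p N : ℝ) : 0 ≤ B1 p N := by
  unfold B1; nlinarith [sq_nonneg (K1 p N / 2 + 1)]

theorem sq_le_of_abs {a b : ℝ} (h : |a| ≤ b) : a ^ 2 ≤ b ^ 2 := by
  rw [← sq_abs]; exact pow_le_pow_left₀ (abs_nonneg _) h 2

theorem init_good (w : Wave p lam gam K c z0 φ s G J) (w' : Wave p lam' gam' K c z0 φ' s' G' J') {A B : ℝ}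
    (h0 : 2 * z0 ≤ A + B) : ∃ s1 G1 J1, Good p (Nf p K) (Qf p K) (fun x => φ (x + A) * φ' (-x + B)) s1 G1 J1 := by
  have hp := w.p1
  have hK := w.K1
  have D := (w.toData.shift A).mul (w'.toData.shift B).refl
  have hG : ∀ x, G (x + A) + G' (-x + B) + 1 + 2 * (s (x + A) * -s' (-x + B)) ≤ 0 := fun x => by
    have h1 := mul_pos (w.s0 (x + A)) (w'.s0 (-x + B))
    have h2 := w.G0 (x + A)
    have h3 := w'.G0 (-x + B)
    rcases le_total z0 (x + A) with h | h
    · have := w.conc _ h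
      linarith
    · have := w'.conc (-x + B) (by linarith)
      linarith
  have hs := s_bound D hG
  have as : ∀ x, |s (x + A)| ≤ 1 := fun x => by rw [abs_of_pos (w.s0 _)]; exact w.s1 _
  have as' : ∀ x, |-s' (-x + B)| ≤ 1 := fun x => by rw [abs_neg, abs_of_pos (w'.s0 _)]; exact w'.s1 _
  have aG : ∀ x, |G (x + A) + G' (-x + B) + 1 + 2 * (s (x + A) * -s' (-x + B))| ≤ 2 * K + 3 := fun x => by
    have := aadd (aadd (aadd (w.GK (x + A)) (w'.GK (-x + B))) (abs_one.le : |(1:ℝ)| ≤ 1))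
      (amul (abs_two.le : |(2:ℝ)| ≤ 2) (amul (as x) (as' x)))
    linarith
  have ad : ∀ x, |G (x + A) + 1 - s (x + A) ^ 2| ≤ K + 2 := fun x => by
    have := asub (aadd (w.GK (x + A)) (abs_one.le : |(1:ℝ)| ≤ 1)) (amul (as x) (as x))
    rw [← pow_two] at this
    linarith
  have ad' : ∀ x, |G' (-x + B) + 1 - (-s' (-x + B)) ^ 2| ≤ K + 2 := fun x => by
    have := asub (aadd (w'.GK (-x + B)) (abs_one.le : |(1:ℝ)| ≤ 1)) (amul (as' x) (as' x))
    rw [← pow_two] at this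
    linarith
  have aJ : ∀ x, |J (x + A) + -J' (-x + B) + 2 * ((G (x + A) + 1 - s (x + A) ^ 2) * -s' (-x + B) +
      s (x + A) * (G' (-x + B) + 1 - (-s' (-x + B)) ^ 2))| ≤ 6 * K + 8 := fun x => by
    have := aadd (aadd (w.JK (x + A)) ((abs_neg (J' (-x + B))).trans_le (w'.JK (-x + B))))
      (amul (abs_two.le : |(2:ℝ)| ≤ 2) (aadd (amul (ad x) (as' x)) (amul (as x) (ad' x))))
    linarith
  refine ⟨_, _, _, D, fun x => ?_, hG, hs, fun x => ?_, fun x => ?_, K * (Real.exp A + Real.exp B), fun x => ?_⟩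
  · exact mul_le_one₀ (w.lt1 _).le (w'.pos _).le (w'.lt1 _).le
  · have h1 := (neg_le_abs _).trans (aG x)
    have h2 := sq_le_of_abs (hs x)
    have h3 := mul_le_mul_of_nonneg_left h2 (by linarith : 0 ≤ p)
    have h4 : 0 ≤ N0 p := by unfold N0 cG; positivity
    unfold Nf
    linarith only [h1, h3, h4]
  · have h1 := sq_le_of_abs (aJ x)
    have h2 := mul_le_mul_of_nonneg_left (sq_le_of_abs (aG x)) (B1_nonneg p (Nf p K))
    have h3 : 0 ≤ Q1 p (Nf p K) := by
      have := B1_nonneg p (Nf p K)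
      unfold Q1; positivity
    unfold Qf
    linarith only [h1, h2, h3]
  · have h1 : φ (x + A) * φ' (-x + B) ≤ φ (x + A) := mul_le_of_le_one_right (w.pos _).le (w'.lt1 _).le
    have h2 : φ (x + A) * φ' (-x + B) ≤ φ' (-x + B) := mul_le_of_le_one_left (w'.pos _).le (w.lt1 _).le
    have h3 := w.dec (x + A)
    have h4 := w'.dec (-x + B)
    rw [Real.exp_add] at h3 h4
    rcases le_total 0 x with h | h
    · rw [abs_of_nonneg h]
      have : 0 < K * Real.exp A * Real.exp (-x) := by positivity
      linarith
    · rw [abs_of_nonpos h, neg_neg]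
      have : 0 < K * Real.exp B * Real.exp x := by positivity
      linarith

theorem init_half (w : Wave p lam gam K c z0 φ s G J) (w' : Wave p lam' gam' K c z0 φ' s' G' J') {A B X : ℝ}
    (hX : φ (X + A) = φ' (-X + B)) (h0 : 0 ≤ -X + B)
    (hI : Integrable (fun x => vm φ φ' A B x ^ p - (φ (x + A) * φ' (-x + B)) ^ p)) :
    ∫ x in Set.Iic X, (vm φ φ' A B x ^ p - (φ (x + A) * φ' (-x + B)) ^ p) ≤
      p * K / (gam' * c) * (K * Real.exp (-(th gam gam' * (A + B)))) := by
  have hp := w.p1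
  have hK := w.K1
  have hg := w'.gam0
  have hc := w.c0
  have i1 : IntegrableOn (fun x => p * (K * Real.exp (-(gam' * B))) * Real.exp (gam' * x)) (Set.Iic X) :=
    (integrableOn_exp_mul_Iic hg X).const_mul _
  have h1 := setIntegral_mono_on hI.integrableOn i1 measurableSet_Iic (fun x hx => by
    rw [vm_left w w' hX hx]
    have h2 := rpow_sub_le hp (mul_pos (w.pos (x + A)) (w'.pos (-x + B))).le
      (mul_le_of_le_one_right (w.pos (x + A)).le (w'.lt1 (-x + B)).le) (w.lt1 (x + A)).le
    refine h2.trans ?_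
    rw [mul_assoc]
    refine mul_le_mul_of_nonneg_left ?_ (by linarith)
    have h3 : φ (x + A) - φ (x + A) * φ' (-x + B) ≤ 1 - φ' (-x + B) := by
      nlinarith [w.lt1 (x + A), w'.lt1 (-x + B)]
    refine h3.trans ((w'.up _).trans_eq ?_)
    rw [mul_assoc, ← Real.exp_add]
    congr 2
    ring)
  refine h1.trans ?_
  rw [integral_const_mul, integral_exp_mul_Iic hg]
  have h4 := (w'.low _ h0).trans_eq (by rw [← hX])
  have h5 := h4.trans (cross_small w w' hX)
  have e : p * (K * Real.exp (-(gam' * B))) * (Real.exp (gam' * X) / gam') =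
      p * K / (gam' * c) * (c * Real.exp (-(gam' * (-X + B)))) := by
    have : -(gam' * (-X + B)) = -(gam' * B) + gam' * X := by ring
    rw [this, Real.exp_add]
    field_simp
  rw [e]
  exact mul_le_mul_of_nonneg_left h5 (by positivity)

theorem vm_comm (φ φ' : ℝ → ℝ) (A B x : ℝ) : vm φ φ' A B (-x) = vm φ' φ B A x := by
  unfold vm; rw [neg_neg, min_comm]

theorem init_int (w : Wave p lam gam K c z0 φ s G J) (w' : Wave p lam' gam' K c z0 φ' s' G' J') :
    ∃ D S0, 0 < D ∧ ∀ A B, S0 ≤ A + B →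
      ∫ x, (vm φ φ' A B x ^ p - (φ (x + A) * φ' (-x + B)) ^ p) ≤ D * Real.exp (-(th gam gam' * (A + B))) := by
  have hp := w.p1
  have hK := w.K1
  have hg := w'.gam0
  have hg' := w.gam0
  have hc := w.c0
  obtain ⟨S0, hS⟩ := cross_nonneg w w'
  refine ⟨p * K / (gam' * c) * K + p * K / (gam * c) * K, S0, by positivity, fun A B hAB => ?_⟩
  obtain ⟨X, hX⟩ := cross w w' A B
  obtain ⟨hX1, hX2⟩ := hS A B X hAB hX
  have key : ∀ x, (φ (x + A) * φ' (-x + B)) ≤ vm φ φ' A B x := fun x => le_min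
    (mul_le_of_le_one_right (w.pos _).le (w'.lt1 _).le) (mul_le_of_le_one_left (w'.pos _).le (w.lt1 _).le)
  have hI : Integrable (fun x => vm φ φ' A B x ^ p - (φ (x + A) * φ' (-x + B)) ^ p) := by
    refine (vmp_int w w' A B).mono' ?_ (Eventually.of_forall fun x => ?_)
    · have := w.cont
      have := w'.cont
      exact (((rpow_cont hp).comp (vm_cont w w' A B)).sub ((rpow_cont hp).comp
        (show Continuous (fun x => φ (x + A) * φ' (-x + B)) by fun_prop))).aestronglyMeasurable
    · have h0 : 0 < φ (x + A) * φ' (-x + B) := mul_pos (w.pos _) (w'.pos _)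
      have h1 := Real.rpow_le_rpow h0.le (key x) (by linarith : 0 ≤ p)
      have h2 := Real.rpow_pos_of_pos h0 p
      rw [Real.norm_eq_abs, abs_le]
      constructor <;> linarith
  have hX' : φ' (-X + B) = φ (- -X + A) := by rw [neg_neg, hX]
  have hI' : Integrable (fun x => vm φ' φ B A x ^ p - (φ' (x + B) * φ (-x + A)) ^ p) := by
    have := hI.comp_neg
    refine this.congr (Eventually.of_forall fun x => ?_)
    simp only [vm_comm, neg_neg, mul_comm]
  have h1 := init_half w w' hX hX2 hI
  have h2 := init_half w' w hX' (by rwa [neg_neg]) hI'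
  have h3 := integral_comp_neg_Ioi X (fun x => vm φ' φ B A x ^ p - (φ' (x + B) * φ (-x + A)) ^ p)
  rw [← h3] at h2
  simp only [vm_comm, neg_neg] at h2
  rw [← intervalIntegral.integral_Iic_add_Ioi (b := X) hI.integrableOn hI.integrableOn]
  have e1 : th gam' gam = th gam gam' := by unfold th; rw [mul_comm, add_comm]
  have e2 : ∀ x, φ' (-x + B) * φ (x + A) = φ (x + A) * φ' (-x + B) := fun x => mul_comm _ _
  simp only [e1, add_comm B A, e2] at h2
  linarith only [h1, h2]

end
end AMS

namespace AMS

theorem int_exp_abs : Integrable (fun x : ℝ => Real.exp (-|x|)) := by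
  have h1 : IntegrableOn (fun x : ℝ => Real.exp (1 * x)) (Set.Iic 0) := integrableOn_exp_mul_Iic one_pos 0
  have h2 : IntegrableOn (fun x : ℝ => Real.exp (-1 * x)) (Set.Ioi 0) := integrableOn_exp_mul_Ioi (by norm_num) 0
  rw [← integrableOn_univ, ← Set.Iic_union_Ioi (a := (0:ℝ))]
  refine IntegrableOn.union (h1.congr_fun (fun x hx => ?_) measurableSet_Iic)
    (h2.congr_fun (fun x hx => ?_) measurableSet_Ioi)
  · simp only [abs_of_nonpos (Set.mem_Iic.1 hx), one_mul, neg_neg]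
  · simp only [abs_of_pos (Set.mem_Ioi.1 hx), neg_mul, one_mul]

theorem tendsto_exp_neg_abs : Tendsto (fun x : ℝ => Real.exp (-|x|)) atTop (𝓝 0) ∧
    Tendsto (fun x : ℝ => Real.exp (-|x|)) atBot (𝓝 0) :=
  ⟨Real.tendsto_exp_neg_atTop_nhds_zero.comp tendsto_abs_atTop_atTop,
   Real.tendsto_exp_neg_atTop_nhds_zero.comp tendsto_abs_atBot_atTop⟩

section
variable {p N Q : ℝ} {g s G J : ℝ → ℝ}

theorem Good.bdG (h : Good p N Q g s G J) (hp : 1 < p) (x : ℝ) : |G x + 1| ≤ N + 1 := by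
  have h1 := h.hN x
  have h2 := h.G0 x
  have h3 : 0 ≤ p * s x ^ 2 := by positivity
  rw [abs_le]; constructor <;> linarith

theorem Good.int_of_le (h : Good p N Q g s G J) {F : ℝ → ℝ} (hF : Continuous F) {L : ℝ} (hL : 0 ≤ L)
    (hb : ∀ x, |F x| ≤ L * g x) : Integrable F := by
  obtain ⟨C, hC⟩ := h.dec
  refine (int_exp_abs.const_mul (L * C)).mono' hF.aestronglyMeasurable (Eventually.of_forall fun x => ?_)
  rw [Real.norm_eq_abs]
  refine (hb x).trans ?_
  have := mul_le_mul_of_nonneg_left (hC x) hL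
  linarith

theorem Good.powle (h : Good p N Q g s G J) (hp : 1 < p) (x : ℝ) : g x ^ p ≤ g x := by
  have := Real.rpow_le_rpow_of_exponent_ge (h.pos x) (h.le1 x) hp.le
  rwa [Real.rpow_one] at this

theorem Good.int (h : Good p N Q g s G J) : Integrable g :=
  h.int_of_le h.cont zero_le_one fun x => by rw [abs_of_pos (h.pos x), one_mul]

theorem Good.intp (h : Good p N Q g s G J) (hp : 1 < p) : Integrable (fun x => g x ^ p) :=
  h.int_of_le ((rpow_cont hp).comp h.cont) zero_le_one fun x => by
    show |g x ^ p| ≤ _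
    rw [abs_of_pos (Real.rpow_pos_of_pos (h.pos x) p), one_mul]; exact h.powle hp x

theorem Good.int2 (h : Good p N Q g s G J) (hp : 1 < p) : Integrable (fun x => g x * (G x + 1)) := by
  have := h.contG
  have := h.cont
  have hN : 0 ≤ N + 1 := (abs_nonneg _).trans (h.bdG hp 0)
  refine h.int_of_le (L := N + 1) (by fun_prop) hN fun x => ?_
  rw [abs_mul, abs_of_pos (h.pos x), mul_comm]
  exact mul_le_mul_of_nonneg_right (h.bdG hp x) (h.pos x).le

theorem Good.int2_zero (h : Good p N Q g s G J) (hp : 1 < p) : ∫ x, g x * (G x + 1) = 0 := by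
  obtain ⟨C, hC⟩ := h.dec
  have hb : ∀ x, |g x * s x| ≤ C * Real.exp (-|x|) := fun x => by
    refine le_trans ?_ (hC x)
    rw [abs_mul, abs_of_pos (h.pos x)]
    exact mul_le_of_le_one_right (h.pos x).le (h.s1 x)
  have t1 := tendsto_exp_neg_abs.1.const_mul C
  have t2 := tendsto_exp_neg_abs.2.const_mul C
  rw [mul_zero] at t1 t2
  have := integral_of_hasDerivAt_of_tendsto h.dd (h.int2 hp) (squeeze_zero_norm hb t2) (squeeze_zero_norm hb t1)
  rw [this, sub_zero]

theorem Rothe.I_step {δ : ℝ} {U S G J : ℕ → ℝ → ℝ} (R : Rothe p δ N Q U S G J) (hp : 1 < p) (k : ℕ) :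
    ∫ x, U (k + 1) x ^ p = (∫ x, U k x ^ p) + δ * ((∫ x, U (k + 1) x ^ p) - ∫ x, U (k + 1) x) := by
  have h := R.good (k + 1)
  have e1 : ∀ x, U (k + 1) x ^ p - U k x ^ p = δ * (U (k + 1) x * (G (k + 1) x + 1)) + δ * (U (k + 1) x ^ p - U (k + 1) x) :=
    fun x => by have := R.step k x; linarith
  have e2 := integral_congr_ae (μ := volume) (Eventually.of_forall e1)
  have e3 := integral_add ((h.int2 hp).const_mul δ) (((h.intp hp).sub h.int).const_mul δ)
  simp only [Pi.sub_apply] at e3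
  rw [integral_sub (h.intp hp) ((R.good k).intp hp), e3, integral_const_mul, integral_const_mul, h.int2_zero hp,
    integral_sub (h.intp hp) h.int] at e2
  linarith
end

theorem eta_ineq {p v U e : ℝ} (hp : 1 < p) (he : 0 ≤ e) (hv : 0 < v) (hv1 : v < 1) (hU : 0 < U) (h : U ^ p ≤ (1 + e) * v ^ p) :
    (v ^ p - v) - (U ^ p - U) ≤ (1 - 1 / p) * (v ^ p - U ^ p) + e * v := by
  have hp0 : 0 < p := by linarith
  have hev : 0 ≤ e * v := by positivity
  rcases le_total U v with h1 | h1
  · have h2 := rpow_sub_le hp hU.le h1 hv1.le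
    have h3 : 1 / p * (v ^ p - U ^ p) ≤ v - U := by
      rw [one_div, inv_mul_le_iff₀ hp0]; exact h2
    linarith
  · have h2 : U ≤ (1 + e) * v := by
      rw [← Real.rpow_le_rpow_iff hU.le (by positivity) hp0, Real.mul_rpow (by positivity) hv.le]
      refine h.trans (mul_le_mul_of_nonneg_right ?_ (Real.rpow_pos_of_pos hv p).le)
      have := Real.rpow_le_rpow_of_exponent_le (by linarith : 1 ≤ 1 + e) hp.le
      rwa [Real.rpow_one] at this
    have h3 : 0 ≤ 1 / p * (U ^ p - v ^ p) := by
      have := Real.rpow_le_rpow hv.le h1 hp0.le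
      have : 0 ≤ U ^ p - v ^ p := by linarith
      positivity
    linarith

section
variable {p lam lam' gam gam' K c z0 : ℝ} {φ s G J φ' s' G' J' : ℝ → ℝ}

theorem U_le (w : Wave p lam gam K c z0 φ s G J) (w' : Wave p lam' gam' K c z0 φ' s' G' J')
    {δ N Q L : ℝ} (hδ : 0 < δ) (hδ1 : δ < 1) (hL : Lw p lam ≤ L) (hL' : Lw p lam' ≤ L) (hLδ : L * δ ≤ 1)
    {U S GU JU : ℕ → ℝ → ℝ} (R : Rothe p δ N Q U S GU JU) (A B : ℝ)
    (h0 : U 0 = fun x => φ (x + A) * φ' (-x + B)) (k : ℕ) (x : ℝ) :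
    U k x ^ p ≤ (1 + δ * (1 + L * δ) ^ k) * vm φ φ' (A - lam * (k * δ)) (B - lam' * (k * δ)) x ^ p := by
  have h1 := w.compare hδ hδ1 hL hLδ R A (fun x => by
    rw [h0]; exact mul_le_of_le_one_right (w.pos _).le (w'.lt1 _).le) k x
  have h2 := w'.compare hδ hδ1 hL' hLδ R.refl B (fun x => by
    simp only [h0, neg_neg]; exact mul_le_of_le_one_left (w'.pos _).le (w.lt1 _).le) k (-x)
  simp only [neg_neg] at h2
  unfold vm
  rcases min_choice (φ (x + (A - lam * (k * δ)))) (φ' (-x + (B - lam' * (k * δ)))) with h | h <;> rw [h]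
  exacts [h1, h2]

theorem E_step (w : Wave p lam gam K c z0 φ s G J) (w' : Wave p lam' gam' K c z0 φ' s' G' J')
    {δ N Q e W : ℝ} (hδ : 0 < δ) (hl : lam * δ ≤ 1) (hl' : lam' * δ ≤ 1) (hδe : δ ≤ e) (he : e ≤ 1)
    {U S GU JU : ℕ → ℝ → ℝ} (R : Rothe p δ N Q U S GU JU) (A B : ℝ) (hW : ∫ x, vm φ φ' A B x ≤ W) (k : ℕ)
    (hU : ∀ x, U (k + 1) x ^ p ≤ (1 + e) * vm φ φ' A B x ^ p) :
    (∫ x, vm φ φ' (A - lam * δ) (B - lam' * δ) x ^ p) - (∫ x, U (k + 1) x ^ p) ≤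
      (1 + (1 - 1 / p) * δ) * ((∫ x, vm φ φ' A B x ^ p) - ∫ x, U k x ^ p)
        + δ * (2 * K ^ 2 * Real.exp (-(th gam gam' * (A + B)))) + δ * (e * ((C2 p * (lam ^ 2 + lam' ^ 2) + 3) * W)) := by
  have hp := w.p1
  have hp0 : 0 < p := by linarith
  have he0 : 0 ≤ e := by linarith
  have h := R.good (k + 1)
  have v1 := V_step w w' A B hδ.le hl hl'
  have iv := vm_int w w' A B
  have ivp := vmp_int w w' A B
  have i1 := R.I_step hp k
  have hW0 : 0 ≤ W := (integral_nonneg fun x => (vm_pos w w' A B x).le).trans hW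
  have hV : ∫ x, vm φ φ' A B x ^ p ≤ W := by
    refine le_trans (integral_mono ivp iv fun x => ?_) hW
    exact (le_abs_self _).trans (abs_rpow_le hp (vm_pos w w' A B x) (vm_lt w A B x))
  have hUv : ∫ x, U (k + 1) x ≤ 2 * W := by
    have : ∫ x, U (k + 1) x ≤ ∫ x, 2 * vm φ φ' A B x := integral_mono h.int (iv.const_mul 2) fun x => by
      have hv := vm_pos w w' A B x
      show U (k + 1) x ≤ 2 * vm φ φ' A B x
      rw [← Real.rpow_le_rpow_iff (h.pos x).le (by positivity) hp0, Real.mul_rpow (by positivity) hv.le]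
      refine (hU x).trans (mul_le_mul_of_nonneg_right ?_ (Real.rpow_pos_of_pos hv p).le)
      have := Real.rpow_le_rpow_of_exponent_le (by norm_num : (1:ℝ) ≤ 2) hp.le
      rw [Real.rpow_one] at this
      linarith
    rw [integral_const_mul] at this
    linarith
  have hUp : 0 ≤ ∫ x, U (k + 1) x ^ p := integral_nonneg fun x => (Real.rpow_pos_of_pos (h.pos x) p).le
  have key : (∫ x, (vm φ φ' A B x ^ p - vm φ φ' A B x)) - ((∫ x, U (k + 1) x ^ p) - ∫ x, U (k + 1) x) ≤
      (1 - 1 / p) * ((∫ x, vm φ φ' A B x ^ p) - ∫ x, U (k + 1) x ^ p) + e * ∫ x, vm φ φ' A B x := by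
    have := integral_mono ((ivp.sub iv).sub ((h.intp hp).sub h.int)) (((ivp.sub (h.intp hp)).const_mul (1 - 1 / p)).add (iv.const_mul e))
      (fun x => eta_ineq hp he0 (vm_pos w w' A B x) (vm_lt w A B x) (h.pos x) (hU x))
    have a1 := integral_sub (ivp.sub iv) ((h.intp hp).sub h.int)
    have a2 := integral_sub (h.intp hp) h.int
    have a3 := integral_add ((ivp.sub (h.intp hp)).const_mul (1 - 1 / p)) (iv.const_mul e)
    have a4 := integral_sub ivp (h.intp hp)
    simp only [Pi.sub_apply, Pi.add_apply] at this a1 a3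
    rw [a1, a2, a3, integral_const_mul, integral_const_mul, a4] at this
    exact this
  obtain ⟨V, hVd⟩ : ∃ V, V = ∫ x, vm φ φ' A B x ^ p := ⟨_, rfl⟩
  obtain ⟨Y, hYd⟩ : ∃ V, V = ∫ x, vm φ φ' A B x := ⟨_, rfl⟩
  obtain ⟨Z, hZd⟩ : ∃ V, V = ∫ x, (vm φ φ' A B x ^ p - vm φ φ' A B x) := ⟨_, rfl⟩
  obtain ⟨I, hId⟩ : ∃ V, V = ∫ x, U (k + 1) x ^ p := ⟨_, rfl⟩
  obtain ⟨I0, hI0d⟩ : ∃ V, V = ∫ x, U k x ^ p := ⟨_, rfl⟩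
  obtain ⟨u, hud⟩ : ∃ V, V = ∫ x, U (k + 1) x := ⟨_, rfl⟩
  obtain ⟨C, hCd⟩ : ∃ C, C = C2 p * (lam ^ 2 + lam' ^ 2) := ⟨_, rfl⟩
  have hC : 0 ≤ C := by rw [hCd]; unfold C2; positivity
  rw [← hVd, ← hZd, ← hCd] at v1
  rw [← hVd, ← hI0d, ← hId, ← hCd]
  rw [← hVd, ← hZd, ← hId, ← hud, ← hYd] at key
  rw [← hId, ← hI0d, ← hud] at i1
  rw [← hud] at hUv
  rw [← hId] at hUp
  rw [← hVd] at hV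
  rw [← hYd] at hW
  have hmu : 0 ≤ 1 - 1 / p ∧ 1 - 1 / p ≤ 1 := by
    have : 1 / p ≤ 1 := by rw [div_le_one hp0]; exact hp.le
    have : 0 < 1 / p := by positivity
    constructor <;> linarith
  obtain ⟨μ, hμ⟩ : ∃ μ, μ = 1 - 1 / p := ⟨_, rfl⟩
  rw [← hμ] at key hmu ⊢
  have k1 := mul_le_mul_of_nonneg_left key hδ.le
  have k2 : δ * (μ * (I0 - I)) ≤ δ * (e * (2 * W)) := by
    refine mul_le_mul_of_nonneg_left ?_ hδ.le
    have : I0 - I ≤ δ * (2 * W) := by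
      have := mul_le_mul_of_nonneg_left hUv hδ.le
      have := mul_nonneg hδ.le hUp
      linarith
    have a1 := mul_le_mul_of_nonneg_left this hmu.1
    have a2 := mul_le_mul_of_nonneg_right hmu.2 (show 0 ≤ δ * (2 * W) by positivity)
    have a3 := mul_le_mul_of_nonneg_right hδe (show 0 ≤ 2 * W by positivity)
    linarith
  have k3 : C * δ ^ 2 * V ≤ δ * (e * (C * W)) := by
    have a1 : C * δ ^ 2 * V ≤ C * δ ^ 2 * W := mul_le_mul_of_nonneg_left hV (by positivity)
    have a2 := mul_le_mul_of_nonneg_right hδe (show 0 ≤ δ * C * W by positivity)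
    linarith
  have k4 : δ * (e * Y) ≤ δ * (e * W) := by gcongr
  linarith only [v1, k1, k2, k3, k4, i1]

theorem E_bound (w : Wave p lam gam K c z0 φ s G J) (w' : Wave p lam' gam' K c z0 φ' s' G' J')
    {δ N Q L T e W D d : ℝ} (hδ : 0 < δ) (hδ1 : δ < 1) (hL : Lw p lam ≤ L) (hL' : Lw p lam' ≤ L) (hLδ : L * δ ≤ 1)
    (hl : lam * δ ≤ 1) (hl' : lam' * δ ≤ 1) (hT : 0 ≤ T) (he : e = δ * Real.exp (L * T)) (he1 : e ≤ 1)
    {U S GU JU : ℕ → ℝ → ℝ} (R : Rothe p δ N Q U S GU JU) (A B : ℝ) (hW : ∫ x, vm φ φ' A B x ≤ W)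
    (h0 : U 0 = fun x => φ (x + A) * φ' (-x + B)) (hd : d = th gam gam' * (lam + lam'))
    (hD : 2 * K ^ 2 ≤ D * (d - (1 - 1 / p))) (hD0 : 0 ≤ D)
    (hE0 : (∫ x, vm φ φ' A B x ^ p) - ∫ x, U 0 x ^ p ≤ D * Real.exp (-(th gam gam' * (A + B)))) (k : ℕ) (hk : k * δ ≤ T) :
    (∀ x, U k x ^ p ≤ (1 + e) * vm φ φ' (A - lam * (k * δ)) (B - lam' * (k * δ)) x ^ p) ∧
    (∫ x, vm φ φ' (A - lam * (k * δ)) (B - lam' * (k * δ)) x ^ p) - (∫ x, U k x ^ p) ≤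
      D * Real.exp (-(th gam gam' * (A + B)) + d * (k * δ)) + e * ((C2 p * (lam ^ 2 + lam' ^ 2) + 3) * W) * ((1 + δ) ^ k - 1) := by
  have hp := w.p1
  have hp0 : 0 < p := by linarith
  have hlam := w.lam1
  have hlam' := w'.lam1
  have hC : 0 < C2 p := by unfold C2; positivity
  have hL0 : 0 < L := by
    refine lt_of_lt_of_le ?_ hL
    unfold Lw
    positivity
  have hUe : ∀ k : ℕ, k * δ ≤ T → ∀ x, U k x ^ p ≤ (1 + e) * vm φ φ' (A - lam * (k * δ)) (B - lam' * (k * δ)) x ^ p := fun k hk x => by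
    refine (U_le w w' hδ hδ1 hL hL' hLδ R A B h0 k x).trans ?_
    refine mul_le_mul_of_nonneg_right ?_ (Real.rpow_pos_of_pos (vm_pos w w' _ _ _) p).le
    have h1 : (1 + L * δ) ^ k ≤ Real.exp (L * T) := by
      have : 1 + L * δ ≤ Real.exp (L * δ) := by linarith [Real.add_one_le_exp (L * δ)]
      refine (pow_le_pow_left₀ (by positivity) this k).trans ?_
      rw [← Real.exp_nat_mul]
      refine Real.exp_le_exp.2 ?_
      have := mul_le_mul_of_nonneg_left hk hL0.le
      linarith
    have := mul_le_mul_of_nonneg_left h1 hδ.le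
    linarith
  refine ⟨hUe k hk, ?_⟩
  have hδe : δ ≤ e := by
    rw [he]; exact le_mul_of_one_le_right hδ.le (Real.one_le_exp (by positivity))
  have hW0 : 0 ≤ W := (integral_nonneg fun x => (vm_pos w w' A B x).le).trans hW
  induction k with
  | zero => simpa using hE0
  | succ k ih =>
    have hk' : (k : ℝ) * δ ≤ T := by
      refine le_trans ?_ hk
      push_cast
      nlinarith
    have ih := ih hk'
    have hkδ : 0 ≤ (k : ℝ) * δ := by positivity
    have a1 : A - lam * (k * δ) - lam * δ = A - lam * ((k + 1 : ℕ) * δ) := by push_cast; ring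
    have a2 : B - lam' * (k * δ) - lam' * δ = B - lam' * ((k + 1 : ℕ) * δ) := by push_cast; ring
    have hW' : ∫ x, vm φ φ' (A - lam * (k * δ)) (B - lam' * (k * δ)) x ≤ W := by
      refine le_trans (integral_mono (vm_int w w' _ _) (vm_int w w' A B) fun x => vm_anti w w' ?_ ?_ x) hW
      · have : 0 ≤ lam * (k * δ) := by positivity
        linarith
      · have : 0 ≤ lam' * (k * δ) := by positivity
        linarith
    have hst := E_step w w' hδ hl hl' hδe he1 R (A - lam * (k * δ)) (B - lam' * (k * δ)) hW' k (fun x => by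
      refine (hUe (k + 1) hk x).trans (mul_le_mul_of_nonneg_left ?_ (by linarith))
      refine Real.rpow_le_rpow (vm_pos w w' _ _ _).le (vm_anti w w' ?_ ?_ x) hp0.le
      · rw [← a1]; have : 0 ≤ lam * δ := by positivity
        linarith
      · rw [← a2]; have : 0 ≤ lam' * δ := by positivity
        linarith)
    rw [a1, a2] at hst
    have ey : -(th gam gam' * (A - lam * (k * δ) + (B - lam' * (k * δ)))) = -(th gam gam' * (A + B)) + d * (k * δ) := by
      rw [hd]; ring
    rw [ey] at hst
    have ey2 : -(th gam gam' * (A + B)) + d * ((k + 1 : ℕ) * δ) = (-(th gam gam' * (A + B)) + d * (k * δ)) + d * δ := by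
      push_cast; ring
    rw [ey2, Real.exp_add]
    obtain ⟨y, hy⟩ : ∃ y, y = Real.exp (-(th gam gam' * (A + B)) + d * (k * δ)) := ⟨_, rfl⟩
    rw [← hy] at hst ih ⊢
    have hy0 : 0 < y := by rw [hy]; exact Real.exp_pos _
    obtain ⟨ξ, hξ⟩ : ∃ ξ, ξ = e * ((C2 p * (lam ^ 2 + lam' ^ 2) + 3) * W) := ⟨_, rfl⟩
    rw [← hξ] at hst ih ⊢
    have hξ0 : 0 ≤ ξ := by rw [hξ]; have : 0 ≤ e := by linarith
                           positivity
    have hmu : 0 ≤ 1 - 1 / p ∧ 1 - 1 / p ≤ 1 := by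
      have : 1 / p ≤ 1 := by rw [div_le_one hp0]; exact hp.le
      have : 0 < 1 / p := by positivity
      constructor <;> linarith
    obtain ⟨μ, hμ⟩ : ∃ μ, μ = 1 - 1 / p := ⟨_, rfl⟩
    rw [← hμ] at hst hD hmu
    refine hst.trans ?_
    have b1 := mul_le_mul_of_nonneg_left ih (show 0 ≤ 1 + μ * δ by have := mul_nonneg hmu.1 hδ.le; linarith)
    have b2 : D * (y * (1 + d * δ)) ≤ D * (y * Real.exp (d * δ)) := by
      gcongr
      linarith [Real.add_one_le_exp (d * δ)]
    have b3 := mul_le_mul_of_nonneg_right hD (show 0 ≤ δ * y by positivity)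
    obtain ⟨q, hq⟩ : ∃ q, q = (1 + δ) ^ k - 1 := ⟨_, rfl⟩
    have hq0 : 0 ≤ q := by rw [hq]; linarith [one_le_pow₀ (n := k) (by linarith : (1:ℝ) ≤ 1 + δ)]
    have b4 : (1 + δ) ^ (k + 1) - 1 = q * (1 + δ) + δ := by rw [hq]; ring
    rw [b4]
    rw [← hq] at b1
    have b5 := mul_le_mul_of_nonneg_right hmu.2 (show 0 ≤ ξ * q * δ by positivity)
    linarith only [b1, b2, b3, b5]

end
end AMS

namespace AMS

section
variable {p lam lam' gam gam' K c z0 : ℝ} {φ s G J φ' s' G' J' : ℝ → ℝ}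

theorem exists_small {a b : ℝ} (ha : 0 ≤ a) (hb : 0 < b) : ∃ δ, 0 < δ ∧ ∀ δ', 0 ≤ δ' → δ' ≤ δ → a * δ' ≤ b := by
  refine ⟨b / (a + 1), by positivity, fun δ' h0 h => ?_⟩
  rw [le_div_iff₀ (by positivity)] at h
  linarith

theorem approx (w : Wave p lam gam K c z0 φ s G J) (w' : Wave p lam' gam' K c z0 φ' s' G' J') (h h' d : ℝ)
    (hd : d = (gam * gam' + (p - 1)) / p) : ∃ D > 0, ∃ m0 : ℕ, ∀ m : ℕ, m0 ≤ m → ∃ δ > 0, δ < 1 ∧ δ ≤ 1 / ((m : ℝ) + 1) ∧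
      ∃ U S GU JU, Rothe p δ (Nf p K) (Qf p K) U S GU JU ∧ ∀ k : ℕ, k * δ ≤ 2 * m →
        (∀ x, U k x ^ p ≤ (1 + 1 / ((m : ℝ) + 1)) *
          vm φ φ' (h - lam * (-m + k * δ)) (h' - lam' * (-m + k * δ)) x ^ p) ∧
        (∫ x, vm φ φ' (h - lam * (-m + k * δ)) (h' - lam' * (-m + k * δ)) x ^ p) - (∫ x, U k x ^ p)
          ≤ D * Real.exp (d * (-m + k * δ)) + 1 / ((m : ℝ) + 1) := by
  have hp := w.p1
  have hp0 : 0 < p := by linarith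
  have hlam := w.lam1
  have hlam' := w'.lam1
  have hg := w.gam0
  have hg' := w'.gam0
  have hK := w.K1
  have hdt : d = th gam gam' * (lam + lam') := by
    have e1 := w.gameq
    have e2 := w'.gameq
    rw [hd]
    unfold th
    rw [div_eq_iff hp0.ne', div_mul_eq_mul_div, div_mul_eq_mul_div, eq_div_iff (by positivity)]
    linear_combination gam' * e1 + gam * e2
  have hdm : d - (1 - 1 / p) = gam * gam' / p := by rw [hd]; field_simp; ring
  obtain ⟨D1, S0, hD1, hD1b⟩ := init_int w w'
  obtain ⟨D, hDd⟩ : ∃ D, D = D1 + 2 * K ^ 2 / (gam * gam' / p) := ⟨_, rfl⟩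
  have hD0 : 0 < D := by rw [hDd]; positivity
  have hDD : 2 * K ^ 2 ≤ D * (d - (1 - 1 / p)) := by
    rw [hdm, hDd, add_mul, div_mul_cancel₀ _ (by positivity)]
    have : 0 ≤ D1 * (gam * gam' / p) := by positivity
    linarith
  obtain ⟨m0, hm0⟩ := exists_nat_ge (max S0 (2 * z0) - (h + h'))
  refine ⟨D * Real.exp (-(th gam gam' * (h + h'))), by positivity, m0, fun m hm => ?_⟩
  have hmR : (m0 : ℝ) ≤ m := by exact_mod_cast hm
  have hm0' : (0:ℝ) ≤ m := Nat.cast_nonneg m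
  obtain ⟨A, hA⟩ : ∃ A, A = h + lam * m := ⟨_, rfl⟩
  obtain ⟨B, hB⟩ : ∃ B, B = h' + lam' * m := ⟨_, rfl⟩
  have hAB : max S0 (2 * z0) ≤ A + B := by
    rw [hA, hB]
    nlinarith
  obtain ⟨s1, G1, J1, hgood⟩ := init_good w w' ((le_max_right _ _).trans hAB)
  have hinit := hD1b A B ((le_max_left _ _).trans hAB)
  obtain ⟨L, hLd⟩ : ∃ L, L = max (Lw p lam) (Lw p lam') := ⟨_, rfl⟩
  have hL : Lw p lam ≤ L := by rw [hLd]; exact le_max_left _ _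
  have hL' : Lw p lam' ≤ L := by rw [hLd]; exact le_max_right _ _
  have hC : 0 < C2 p := by unfold C2; positivity
  have hL0 : 0 < L := by
    refine lt_of_lt_of_le ?_ hL
    unfold Lw
    positivity
  obtain ⟨W, hWd⟩ : ∃ W, W = ∫ x, vm φ φ' A B x := ⟨_, rfl⟩
  have hW0 : 0 ≤ W := by rw [hWd]; exact integral_nonneg fun x => (vm_pos w w' A B x).le
  obtain ⟨Z, hZ⟩ : ∃ Z, Z = (C2 p * (lam ^ 2 + lam' ^ 2) + 3) * W := ⟨_, rfl⟩
  have hZ0 : 0 ≤ Z := by rw [hZ]; positivity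
  have hb : 0 < 1 / ((m : ℝ) + 1) := by positivity
  have hb1 : 1 / ((m : ℝ) + 1) ≤ 1 := by rw [div_le_one (by positivity)]; linarith
  have hX := Real.exp_pos (L * (2 * m))
  obtain ⟨δ1, p1, q1⟩ := exists_small hL0.le (zero_lt_one)
  obtain ⟨δ2, p2, q2⟩ := exists_small (a := lam) (by linarith) (zero_lt_one)
  obtain ⟨δ3, p3, q3⟩ := exists_small (a := lam') (by linarith) (zero_lt_one)
  obtain ⟨δ4, p4, q4⟩ := exists_small hX.le hb
  obtain ⟨δ5, p5, q5⟩ := exists_small (a := Real.exp (L * (2 * m)) * Z * Real.exp (2 * m)) (by positivity) hb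
  obtain ⟨δ6, p6, q6⟩ := exists_small (a := 1) (by norm_num) hb
  obtain ⟨δ, hδ, r0, r1, r2, r3, r4, r5, r6⟩ : ∃ δ > 0, δ ≤ 1 / 2 ∧ δ ≤ δ1 ∧ δ ≤ δ2 ∧ δ ≤ δ3 ∧ δ ≤ δ4 ∧ δ ≤ δ5 ∧ δ ≤ δ6 := by
    refine ⟨min (1 / 2) (min δ1 (min δ2 (min δ3 (min δ4 (min δ5 δ6))))), by positivity, ?_⟩
    simp
  have r1 := q1 δ hδ.le r1
  have r2 := q2 δ hδ.le r2
  have r3 := q3 δ hδ.le r3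
  have r4 := q4 δ hδ.le r4
  have r5 := q5 δ hδ.le r5
  have r6 := q6 δ hδ.le r6
  have hN : N0 p ≤ Nf p K := by unfold Nf; linarith
  have hQ : Q1 p (Nf p K) ≤ Qf p K := by
    have := B1_nonneg p (Nf p K)
    have : 0 ≤ (6 * K + 8) ^ 2 + B1 p (Nf p K) * (2 * K + 3) ^ 2 := by positivity
    unfold Qf; linarith
  obtain ⟨U, S, GU, JU, R, hU0⟩ := rothe_exists hp hδ (by linarith) hN hQ hgood
  refine ⟨δ, hδ, by linarith, by linarith, U, S, GU, JU, R, fun k hk => ?_⟩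
  have hE0 : (∫ x, vm φ φ' A B x ^ p) - ∫ x, U 0 x ^ p ≤ D * Real.exp (-(th gam gam' * (A + B))) := by
    rw [← integral_sub (vmp_int w w' A B) ((R.good 0).intp hp), hU0]
    refine hinit.trans ?_
    have : D1 ≤ D := by rw [hDd]; have : 0 ≤ 2 * K ^ 2 / (gam * gam' / p) := by positivity
                        linarith
    gcongr
  obtain ⟨b1, b2⟩ := E_bound w w' hδ (by linarith) hL hL' r1 r2 r3 (T := 2 * m) (by positivity) rfl (by linarith) R A B hWd.ge hU0 hdt hDD hD0.le hE0 k hk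
  have ea : A - lam * (k * δ) = h - lam * (-m + k * δ) := by rw [hA]; ring
  have eb : B - lam' * (k * δ) = h' - lam' * (-m + k * δ) := by rw [hB]; ring
  rw [ea, eb] at b1 b2
  constructor
  · intro x
    refine (b1 x).trans (mul_le_mul_of_nonneg_right ?_ (Real.rpow_pos_of_pos (vm_pos w w' _ _ _) p).le)
    linarith
  · refine b2.trans (add_le_add ?_ ?_)
    · rw [mul_assoc, ← Real.exp_add]
      refine le_of_eq ?_
      congr 2
      rw [hdt, hA, hB]
      ring
    · rw [← hZ]
      refine le_trans ?_ r5
      have : (1 + δ) ^ k - 1 ≤ Real.exp (2 * m) := by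
        have : 1 + δ ≤ Real.exp δ := by linarith [Real.add_one_le_exp δ]
        have := pow_le_pow_left₀ (by positivity) this k
        rw [← Real.exp_nat_mul] at this
        have h2 := Real.exp_le_exp.2 hk
        linarith
      have := mul_le_mul_of_nonneg_left this (show 0 ≤ δ * Real.exp (L * (2 * m)) * Z by positivity)
      linarith

end
end AMS

namespace AMS

theorem lip_of {f f1 : ℝ → ℝ} {K : ℝ} (h : ∀ x, HasDerivAt f (f1 x) x) (hK : ∀ x, |f1 x| ≤ K) (x y : ℝ) :
    |f y - f x| ≤ K * |y - x| := by
  have := Convex.norm_image_sub_le_of_norm_hasDerivWithin_le (f := f) (f' := f1) (s := Set.univ) (C := K)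
    (fun x _ => (h x).hasDerivWithinAt) (fun x _ => hK x) convex_univ (Set.mem_univ x) (Set.mem_univ y)
  exact this

theorem quad_of {f f1 f2 : ℝ → ℝ} {K : ℝ} (h : ∀ x, HasDerivAt f (f1 x) x) (h1 : ∀ x, HasDerivAt f1 (f2 x) x)
    (hK : ∀ x, |f2 x| ≤ K) (x y : ℝ) : |f y - f x - (y - x) * f1 x| ≤ K * (y - x) ^ 2 := by
  have hK0 : 0 ≤ K := (abs_nonneg _).trans (hK 0)
  have := Convex.norm_image_sub_le_of_norm_hasDerivWithin_le (f := fun z => f z - (z - x) * f1 x) (f' := fun z => f1 z - f1 x)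
    (s := Set.uIcc x y) (C := K * |y - x|) (x := x) (y := y)
    (fun z _ => by
      have e := (h z).sub (((hasDerivAt_id z).sub_const x).mul_const (f1 x))
      exact (e.congr_deriv (by simp)).hasDerivWithinAt)
    (fun z hz => by
      rw [Real.norm_eq_abs]
      refine (lip_of h1 hK x z).trans (mul_le_mul_of_nonneg_left ?_ hK0)
      exact Set.abs_sub_left_of_mem_uIcc hz)
    (convex_uIcc x y) Set.left_mem_uIcc Set.right_mem_uIcc
  simp only [Real.norm_eq_abs, sub_self, zero_mul, sub_zero] at this
  have e : f y - f x - (y - x) * f1 x = f y - (y - x) * f1 x - f x := by ring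
  rw [e]
  refine this.trans_eq ?_
  rw [mul_assoc, ← pow_two, sq_abs]

theorem interp {K ε : ℝ} (hK : 0 ≤ K) (hε : 0 < ε) : ∃ η > 0, ∀ f f1 f2 : ℝ → ℝ, (∀ x, HasDerivAt f (f1 x) x) →
    (∀ x, HasDerivAt f1 (f2 x) x) → (∀ x, |f2 x| ≤ K) → (∀ x, |f x| ≤ η) → ∀ x, |f1 x| ≤ ε := by
  obtain ⟨r, hr⟩ : ∃ r, r = ε / (2 * (K + 1)) := ⟨_, rfl⟩
  have hr0 : 0 < r := by rw [hr]; positivity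
  refine ⟨r * ε / 4, by positivity, fun f f1 f2 h h1 hb hf x => ?_⟩
  have h2 := quad_of h h1 hb x (x + r)
  have h3 := hf (x + r)
  have h4 := hf x
  have e : x + r - x = r := by ring
  rw [e] at h2
  have h5 : r * |f1 x| ≤ r * ε / 4 + r * ε / 4 + K * r ^ 2 := by
    have : r * f1 x = (f (x + r) - f x) - (f (x + r) - f x - r * f1 x) := by ring
    rw [← abs_of_pos hr0, ← abs_mul, this, abs_of_pos hr0]
    exact asub (asub h3 h4) h2
  have h6 : K * r ≤ ε / 2 := by
    have : (K + 1) * r = ε / 2 := by rw [hr]; field_simp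
    linarith
  have h7 : r * |f1 x| ≤ r * ε := by nlinarith
  exact le_of_mul_le_mul_left h7 hr0

theorem pow_sub_le {p a b : ℝ} (hp : 1 < p) (hb : 0 ≤ b) (hab : b ≤ a) : (a - b) ^ p ≤ a ^ p - b ^ p := by
  have := Real.add_rpow_le_rpow_add (a := a - b) (b := b) (by linarith) hb hp.le
  rw [sub_add_cancel] at this
  linarith

theorem abs_sub_of_pow {p a b ε : ℝ} (hp : 1 < p) (ha : 0 ≤ a) (hb : 0 ≤ b) (hε : 0 ≤ ε) (h : |a ^ p - b ^ p| ≤ ε ^ p) : |a - b| ≤ ε := by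
  have hp0 : 0 < p := by linarith
  rw [← Real.rpow_le_rpow_iff (abs_nonneg _) hε hp0]
  refine le_trans ?_ h
  rcases le_total a b with h1 | h1
  · rw [abs_sub_comm, abs_of_nonneg (by linarith), abs_sub_comm]
    exact (pow_sub_le hp ha h1).trans (le_abs_self _)
  · rw [abs_of_nonneg (by linarith)]
    exact (pow_sub_le hp hb h1).trans (le_abs_self _)

/-- Uniform bound for all derivatives. -/
noncomputable def KK (N Q : ℝ) : ℝ := N + Q + 3

section
variable {p N Q : ℝ} {g s G J : ℝ → ℝ}

theorem Good.d3' (h : Good p N Q g s G J) (x : ℝ) :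
    HasDerivAt (fun x => g x * (G x + 1)) (g x * (s x * (G x + 1) + J x)) x :=
  ((h.d1 x).mul ((h.d3 x).add_const 1)).congr_deriv (by ring)

theorem Good.NQ (h : Good p N Q g s G J) (hp : 1 < p) : 0 ≤ N ∧ 0 ≤ Q := by
  constructor
  · have h1 := h.hN 0
    have h2 := h.G0 0
    have h3 : 0 ≤ p * s 0 ^ 2 := by positivity
    linarith
  · refine le_trans ?_ (h.hQ 0)
    have := B1_nonneg p N
    positivity

theorem Good.bd1 (h : Good p N Q g s G J) (hp : 1 < p) (x : ℝ) : |g x * s x| ≤ KK N Q := by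
  obtain ⟨h1, h2⟩ := h.NQ hp
  have := amul ((abs_of_pos (h.pos x)).trans_le (h.le1 x)) (h.s1 x)
  unfold KK; linarith

theorem Good.bd2 (h : Good p N Q g s G J) (hp : 1 < p) (x : ℝ) : |g x * (G x + 1)| ≤ N + 1 := by
  obtain ⟨h1, h2⟩ := h.NQ hp
  have := amul ((abs_of_pos (h.pos x)).trans_le (h.le1 x)) (h.bdG hp x)
  linarith

theorem Good.bd2K (h : Good p N Q g s G J) (hp : 1 < p) (x : ℝ) : |g x * (G x + 1)| ≤ KK N Q := by
  obtain ⟨h1, h2⟩ := h.NQ hp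
  have := h.bd2 hp x
  unfold KK; linarith

theorem Good.bd3 (h : Good p N Q g s G J) (hp : 1 < p) (x : ℝ) : |g x * (s x * (G x + 1) + J x)| ≤ KK N Q := by
  obtain ⟨h1, h2⟩ := h.NQ hp
  have hJ : |J x| ≤ Q + 1 := by
    have h3 := h.hQ x
    have h4 : 0 ≤ B1 p N * G x ^ 2 := mul_nonneg (B1_nonneg p N) (sq_nonneg _)
    have h5 : |J x| ^ 2 ≤ Q := by rw [sq_abs]; linarith
    nlinarith [abs_nonneg (J x)]
  have := amul ((abs_of_pos (h.pos x)).trans_le (h.le1 x)) (aadd (amul (h.s1 x) (h.bdG hp x)) hJ)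
  unfold KK; linarith

noncomputable def RR (p : ℝ) (U G : ℕ → ℝ → ℝ) (k : ℕ) (x : ℝ) : ℝ := U k x * (G k x + 1) + (U k x ^ p - U k x)

theorem Rothe.step' {δ : ℝ} {U S G J : ℕ → ℝ → ℝ} (R : Rothe p δ N Q U S G J) (k : ℕ) (x : ℝ) :
    U (k + 1) x ^ p = U k x ^ p + δ * RR p U G (k + 1) x := by
  have := R.step k x
  unfold RR
  linarith

theorem Rothe.RR_bd {δ : ℝ} {U S G J : ℕ → ℝ → ℝ} (R : Rothe p δ N Q U S G J) (hp : 1 < p) (k : ℕ) (x : ℝ) :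
    |RR p U G k x| ≤ KK N Q := by
  have h := R.good k
  obtain ⟨h1, h2⟩ := h.NQ hp
  have h3 : |U k x ^ p - U k x| ≤ 1 := by
    have a1 := h.powle hp x
    have a2 := Real.rpow_pos_of_pos (h.pos x) p
    have a3 := h.le1 x
    rw [abs_le]; constructor <;> linarith
  have := aadd (h.bd2 hp x) h3
  unfold RR KK
  linarith

theorem Rothe.lipρ {δ : ℝ} {U S G J : ℕ → ℝ → ℝ} (R : Rothe p δ N Q U S G J) (hp : 1 < p) (hδ : 0 < δ) (j n : ℕ) (x : ℝ) :
    |U (j + n) x ^ p - U j x ^ p| ≤ KK N Q * (n * δ) := by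
  induction n with
  | zero => simp
  | succ n ih =>
    have e := R.step' (j + n) x
    have : U (j + (n + 1)) x ^ p - U j x ^ p = (U (j + n) x ^ p - U j x ^ p) + δ * RR p U G (j + n + 1) x := by
      rw [← add_assoc, e]; ring
    rw [this]
    refine (aadd ih (amul (abs_of_pos hδ).le (R.RR_bd hp _ x))).trans_eq ?_
    push_cast; ring

/-- modulus of continuity in time -/
theorem time_mod (hp : 1 < p) (hN : 0 ≤ N) (hQ : 0 ≤ Q) {ε : ℝ} (hε : 0 < ε) : ∃ η > 0, ∀ (δ : ℝ) (U S G J : ℕ → ℝ → ℝ), 0 < δ →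
    Rothe p δ N Q U S G J → ∀ j n : ℕ, n * δ ≤ η → ∀ x, |U (j + n) x - U j x| ≤ ε ∧
      |RR p U G (j + n) x - RR p U G j x| ≤ ε := by
  have hK : 0 < KK N Q := by unfold KK; linarith
  obtain ⟨η1, hη1, H1⟩ := interp (K := KK N Q + KK N Q) (by linarith) (show 0 < ε / 3 by positivity)
  obtain ⟨η2, hη2, H2⟩ := interp (K := KK N Q + KK N Q) (by linarith) hη1
  obtain ⟨η3, hηdef⟩ : ∃ η3, η3 = min η2 (ε / 3) := ⟨_, rfl⟩
  have hη3 : 0 < η3 := by rw [hηdef]; positivity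
  have e1 : η3 ≤ η2 := by rw [hηdef]; exact min_le_left _ _
  have e2 : η3 ≤ ε / 3 := by rw [hηdef]; exact min_le_right _ _
  have hηpos := Real.rpow_pos_of_pos hη3 p
  refine ⟨min (η3 ^ p / KK N Q) (ε / 3 / KK N Q), by positivity, fun δ U S G J hδ R j n hn x => ?_⟩
  have hn1 : KK N Q * (n * δ) ≤ η3 ^ p := by
    have := hn.trans (min_le_left _ _)
    rw [le_div_iff₀ hK] at this; linarith
  have hn2 : KK N Q * (n * δ) ≤ ε / 3 := by
    have := hn.trans (min_le_right _ _)
    rw [le_div_iff₀ hK] at this; linarith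
  have g1 := R.good (j + n)
  have g2 := R.good j
  have hu : ∀ x, |U (j + n) x - U j x| ≤ η3 := fun x =>
    abs_sub_of_pow hp (g1.pos x).le (g2.pos x).le hη3.le ((R.lipρ hp hδ j n x).trans hn1)
  have hu1 := H2 (fun x => U (j + n) x - U j x) (fun x => U (j + n) x * S (j + n) x - U j x * S j x)
    (fun x => U (j + n) x * (G (j + n) x + 1) - U j x * (G j x + 1))
    (fun x => (g1.d1 x).sub (g2.d1 x)) (fun x => (g1.dd x).sub (g2.dd x)) (fun x => asub (g1.bd2K hp x) (g2.bd2K hp x))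
    (fun x => (hu x).trans e1)
  have hu2 := H1 (fun x => U (j + n) x * S (j + n) x - U j x * S j x)
    (fun x => U (j + n) x * (G (j + n) x + 1) - U j x * (G j x + 1)) _
    (fun x => (g1.dd x).sub (g2.dd x)) (fun x => (g1.d3' x).sub (g2.d3' x)) (fun x => asub (g1.bd3 hp x) (g2.bd3 hp x)) hu1
  refine ⟨(hu x).trans (by linarith), ?_⟩
  have e : RR p U G (j + n) x - RR p U G j x = (U (j + n) x * (G (j + n) x + 1) - U j x * (G j x + 1)) +
      ((U (j + n) x ^ p - U j x ^ p) - (U (j + n) x - U j x)) := by unfold RR; ring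
  rw [e]
  refine (aadd (hu2 x) (asub ((R.lipρ hp hδ j n x).trans hn2) ((hu x).trans e2))).trans (by linarith)

theorem time_deriv {η ε δ : ℝ} {U S G J : ℕ → ℝ → ℝ} (hδ : 0 < δ) (R : Rothe p δ N Q U S G J)
    (H : ∀ j n : ℕ, n * δ ≤ η → ∀ x, |RR p U G (j + n) x - RR p U G j x| ≤ ε) (j n : ℕ) (hn : n * δ ≤ η) (x : ℝ) :
    |U (j + n) x ^ p - U j x ^ p - n * δ * RR p U G j x| ≤ n * δ * ε := by
  induction n with
  | zero => simp
  | succ n ih =>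
    have h1 := H j (n + 1) hn x
    have hn' : (n : ℝ) * δ ≤ η := by
      refine le_trans ?_ hn
      push_cast; linarith
    have e := R.step' (j + n) x
    have : U (j + (n + 1)) x ^ p - U j x ^ p - (n + 1 : ℕ) * δ * RR p U G j x =
      (U (j + n) x ^ p - U j x ^ p - n * δ * RR p U G j x) + δ * (RR p U G (j + (n + 1)) x - RR p U G j x) := by
      rw [← add_assoc, e]; push_cast; ring
    rw [this]
    refine (aadd (ih hn') (amul (abs_of_pos hδ).le h1)).trans_eq ?_
    push_cast; ring

end
end AMS

namespace AMS

theorem ulim (a : ℕ → ℝ) {C : ℝ} (h : ∀ m, |a m| ≤ C) : ∃ l, Tendsto a (hyperfilter ℕ : Filter ℕ) (𝓝 l) := by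
  have hc : IsCompact (Set.Icc (-C) C) := isCompact_Icc
  obtain ⟨l, -, hl⟩ := hc.ultrafilter_le_nhds ((hyperfilter ℕ).map a) (by
    rw [Ultrafilter.coe_map, le_principal_iff, mem_map]
    exact Filter.univ_mem' fun m => abs_le.1 (h m))
  exact ⟨l, hl⟩

theorem hasDerivAt_of_quad {f : ℝ → ℝ} {f' x K : ℝ} (h : ∀ y, |f y - f x - (y - x) * f'| ≤ K * (y - x) ^ 2) : HasDerivAt f f' x := by
  rw [hasDerivAt_iff_isLittleO, Asymptotics.isLittleO_iff]
  intro c hc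
  have hK : 0 < |K| + 1 := by positivity
  filter_upwards [Metric.ball_mem_nhds x (show 0 < c / (|K| + 1) by positivity)] with y hy
  rw [Metric.mem_ball, Real.dist_eq, lt_div_iff₀ hK] at hy
  rw [Real.norm_eq_abs, Real.norm_eq_abs, smul_eq_mul]
  refine (h y).trans ?_
  rw [← sq_abs, pow_two, ← mul_assoc]
  refine mul_le_mul_of_nonneg_right ?_ (abs_nonneg _)
  have := mul_le_mul_of_nonneg_right (le_abs_self K) (abs_nonneg (y - x))
  nlinarith [abs_nonneg (y - x)]

/-- time index -/
noncomputable def kap (M δ τ : ℝ) : ℕ := ⌊(τ + M) / δ⌋₊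
noncomputable def tt (M δ τ : ℝ) : ℝ := -M + kap M δ τ * δ

theorem kap_mono {M δ : ℝ} (hδ : 0 < δ) {s τ : ℝ} (h : s ≤ τ) : kap M δ s ≤ kap M δ τ := by
  unfold kap
  gcongr

theorem tt_le {M δ τ : ℝ} (hδ : 0 < δ) (h : 0 ≤ τ + M) : tt M δ τ ≤ τ ∧ τ - δ ≤ tt M δ τ := by
  have h1 := Nat.floor_le (show 0 ≤ (τ + M) / δ by positivity)
  have h2 := Nat.lt_floor_add_one ((τ + M) / δ)
  rw [le_div_iff₀ hδ] at h1
  rw [div_lt_iff₀ hδ] at h2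
  unfold tt kap
  constructor <;> linarith

theorem tt_tendsto {M δ : ℕ → ℝ} (hM : Tendsto M atTop atTop) (hδ : ∀ m, 0 < δ m) (hδ0 : Tendsto δ atTop (𝓝 0)) (τ : ℝ) :
    Tendsto (fun m => tt (M m) (δ m) τ) atTop (𝓝 τ) := by
  have h1 : Tendsto (fun m => τ - δ m) atTop (𝓝 (τ - 0)) := hδ0.const_sub τ
  rw [sub_zero] at h1
  have hev : ∀ᶠ m in atTop, 0 ≤ τ + M m := by
    filter_upwards [hM.eventually_ge_atTop (-τ)] with m hm
    linarith
  refine tendsto_of_tendsto_of_tendsto_of_le_of_le' h1 tendsto_const_nhds ?_ ?_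
  · filter_upwards [hev] with m hm using (tt_le (hδ m) hm).2
  · filter_upwards [hev] with m hm using (tt_le (hδ m) hm).1

theorem limit_exists {p N Q : ℝ} (hp : 1 < p) (hN : 0 ≤ N) (hQ : 0 ≤ Q) {M δ : ℕ → ℝ} (hM : Tendsto M atTop atTop)
    (hδ : ∀ m, 0 < δ m) (hδ0 : Tendsto δ atTop (𝓝 0)) {U S G J : ℕ → ℕ → ℝ → ℝ}
    (R : ∀ m, Rothe p (δ m) N Q (U m) (S m) (G m) (J m)) :
    ∃ u a b : ℝ → ℝ → ℝ, (∀ x τ, Tendsto (fun m => U m (kap (M m) (δ m) τ) x) (hyperfilter ℕ : Filter ℕ) (𝓝 (u x τ))) ∧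
      (∀ x τ, HasDerivAt (fun y => u y τ) (a x τ) x) ∧ (∀ x τ, HasDerivAt (fun y => a y τ) (b x τ) x) ∧
      (∀ τ, Continuous (fun x => b x τ)) ∧
      (∀ x τ, HasDerivAt (fun s => u x s ^ p) (b x τ + (u x τ ^ p - u x τ)) τ) ∧
      (∀ x, Continuous (fun τ => b x τ + (u x τ ^ p - u x τ))) ∧
      Continuous (Function.uncurry u) ∧ (∀ x τ, 0 ≤ u x τ) ∧ (∀ x τ, u x τ ≤ 1) ∧
      (∀ x y τ, u x τ * Real.exp (-|x - y|) ≤ u y τ) := by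
  have hg := fun m k => (R m).good k
  choose u hu using fun x τ => ulim (fun m => U m (kap (M m) (δ m) τ) x) (C := 1) (fun m => by
    rw [abs_of_pos ((hg m _).pos x)]; exact (hg m _).le1 x)
  choose a ha using fun x τ => ulim (fun m => U m (kap (M m) (δ m) τ) x * S m (kap (M m) (δ m) τ) x)
    (fun m => (hg m _).bd1 hp x)
  choose b hb using fun x τ => ulim (fun m => U m (kap (M m) (δ m) τ) x * (G m (kap (M m) (δ m) τ) x + 1))
    (fun m => (hg m _).bd2K hp x)
  have hρ : ∀ x τ, Tendsto (fun m => U m (kap (M m) (δ m) τ) x ^ p) (hyperfilter ℕ : Filter ℕ) (𝓝 (u x τ ^ p)) :=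
    fun x τ => (hu x τ).rpow_const (Or.inr (by linarith))
  have hR : ∀ x τ, Tendsto (fun m => RR p (U m) (G m) (kap (M m) (δ m) τ) x) (hyperfilter ℕ : Filter ℕ)
      (𝓝 (b x τ + (u x τ ^ p - u x τ))) := fun x τ => (hb x τ).add ((hρ x τ).sub (hu x τ))
  have h0 : ∀ x τ, 0 ≤ u x τ := fun x τ => ge_of_tendsto (hu x τ) (Eventually.of_forall fun m => ((hg m _).pos x).le)
  have h1 : ∀ x τ, u x τ ≤ 1 := fun x τ => le_of_tendsto (hu x τ) (Eventually.of_forall fun m => (hg m _).le1 x)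
  have hlip : ∀ x y τ, |u y τ - u x τ| ≤ KK N Q * |y - x| := fun x y τ =>
    le_of_tendsto ((hu y τ).sub (hu x τ)).abs (Eventually.of_forall fun m =>
      lip_of (hg m _).d1 ((hg m _).bd1 hp) x y)
  have hd1 : ∀ x τ, HasDerivAt (fun y => u y τ) (a x τ) x := fun x τ => by
    refine hasDerivAt_of_quad (K := KK N Q) fun y => ?_
    exact le_of_tendsto (((hu y τ).sub (hu x τ)).sub ((ha x τ).const_mul (y - x))).abs (Eventually.of_forall fun m =>
      quad_of (hg m _).d1 (hg m _).dd ((hg m _).bd2K hp) x y)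
  have hd2 : ∀ x τ, HasDerivAt (fun y => a y τ) (b x τ) x := fun x τ => by
    refine hasDerivAt_of_quad (K := KK N Q) fun y => ?_
    exact le_of_tendsto (((ha y τ).sub (ha x τ)).sub ((hb x τ).const_mul (y - x))).abs (Eventually.of_forall fun m =>
      quad_of (hg m _).dd (hg m _).d3' ((hg m _).bd3 hp) x y)
  have hK0 : 0 < KK N Q := by unfold KK; linarith
  have hbl : ∀ x y τ, |b y τ - b x τ| ≤ KK N Q * |y - x| := fun x y τ =>
    le_of_tendsto ((hb y τ).sub (hb x τ)).abs (Eventually.of_forall fun m =>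
      lip_of (hg m _).d3' ((hg m _).bd3 hp) x y)
  have hbc : ∀ τ, Continuous (fun x => b x τ) := fun τ => by
    have : LipschitzWith (KK N Q).toNNReal (fun x => b x τ) := LipschitzWith.of_dist_le_mul fun x y => by
      rw [Real.dist_eq, Real.dist_eq, Real.coe_toNNReal _ hK0.le]
      exact hbl y x τ
    exact this.continuous
  have hF : (hyperfilter ℕ : Filter ℕ) ≤ atTop := by
    rw [← Nat.cofinite_eq_atTop]; exact hyperfilter_le_cofinite
  have time : ∀ ε > 0, ∃ η > 0, ∀ x s τ, s ≤ τ → τ - s < η → |u x τ - u x s| ≤ ε ∧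
      |(b x τ + (u x τ ^ p - u x τ)) - (b x s + (u x s ^ p - u x s))| ≤ ε ∧
      |u x τ ^ p - u x s ^ p - (τ - s) * (b x s + (u x s ^ p - u x s))| ≤ (τ - s) * ε := fun ε hε => by
    obtain ⟨η, hη, H⟩ := time_mod hp hN hQ hε
    refine ⟨η, hη, fun x s τ hs hτ => ?_⟩
    obtain ⟨n, hn⟩ : ∃ n : ℕ → ℕ, ∀ m, kap (M m) (δ m) τ = kap (M m) (δ m) s + n m :=
      ⟨fun m => kap (M m) (δ m) τ - kap (M m) (δ m) s, fun m =>
        (Nat.add_sub_cancel' (kap_mono (M := M m) (hδ m) hs)).symm⟩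
    have hnt : Tendsto (fun m => (n m : ℝ) * δ m) (hyperfilter ℕ : Filter ℕ) (𝓝 (τ - s)) := by
      refine Tendsto.mono_left ?_ hF
      refine ((tt_tendsto hM hδ hδ0 τ).sub (tt_tendsto hM hδ hδ0 s)).congr fun m => ?_
      unfold tt
      rw [hn m]; push_cast; ring
    have hev : ∀ᶠ m in (hyperfilter ℕ : Filter ℕ), (n m : ℝ) * δ m ≤ η := hnt.eventually_le_const hτ
    refine ⟨?_, ?_, ?_⟩
    · refine le_of_tendsto ((hu x τ).sub (hu x s)).abs ?_
      filter_upwards [hev] with m hm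
      rw [hn m]
      exact (H _ _ _ _ _ (hδ m) (R m) _ _ hm x).1
    · refine le_of_tendsto ((hR x τ).sub (hR x s)).abs ?_
      filter_upwards [hev] with m hm
      rw [hn m]
      exact (H _ _ _ _ _ (hδ m) (R m) _ _ hm x).2
    · refine le_of_tendsto_of_tendsto (((hρ x τ).sub (hρ x s)).sub (hnt.mul (hR x s))).abs (hnt.mul_const ε) ?_
      filter_upwards [hev] with m hm
      rw [hn m]
      exact time_deriv (hδ m) (R m) (fun j n h x => (H _ _ _ _ _ (hδ m) (R m) _ _ h x).2) _ _ hm x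
  have time2 : ∀ ε > 0, ∃ η > 0, ∀ x s τ, |τ - s| < η → |u x τ - u x s| ≤ ε ∧
      |(b x τ + (u x τ ^ p - u x τ)) - (b x s + (u x s ^ p - u x s))| ≤ ε ∧
      |u x τ ^ p - u x s ^ p - (τ - s) * (b x s + (u x s ^ p - u x s))| ≤ ε * |τ - s| := fun ε hε => by
    obtain ⟨η, hη, H⟩ := time (ε / 2) (by positivity)
    refine ⟨η, hη, fun x s τ hτ => ?_⟩
    rcases le_total s τ with h | h
    · have eτ : |τ - s| = τ - s := abs_of_nonneg (by linarith)
      rw [eτ] at hτ ⊢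
      obtain ⟨c1, c2, c3⟩ := H x s τ h hτ
      refine ⟨by linarith, by linarith, c3.trans ?_⟩
      nlinarith
    · have eτ : |τ - s| = s - τ := by rw [abs_sub_comm]; exact abs_of_nonneg (by linarith)
      rw [eτ] at hτ ⊢
      obtain ⟨c1, c2, c3⟩ := H x τ s h (by linarith)
      refine ⟨by rw [abs_sub_comm]; linarith, by rw [abs_sub_comm]; linarith, ?_⟩
      have e : u x τ ^ p - u x s ^ p - (τ - s) * (b x s + (u x s ^ p - u x s)) =
        -(u x s ^ p - u x τ ^ p - (s - τ) * (b x τ + (u x τ ^ p - u x τ))) +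
          (s - τ) * ((b x s + (u x s ^ p - u x s)) - (b x τ + (u x τ ^ p - u x τ))) := by ring
      rw [e]
      refine (aadd ((abs_neg _).trans_le c3) (amul (abs_of_nonneg (by linarith)).le c2)).trans_eq ?_
      ring
  have hdt : ∀ x τ, HasDerivAt (fun s => u x s ^ p) (b x τ + (u x τ ^ p - u x τ)) τ := fun x τ => by
    rw [hasDerivAt_iff_isLittleO, Asymptotics.isLittleO_iff]
    intro c hc
    obtain ⟨η, hη, H⟩ := time2 c hc
    filter_upwards [Metric.ball_mem_nhds τ hη] with y hy
    rw [Metric.mem_ball, Real.dist_eq] at hy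
    rw [Real.norm_eq_abs, Real.norm_eq_abs, smul_eq_mul]
    exact (H x τ y hy).2.2
  have hRc : ∀ x, Continuous (fun τ => b x τ + (u x τ ^ p - u x τ)) := fun x => by
    rw [Metric.continuous_iff]
    intro τ ε hε
    obtain ⟨η, hη, H⟩ := time2 (ε / 2) (by positivity)
    refine ⟨η, hη, fun y hy => ?_⟩
    rw [Real.dist_eq] at hy ⊢
    exact (H x τ y hy).2.1.trans_lt (by linarith)
  have huc : Continuous (Function.uncurry u) := by
    rw [Metric.continuous_iff]
    rintro ⟨x, τ⟩ ε hε
    obtain ⟨η, hη, H⟩ := time2 (ε / 4) (by positivity)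
    refine ⟨min η (ε / 4 / KK N Q), by positivity, ?_⟩
    rintro ⟨y, s⟩ hy
    rw [Prod.dist_eq, max_lt_iff, Real.dist_eq, Real.dist_eq] at hy
    simp only at hy
    have c1 := (H y τ s (hy.2.trans_le (min_le_left _ _))).1
    have c2 := hlip x y τ
    have c3 := hy.1.trans_le (min_le_right _ _)
    rw [lt_div_iff₀ hK0] at c3
    rw [Real.dist_eq]
    show |u y s - u x τ| < ε
    have e : u y s - u x τ = (u y s - u y τ) + (u y τ - u x τ) := by ring
    rw [e]
    refine (aadd c1 c2).trans_lt (by linarith)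
  refine ⟨u, a, b, hu, hd1, hd2, hbc, hdt, hRc, huc, h0, h1, fun x y τ => ?_⟩
  refine le_of_tendsto_of_tendsto ((hu x τ).mul_const _) (hu y τ) (Eventually.of_forall fun m => ?_)
  refine harnack (hg m _).d1 (fun x => ?_) x y
  rw [abs_mul, abs_of_pos ((hg m _).pos x)]
  exact mul_le_of_le_one_right ((hg m _).pos x).le ((hg m _).s1 x)

/-- Passage to the limit for integrals: equi-Lipschitz dominated sequences along an ultrafilter. -/
theorem limit_integral {f : ℕ → ℝ → ℝ} {g H : ℝ → ℝ} {K I : ℝ} {p : ℝ} (hp : 1 < p) (hlip : ∀ m x y, |f m y - f m x| ≤ K * |y - x|)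
    (h0 : ∀ m x, 0 ≤ f m x)
    (hlim : ∀ x, Tendsto (fun m => f m x) (hyperfilter ℕ : Filter ℕ) (𝓝 (g x))) (hH : Integrable H)
    (hdom : ∀ᶠ m in atTop, ∀ x, f m x ^ p ≤ H x) (e : ℕ → ℝ) (he : Tendsto e atTop (𝓝 0))
    (hI : ∀ᶠ m in atTop, I ≤ (∫ x, f m x ^ p) + e m) : I ≤ ∫ x, g x ^ p := by
  have hF : (hyperfilter ℕ : Filter ℕ) ≤ atTop := by
    rw [← Nat.cofinite_eq_atTop]; exact hyperfilter_le_cofinite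
  have hK0 : 0 ≤ K := by
    have := (abs_nonneg _).trans (hlip 0 0 1)
    simpa using this
  have hglip : ∀ x y, |g y - g x| ≤ K * |y - x| := fun x y =>
    le_of_tendsto ((hlim y).sub (hlim x)).abs (Eventually.of_forall fun m => hlip m x y)
  have hT : Tendsto (fun m => fun q : ℚ => f m q) (hyperfilter ℕ : Filter ℕ) (𝓝 (fun q : ℚ => g q)) :=
    tendsto_pi_nhds.2 fun q => hlim q
  have hcl : MapClusterPt (fun q : ℚ => g q) atTop (fun m => fun q : ℚ => f m q) :=
    (hT.mapClusterPt).mono hF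
  obtain ⟨ψ, hψ, hψt⟩ := MapClusterPt.tendsto_subseq hcl
  have hψt' : ∀ q : ℚ, Tendsto (fun j => f (ψ j) q) atTop (𝓝 (g q)) := fun q => (tendsto_pi_nhds.1 hψt) q
  have hall : ∀ x, Tendsto (fun j => f (ψ j) x) atTop (𝓝 (g x)) := fun x => by
    rw [Metric.tendsto_atTop]
    intro ε hε
    obtain ⟨q, hq1, hq2⟩ := exists_rat_btwn (show x < x + ε / 4 / (K + 1) by
      have : 0 < ε / 4 / (K + 1) := by positivity
      linarith)
    obtain ⟨n, hn⟩ := (Metric.tendsto_atTop.1 (hψt' q)) (ε / 4) (by positivity)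
    refine ⟨n, fun j hj => ?_⟩
    have c1 := hn j hj
    rw [Real.dist_eq] at c1 ⊢
    have hd : K * |x - q| ≤ ε / 4 := by
      have : |x - q| ≤ ε / 4 / (K + 1) := by rw [abs_le]; constructor <;> linarith
      rw [le_div_iff₀ (by positivity)] at this
      nlinarith [abs_nonneg (x - (q:ℝ))]
    have c2 := (hlip (ψ j) q x).trans hd
    have c3 := (hglip q x).trans hd
    have ee : f (ψ j) x - g x = (f (ψ j) x - f (ψ j) q) + ((f (ψ j) q - g q) - (g x - g q)) := by ring
    rw [ee]
    exact (aadd c2 (asub c1.le c3)).trans_lt (by linarith)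
  have hfc : ∀ m, Continuous (f m) := fun m => by
    have : LipschitzWith K.toNNReal (f m) := LipschitzWith.of_dist_le_mul fun x y => by
      rw [Real.dist_eq, Real.dist_eq, Real.coe_toNNReal _ hK0]
      exact hlip m y x
    exact this.continuous
  have hint : Tendsto (fun j => ∫ x, f (ψ j) x ^ p) atTop (𝓝 (∫ x, g x ^ p)) := by
    refine tendsto_integral_filter_of_dominated_convergence H ?_ ?_ hH ?_
    · exact Eventually.of_forall fun j => ((rpow_cont hp).comp (hfc (ψ j))).aestronglyMeasurable
    · filter_upwards [hψ.tendsto_atTop.eventually hdom] with j hj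
      refine Eventually.of_forall fun x => ?_
      rw [Real.norm_eq_abs, abs_of_nonneg (Real.rpow_nonneg (h0 _ _) _)]
      exact hj x
    · exact Eventually.of_forall fun x => (hall x).rpow_const (Or.inr (by linarith))
  have h3 := hint.add (he.comp hψ.tendsto_atTop)
  rw [add_zero] at h3
  exact ge_of_tendsto h3 (hψ.tendsto_atTop.eventually hI)

end AMS

namespace AMS

variable {p lam lam' gam gam' K c z0 : ℝ} {φ s G J φ' s' G' J' : ℝ → ℝ}

theorem merged (w : Wave p lam gam K c z0 φ s G J) (w' : Wave p lam' gam' K c z0 φ' s' G' J') (h h' d : ℝ)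
    (hd : d = (gam * gam' + (p - 1)) / p) : ∃ D > 0, ∃ u a b : ℝ → ℝ → ℝ,
      (∀ x τ, HasDerivAt (fun y => u y τ) (a x τ) x) ∧ (∀ x τ, HasDerivAt (fun y => a y τ) (b x τ) x) ∧
      (∀ τ, Continuous (fun x => b x τ)) ∧
      (∀ x τ, HasDerivAt (fun s => u x s ^ p) (b x τ + (u x τ ^ p - u x τ)) τ) ∧
      (∀ x, Continuous (fun τ => b x τ + (u x τ ^ p - u x τ))) ∧
      Continuous (Function.uncurry u) ∧ (∀ x τ, 0 ≤ u x τ) ∧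
      (∀ x y τ, u x τ * Real.exp (-|x - y|) ≤ u y τ) ∧
      (∀ x τ, u x τ ≤ vm φ φ' (h - lam * τ) (h' - lam' * τ) x) ∧
      (∀ τ, (∫ x, vm φ φ' (h - lam * τ) (h' - lam' * τ) x ^ p) - D * Real.exp (d * τ) ≤ ∫ x, u x τ ^ p) := by
  have hp := w.p1
  have hp0 : 0 < p := by linarith
  have hlam := w.lam1
  have hlam' := w'.lam1
  have hd0 : 0 < d := by
    rw [hd]
    have := mul_pos w.gam0 w'.gam0
    apply div_pos _ hp0
    linarith
  obtain ⟨D, hD, m0, H⟩ := approx w w' h h' d hd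
  choose δ hδ hδ1 hδm U S GU JU R HU using fun m : ℕ => H (m + m0) (Nat.le_add_left _ _)
  have hNQ := ((R 0).good 0).NQ hp
  have hM : Tendsto (fun m : ℕ => ((m + m0 : ℕ) : ℝ)) atTop atTop :=
    tendsto_natCast_atTop_atTop.comp (tendsto_add_atTop_nat m0)
  have he : Tendsto (fun m : ℕ => 1 / (((m + m0 : ℕ) : ℝ) + 1)) atTop (𝓝 0) :=
    (tendsto_one_div_add_atTop_nhds_zero_nat (𝕜 := ℝ)).comp (tendsto_add_atTop_nat m0)
  have hδ0 : Tendsto δ atTop (𝓝 0) := squeeze_zero (fun m => (hδ m).le) hδm he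
  obtain ⟨u, a, b, hu, hd1, hd2, hbc, hdt, hRc, huc, h0, h1, hhar⟩ := limit_exists hp hNQ.1 hNQ.2 hM hδ hδ0 R
  have hF : (hyperfilter ℕ : Filter ℕ) ≤ atTop := by
    rw [← Nat.cofinite_eq_atTop]; exact hyperfilter_le_cofinite
  have hev : ∀ τ : ℝ, ∀ᶠ m : ℕ in atTop, 0 ≤ τ + ((m + m0 : ℕ) : ℝ) ∧
      (kap ((m + m0 : ℕ) : ℝ) (δ m) τ : ℝ) * δ m ≤ 2 * ((m + m0 : ℕ) : ℝ) := fun τ => by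
    filter_upwards [hM.eventually_ge_atTop (-τ), hM.eventually_ge_atTop τ] with m h1 h2
    have h3 : 0 ≤ τ + ((m + m0 : ℕ) : ℝ) := by linarith
    refine ⟨h3, ?_⟩
    have := (tt_le (hδ m) h3).1
    unfold tt at this
    linarith
  have htt := fun τ => tt_tendsto hM hδ hδ0 τ
  refine ⟨D, hD, u, a, b, hd1, hd2, hbc, hdt, hRc, huc, h0, hhar, fun x τ => ?_, fun τ => ?_⟩
  · have hvt : Tendsto (fun m : ℕ => vm φ φ' (h - lam * tt ((m + m0 : ℕ) : ℝ) (δ m) τ) (h' - lam' * tt ((m + m0 : ℕ) : ℝ) (δ m) τ) x) atTop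
        (𝓝 (vm φ φ' (h - lam * τ) (h' - lam' * τ) x)) := by
      have hc : Continuous (fun t : ℝ => vm φ φ' (h - lam * t) (h' - lam' * t) x) := by
        have := w.cont
        have := w'.cont
        unfold vm
        fun_prop
      exact (hc.tendsto τ).comp (htt τ)
    have hr := ((he.const_add 1).mul (hvt.rpow_const (p := p) (Or.inr hp0.le))).mono_left hF
    rw [add_zero, one_mul] at hr
    have hl := (hu x τ).rpow_const (p := p) (Or.inr hp0.le)
    have hle : u x τ ^ p ≤ vm φ φ' (h - lam * τ) (h' - lam' * τ) x ^ p := by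
      refine le_of_tendsto_of_tendsto hl hr ?_
      filter_upwards [hF (hev τ)] with m hm
      exact (HU m _ hm.2).1 x
    exact (Real.rpow_le_rpow_iff (h0 x τ) (vm_pos w w' _ _ _).le hp0).1 hle
  · refine limit_integral (f := fun m x => U m (kap ((m + m0 : ℕ) : ℝ) (δ m) τ) x) (K := KK (Nf p K) (Qf p K))
      (H := fun x => 2 * vm φ φ' (h - lam * (τ - 1)) (h' - lam' * (τ - 1)) x ^ p) hp
      (fun m x y => lip_of ((R m).good _).d1 (((R m).good _).bd1 hp) x y)
      (fun m x => (((R m).good _).pos x).le) (fun x => hu x τ) ((vmp_int w w' _ _).const_mul 2) ?_ _ he ?_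
    · filter_upwards [hev τ] with m hm x
      have h2 := (tt_le (hδ m) hm.1).2
      have h3 := (HU m _ hm.2).1 x
      have h4 : τ - 1 ≤ tt ((m + m0 : ℕ) : ℝ) (δ m) τ := by linarith [hδ1 m]
      refine h3.trans ?_
      have h5 : 1 / (((m + m0 : ℕ) : ℝ) + 1) ≤ 1 := by
        rw [div_le_one (by positivity)]
        linarith [Nat.cast_nonneg (α := ℝ) (m + m0)]
      have h6 : (0:ℝ) < 1 / (((m + m0 : ℕ) : ℝ) + 1) := by positivity
      refine mul_le_mul (by linarith) ?_ (Real.rpow_nonneg (vm_pos w w' _ _ _).le _) (by norm_num)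
      refine Real.rpow_le_rpow (vm_pos w w' _ _ _).le (vm_anti w w' ?_ ?_ x) hp0.le
      · exact sub_le_sub_left (mul_le_mul_of_nonneg_left h4 (by linarith)) h
      · exact sub_le_sub_left (mul_le_mul_of_nonneg_left h4 (by linarith)) h'
    · filter_upwards [hev τ] with m hm
      have h2 : tt ((m + m0 : ℕ) : ℝ) (δ m) τ ≤ τ := (tt_le (hδ m) hm.1).1
      have h3 := (HU m _ hm.2).2
      have h4 : (∫ x, vm φ φ' (h - lam * τ) (h' - lam' * τ) x ^ p) ≤
          ∫ x, vm φ φ' (h - lam * tt ((m + m0 : ℕ) : ℝ) (δ m) τ) (h' - lam' * tt ((m + m0 : ℕ) : ℝ) (δ m) τ) x ^ p := by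
        refine integral_mono (vmp_int w w' _ _) (vmp_int w w' _ _) fun x => ?_
        refine Real.rpow_le_rpow (vm_pos w w' _ _ _).le (vm_anti w w' ?_ ?_ x) hp0.le
        · exact sub_le_sub_left (mul_le_mul_of_nonneg_left h2 (by linarith)) h
        · exact sub_le_sub_left (mul_le_mul_of_nonneg_left h2 (by linarith)) h'
      have h5 : D * Real.exp (d * tt ((m + m0 : ℕ) : ℝ) (δ m) τ) ≤ D * Real.exp (d * τ) := by gcongr
      unfold tt at h4 h5
      linarith

end AMS

open AMS

theorem exists_ancient_merged_solution
    (n : ℕ) (hn : 3 ≤ n)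
    (p lam lam' h h' gam gam' C C' M d : ℝ)
    (hp : p = ((n : ℝ) + 2) / ((n : ℝ) - 2))
    (hlam : 1 < lam) (hlam' : 1 < lam')
    (vl vl' : ℝ → ℝ)
    (hprof : IsTWProfile p lam vl) (hprof' : IsTWProfile p lam' vl')
    (hasym : HasExpAsym p lam gam C vl) (hasym' : HasExpAsym p lam' gam' C' vl')
    (hM : 0 < M)
    (hb : ∀ x ≤ (0:ℝ), vl x ≤ M * Real.exp x)
    (hb' : ∀ x ≤ (0:ℝ), vl' x ≤ M * Real.exp x)
    (hd : d = (gam * gam' + (p - 1)) / p)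
    (v : ℝ → ℝ → ℝ)
    (hv : ∀ x τ, v x τ = min (vl (x - lam * τ + h)) (vl' (-x - lam' * τ + h'))) :
    ∃ T : EReal, ∃ τ₀ : ℝ, (τ₀ : EReal) < T ∧ ∃ D > 0, ∃ u : ℝ → ℝ → ℝ,
      ContinuousOn (Function.uncurry u) {q : ℝ × ℝ | (q.2 : EReal) < T} ∧
      (∀ τ : ℝ, (τ : EReal) < T → ContDiff ℝ 2 (fun x => u x τ)) ∧
      (∀ x : ℝ, ContDiffOn ℝ 1 (fun τ => u x τ) {τ : ℝ | (τ : EReal) < T}) ∧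
      (∀ x : ℝ, ∀ τ : ℝ, (τ : EReal) < T →
        deriv (fun s => u x s ^ p) τ =
          deriv (deriv (fun y => u y τ)) x + u x τ ^ p - u x τ) ∧
      (∀ x : ℝ, ∀ τ : ℝ, (τ : EReal) < T → 0 < u x τ ∧ u x τ ≤ v x τ) ∧
      (∀ τ : ℝ, (τ : EReal) < T →
        Integrable (fun x => v x τ ^ p - u x τ ^ p)) ∧
      (∀ τ ≤ τ₀, (∫ x, |v x τ ^ p - u x τ ^ p|) ≤ D * Real.exp (d * τ)) := by
  have hn3 : (3:ℝ) ≤ n := by exact_mod_cast hn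
  have hp1 : 1 < p := by
    rw [hp, lt_div_iff₀ (by linarith)]
    linarith
  have hp0 : 0 < p := by linarith
  obtain ⟨s, G, J, K, c, z0, w⟩ := wave_exists hp1 hlam hprof hasym hb
  obtain ⟨s', G', J', K', c', z0', w'⟩ := wave_exists hp1 hlam' hprof' hasym' hb'
  have hc := lt_min w.c0 w'.c0
  replace w := w.weaken (le_max_left K K') hc (min_le_left c c') (le_max_left z0 z0')
  replace w' := w'.weaken (le_max_right K K') hc (min_le_right c c') (le_max_right z0 z0')
  have hd0 : 0 < d := by
    rw [hd]
    have := mul_pos w.gam0 w'.gam0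
    apply div_pos _ hp0
    linarith
  have hvv : ∀ x τ, v x τ = vm vl vl' (h - lam * τ) (h' - lam' * τ) x := fun x τ => by
    rw [hv, vm]
    congr 2 <;> ring
  obtain ⟨D, hD, u, a, b, hd1, hd2, hbc, hdt, hRc, huc, h0, hhar, hle, hint⟩ := merged w w' h h' d hd
  have hvint : ∀ τ, Integrable (fun x => v x τ ^ p) := fun τ => by
    simp only [hvv]
    exact vmp_int w w' _ _
  have hv0 : ∀ x τ, 0 < v x τ := fun x τ => by rw [hvv]; exact vm_pos w w' _ _ _
  simp only [← hvv] at hle hint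
  have hpw : ∀ x τ, u x τ ^ p ≤ v x τ ^ p := fun x τ => Real.rpow_le_rpow (h0 x τ) (hle x τ) hp0.le
  have huint : ∀ τ, Integrable (fun x => u x τ ^ p) := fun τ => by
    have hcu : Continuous (fun x => u x τ) := huc.comp (by fun_prop : Continuous fun x : ℝ => (x, τ))
    refine (hvint τ).mono' ((rpow_cont hp1).comp hcu).aestronglyMeasurable (Eventually.of_forall fun x => ?_)
    rw [Real.norm_eq_abs, abs_of_nonneg (Real.rpow_nonneg (h0 _ _) _)]
    exact hpw x τ
  have hI0 : 0 < ∫ x, v x 0 ^ p := by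
    rw [integral_pos_iff_support_of_nonneg (fun x => Real.rpow_nonneg (hv0 x 0).le p) (hvint 0)]
    have : Function.support (fun x => v x 0 ^ p) = Set.univ := by
      ext x
      simp only [Function.mem_support, Set.mem_univ, iff_true]
      exact (Real.rpow_pos_of_pos (hv0 x 0) p).ne'
    rw [this]
    simp
  obtain ⟨T, hT0, hT⟩ : ∃ T : ℝ, T ≤ 0 ∧ D * Real.exp (d * T) < ∫ x, v x 0 ^ p := by
    have ht : Tendsto (fun t : ℝ => D * Real.exp (d * t)) atBot (𝓝 (D * 0)) :=
      (Real.tendsto_exp_atBot.comp (tendsto_id.const_mul_atBot hd0)).const_mul D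
    rw [mul_zero] at ht
    obtain ⟨T, h1, h2⟩ := ((ht.eventually_lt_const hI0).and (eventually_le_atBot 0)).exists
    exact ⟨T, h2, h1⟩
  have hpos : ∀ x τ, τ < T → 0 < u x τ := fun x τ hτ => by
    by_contra hcon
    have hz : ∀ y, u y τ = 0 := fun y => by
      have h1 := hhar y x τ
      have h2 := Real.exp_pos (-|y - x|)
      have h3 := h0 y τ
      by_contra h4
      have h5 : 0 < u y τ := lt_of_le_of_ne h3 (Ne.symm h4)
      have := mul_pos h5 h2
      linarith
    have h1 := hint τ
    simp only [hz, Real.zero_rpow hp0.ne', integral_zero] at h1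
    have h2 : (∫ x, v x 0 ^ p) ≤ ∫ x, v x τ ^ p := by
      refine integral_mono (hvint 0) (hvint τ) fun x => ?_
      refine Real.rpow_le_rpow (hv0 x 0).le ?_ hp0.le
      rw [hvv, hvv]
      refine vm_anti w w' ?_ ?_ x <;> nlinarith
    have h3 : D * Real.exp (d * τ) ≤ D * Real.exp (d * T) := by gcongr
    linarith
  have hset : {τ : ℝ | (τ : EReal) < (T : EReal)} = Set.Iio T := by
    ext τ
    simp
  have hda : ∀ τ, deriv (fun y => u y τ) = fun y => a y τ := fun τ => funext fun y => (hd1 y τ).deriv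
  have hdb : ∀ τ, deriv (fun y => a y τ) = fun y => b y τ := fun τ => funext fun y => (hd2 y τ).deriv
  refine ⟨(T : EReal), T - 1, by exact_mod_cast (by linarith : T - 1 < T), D, hD, u, huc.continuousOn, ?_, ?_, ?_, ?_, ?_, ?_⟩
  · intro τ _
    have e2 : (2 : WithTop ℕ∞) = 1 + 1 := by norm_num
    rw [e2, contDiff_succ_iff_deriv]
    refine ⟨fun y => (hd1 y τ).differentiableAt, by simp, ?_⟩
    rw [hda, contDiff_one_iff_deriv, hdb]
    exact ⟨fun y => (hd2 y τ).differentiableAt, hbc τ⟩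
  · intro x
    rw [hset]
    have h1 : ContDiff ℝ 1 (fun τ => u x τ ^ p) := by
      rw [contDiff_one_iff_deriv]
      refine ⟨fun τ => (hdt x τ).differentiableAt, ?_⟩
      have : deriv (fun τ => u x τ ^ p) = fun τ => b x τ + (u x τ ^ p - u x τ) := funext fun τ => (hdt x τ).deriv
      rw [this]
      exact hRc x
    have h2 : ContDiffOn ℝ 1 (fun τ => (u x τ ^ p) ^ (1 / p)) (Set.Iio T) :=
      h1.contDiffOn.rpow_const_of_ne fun τ hτ => (Real.rpow_pos_of_pos (hpos x τ hτ) p).ne'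
    refine h2.congr fun τ hτ => ?_
    rw [← Real.rpow_mul (h0 x τ), mul_one_div_cancel hp0.ne', Real.rpow_one]
  · intro x τ _
    rw [hda, hdb, (hdt x τ).deriv]
    ring
  · intro x τ hτ
    exact ⟨hpos x τ (by exact_mod_cast hτ), hle x τ⟩
  · intro τ _
    exact (hvint τ).sub (huint τ)
  · intro τ _
    have e : (∫ x, |v x τ ^ p - u x τ ^ p|) = (∫ x, v x τ ^ p) - ∫ x, u x τ ^ p := by
      rw [← integral_sub (hvint τ) (huint τ)]
      refine integral_congr_ae (Eventually.of_forall fun x => ?_)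
      exact abs_of_nonneg (sub_nonneg.2 (hpw x τ))
    rw [e]
    linarith [hint τ]
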